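/- Let β ∈ ℂ with |Re β| < 1/2 and β ≠ 0, let κ ∈ ℂ, κ ≠ 0, satisfy κ² = 1 − e^{−2πiβ}, and fix t ∈ ℝ. Then there exist an Ablowitz–Segur Painlevé II function u for κ and N ∈ ℕ such that for all n ≥ N the Hankel determinant H_n(λ0(n), β) is nonzero (so the monic orthogonal polynomial p_n of degree n with respect to w(·; λ0(n), β) exists), and lim_{n→∞} κ · p_n(λ0(n)) · (2/(n·e))^{n/2} · n^{−1/6} · e^{−t·n^{1/3}} / √(2π) = u(t). (Equivalently, p_n(λ0(n)) = (√(2π)/κ)·(ne/2)^{n/2}·n^{1/6}·e^{t n^{1/3}}·(u(t) + o(1)) as n → ∞.) -/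

import Mathlib

open MeasureTheory Filter Polynomial

noncomputable section

/-- `A` is the Airy function `Ai` and `A'` its derivative: the unique solution of
`A'' = x·A` with `A 0 = 3^(-2/3)/Γ(2/3)` and `A' 0 = -3^(-1/3)/Γ(1/3)`. -/
def IsAiry (A A' : ℝ → ℝ) : Prop :=
  (∀ x : ℝ, HasDerivAt A (A' x) x) ∧ (∀ x : ℝ, HasDerivAt A' (x * A x) x) ∧
  A 0 = (3 : ℝ) ^ (-(2 : ℝ) / 3) / Real.Gamma (2 / 3) ∧
  A' 0 = -((3 : ℝ) ^ (-(1 : ℝ) / 3)) / Real.Gamma (1 / 3)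

/-- An Ablowitz–Segur Painlevé II function for `κ`: a twice differentiable `u : ℝ → ℂ`
with `u'' τ = τ·u τ + 2·(u τ)^3` for all `τ` and `u τ / Ai τ → κ` as `τ → +∞`. -/
def IsAblowitzSegur (A : ℝ → ℝ) (κ : ℂ) (u : ℝ → ℂ) : Prop :=
  Differentiable ℝ u ∧ Differentiable ℝ (deriv u) ∧
  (∀ τ : ℝ, deriv (deriv u) τ = (τ : ℂ) * u τ + 2 * u τ ^ 3) ∧
  Tendsto (fun τ : ℝ => u τ / (A τ : ℂ)) atTop (nhds κ)

/-- The discontinuous Gaussian weight `w(x; λ0, β)`. -/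
def w (l : ℝ) (β : ℂ) (x : ℝ) : ℂ :=
  (Real.exp (-x ^ 2) : ℝ) *
    (if x < l then Complex.exp (Real.pi * Complex.I * β)
     else Complex.exp (-(Real.pi * Complex.I * β)))

/-- The Hankel determinant `H_n(λ0, β)` of the moments of `w(·; λ0, β)` (with `H_0 = 1`). -/
def H (n : ℕ) (l : ℝ) (β : ℂ) : ℂ :=
  Matrix.det (Matrix.of fun j k : Fin n =>
    ∫ x : ℝ, (x : ℂ) ^ ((j : ℕ) + (k : ℕ)) * w l β x)

/-- The scaled jump location `λ0(n) = √(2n)·(1 + (t/2)·n^(-2/3))`. -/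
def lam0 (t : ℝ) (n : ℕ) : ℝ :=
  Real.sqrt (2 * n) * (1 + t / 2 * (n : ℝ) ^ (-(2 : ℝ) / 3))

/-- `p` is the monic orthogonal polynomial of degree `n` for the weight `w(·; l, β)`. -/
def MonicOrthPoly (n : ℕ) (l : ℝ) (β : ℂ) (p : Polynomial ℂ) : Prop :=
  p.Monic ∧ p.natDegree = n ∧
  ∀ m : ℕ, m < n → ∫ x : ℝ, p.eval (x : ℂ) * (x : ℂ) ^ m * w l β x = 0

namespace PR

section

/-- The translated Gaussian `exp (-y² - 2by)`. -/
def gauss (b y : ℝ) : ℝ := Real.exp (-y ^ 2 - 2 * b * y)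

lemma gauss_pos (b y : ℝ) : 0 < gauss b y := Real.exp_pos _

lemma continuous_gauss (b : ℝ) : Continuous (gauss b) := by
  unfold gauss; fun_prop

lemma integrable_pow_mul_gauss (k : ℕ) (b : ℝ) :
    Integrable fun y : ℝ => y ^ k * gauss b y := by
  have h1 : Integrable fun y : ℝ => y ^ k * Real.exp (-(1 / 2) * y ^ 2) := by
    have := integrable_rpow_mul_exp_neg_mul_sq (b := 1 / 2) (by norm_num) (s := k)
      (by have : (0 : ℝ) ≤ k := k.cast_nonneg
          linarith)
    simpa [Real.rpow_natCast] using this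
  refine (h1.norm.const_mul (Real.exp (2 * b ^ 2))).mono'
    ((by fun_prop : Continuous fun y : ℝ => y ^ k).mul
      (continuous_gauss b)).aestronglyMeasurable (Eventually.of_forall fun y => ?_)
  rw [norm_mul, norm_mul, ← mul_assoc, mul_comm (Real.exp _), mul_assoc]
  refine mul_le_mul_of_nonneg_left ?_ (norm_nonneg _)
  rw [gauss, Real.norm_of_nonneg (Real.exp_pos _).le, Real.norm_of_nonneg (Real.exp_pos _).le,
    ← Real.exp_add]
  refine Real.exp_le_exp.2 ?_
  nlinarith [sq_nonneg (y + 2 * b)]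

lemma integrable_eval_mul_gauss (p : ℂ[X]) (b : ℝ) :
    Integrable fun y : ℝ => p.eval (y : ℂ) * (gauss b y : ℂ) := by
  induction p using Polynomial.induction_on' with
  | add p q hp hq =>
    simp only [eval_add, add_mul]
    exact hp.add hq
  | monomial k a =>
    have := ((integrable_pow_mul_gauss k b).ofReal (𝕜 := ℂ)).const_mul a
    refine this.congr (Eventually.of_forall fun y => ?_)
    simp [mul_assoc]

lemma hasDerivAt_gauss (b y : ℝ) : HasDerivAt (gauss b) ((-2 * y - 2 * b) * gauss b y) y := by
  have : HasDerivAt (fun y : ℝ => -y ^ 2 - 2 * b * y) (-2 * y - 2 * b) y := by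
    have h := ((hasDerivAt_pow 2 y).neg).sub ((hasDerivAt_id y).const_mul (2 * b))
    exact h.congr_deriv (by simp)
  exact this.exp.congr_deriv (by simp only [gauss]; ring)

lemma hasDerivAt_eval_mul_gauss (p : ℂ[X]) (b y : ℝ) :
    HasDerivAt (fun y : ℝ => p.eval (y : ℂ) * (gauss b y : ℂ))
      ((derivative p - C 2 * (X + C (b : ℂ)) * p).eval (y : ℂ) * (gauss b y : ℂ)) y := by
  have h1 : HasDerivAt (fun y : ℝ => p.eval (y : ℂ)) ((derivative p).eval (y : ℂ)) y :=
    (p.hasDerivAt (y : ℂ)).comp_ofReal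
  have h2 := (hasDerivAt_gauss b y).ofReal_comp
  refine (h1.mul h2).congr_deriv ?_
  simp only [eval_sub, eval_mul, eval_add, eval_C, eval_X]
  push_cast
  ring

lemma integral_deriv_gauss (p : ℂ[X]) (b : ℝ) :
    ∫ y : ℝ, (derivative p - C 2 * (X + C (b : ℂ)) * p).eval (y : ℂ) * (gauss b y : ℂ) = 0 :=
  integral_eq_zero_of_hasDerivAt_of_integrable
    (fun y => hasDerivAt_eval_mul_gauss p b y)
    (integrable_eval_mul_gauss _ b) (integrable_eval_mul_gauss p b)

lemma integral_Ioi_deriv_gauss (p : ℂ[X]) (b l : ℝ) :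
    ∫ y in Set.Ioi l, (derivative p - C 2 * (X + C (b : ℂ)) * p).eval (y : ℂ) * (gauss b y : ℂ)
      = -(p.eval (l : ℂ) * gauss b l) := by
  have h0 : Tendsto (fun y : ℝ => p.eval (y : ℂ) * (gauss b y : ℂ)) atTop (nhds 0) :=
    tendsto_zero_of_hasDerivAt_of_integrableOn_Ioi (a := l)
      (fun y _ => hasDerivAt_eval_mul_gauss p b y)
      (integrable_eval_mul_gauss _ b).integrableOn (integrable_eval_mul_gauss p b).integrableOn
  rw [integral_Ioi_of_hasDerivAt_of_tendsto' (fun y _ => hasDerivAt_eval_mul_gauss p b y)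
    (integrable_eval_mul_gauss _ b).integrableOn h0, zero_sub]

/-- The functional `f ↦ ∫ f(y) e^{-y²-2by} (1 - γ 1_{y>0}) dy` on polynomials. -/
def L (γ : ℂ) (b : ℝ) : ℂ[X] →ₗ[ℂ] ℂ where
  toFun f := (∫ y : ℝ, f.eval (y : ℂ) * (gauss b y : ℂ)) -
    γ * ∫ y in Set.Ioi (0 : ℝ), f.eval (y : ℂ) * (gauss b y : ℂ)
  map_add' f g := by
    simp only [eval_add, add_mul]
    rw [integral_add (integrable_eval_mul_gauss f b) (integrable_eval_mul_gauss g b),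
      integral_add (integrable_eval_mul_gauss f b).integrableOn
        (integrable_eval_mul_gauss g b).integrableOn]
    ring
  map_smul' c f := by
    simp only [eval_smul, smul_eq_mul, mul_assoc, integral_const_mul, RingHom.id_apply]
    ring

lemma L_apply (γ : ℂ) (b : ℝ) (f : ℂ[X]) :
    L γ b f = (∫ y : ℝ, f.eval (y : ℂ) * (gauss b y : ℂ)) -
      γ * ∫ y in Set.Ioi (0 : ℝ), f.eval (y : ℂ) * (gauss b y : ℂ) := rfl

lemma L_C_mul (γ : ℂ) (b : ℝ) (c : ℂ) (f : ℂ[X]) : L γ b (C c * f) = c * L γ b f := by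
  rw [← smul_eq_C_mul, map_smul, smul_eq_mul]

lemma L_derivative (γ : ℂ) (b : ℝ) (f : ℂ[X]) :
    L γ b (derivative f) = 2 * L γ b (X * f) + 2 * b * L γ b f + γ * f.eval 0 := by
  have h : L γ b (derivative f - C 2 * (X + C (b : ℂ)) * f) = γ * f.eval 0 := by
    rw [L_apply, integral_deriv_gauss, integral_Ioi_deriv_gauss]
    simp [gauss]
  have e : derivative f - C 2 * (X + C (b : ℂ)) * f
      = derivative f - (C 2 * (X * f) + C (2 * (b : ℂ)) * f) := by
    rw [C_mul]; ring
  rw [e, map_sub, map_add, L_C_mul, L_C_mul] at h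
  linear_combination h

lemma hasDerivAt_L_X_pow (γ : ℂ) (k : ℕ) (b : ℝ) :
    HasDerivAt (fun b : ℝ => L γ b (X ^ k)) (-2 * L γ b (X ^ (k + 1))) b := by
  have key : ∀ μ : Measure ℝ, μ ≤ volume →
      HasDerivAt (fun b : ℝ => ∫ y, (X ^ k : ℂ[X]).eval (y : ℂ) * (gauss b y : ℂ) ∂μ)
        (∫ y, -2 * ((X ^ (k + 1) : ℂ[X]).eval (y : ℂ) * (gauss b y : ℂ)) ∂μ) b := by
    intro μ hμ
    have hInt : ∀ (p : ℂ[X]) (b : ℝ),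
        Integrable (fun y : ℝ => p.eval (y : ℂ) * (gauss b y : ℂ)) μ :=
      fun p b => (integrable_eval_mul_gauss p b).mono_measure hμ
    have hg : ∀ x ∈ Metric.ball b 1, ∀ y : ℝ,
        gauss x y ≤ gauss (b + 1) y + gauss (b - 1) y := by
      intro x hx y
      rw [Metric.mem_ball, Real.dist_eq, abs_lt] at hx
      rcases le_total 0 y with hy | hy
      · have : gauss x y ≤ gauss (b - 1) y := Real.exp_le_exp.2 (by nlinarith [hx.1])
        linarith [gauss_pos (b + 1) y]
      · have : gauss x y ≤ gauss (b + 1) y := Real.exp_le_exp.2 (by nlinarith [hx.2])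
        linarith [gauss_pos (b - 1) y]
    refine (hasDerivAt_integral_of_dominated_loc_of_deriv_le (μ := μ)
      (F := fun x y => (X ^ k : ℂ[X]).eval (y : ℂ) * (gauss x y : ℂ))
      (F' := fun x y => -2 * ((X ^ (k + 1) : ℂ[X]).eval (y : ℂ) * (gauss x y : ℂ)))
      (bound := fun y => 2 * (‖(X ^ (k + 1) : ℂ[X]).eval (y : ℂ) * (gauss (b + 1) y : ℂ)‖ +
        ‖(X ^ (k + 1) : ℂ[X]).eval (y : ℂ) * (gauss (b - 1) y : ℂ)‖))
      (Metric.ball_mem_nhds b one_pos)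
      (Eventually.of_forall fun x => (hInt _ x).aestronglyMeasurable) (hInt _ b)
      ((hInt _ b).const_mul _).aestronglyMeasurable
      (Eventually.of_forall fun y x hx => ?_)
      (((hInt _ _).norm.add (hInt _ _).norm).const_mul 2)
      (Eventually.of_forall fun y x _ => ?_)).2
    · simp only [norm_mul, norm_neg, Complex.norm_ofNat, Complex.norm_real, Real.norm_eq_abs,
        abs_of_pos (gauss_pos _ _), ← mul_add]
      have := hg x hx y
      gcongr
    · have h1 : HasDerivAt (fun x : ℝ => gauss x y) (gauss x y * (-2 * y)) x := by
        have : HasDerivAt (fun x : ℝ => -y ^ 2 - 2 * x * y) (-2 * y) x := by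
          have h := (((hasDerivAt_id x).const_mul 2).mul_const y).const_sub (-y ^ 2)
          exact h.congr_deriv (by simp)
        exact this.exp
      refine ((h1.ofReal_comp).const_mul ((X ^ k : ℂ[X]).eval (y : ℂ))).congr_deriv ?_
      simp only [eval_pow, eval_X]
      push_cast
      ring
  have h1 := key volume le_rfl
  have h2 := key (volume.restrict (Set.Ioi 0)) Measure.restrict_le_self
  refine (h1.sub (h2.const_mul γ)).congr_deriv ?_
  rw [integral_const_mul, integral_const_mul, L_apply]; ring

end

section

/-- `γ` avoids the half-line `[1, ∞)`. -/
def Adm (γ : ℂ) : Prop := ∀ θ : ℝ, 0 ≤ θ → θ ≤ 1 → 1 - γ * θ ≠ 0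

lemma Adm.exists_coercive {γ : ℂ} (hγ : Adm γ) :
    ∃ c : ℝ, 0 < c ∧ ∀ A B : ℝ, 0 ≤ B → B ≤ A → c * A ≤ ‖(A : ℂ) - γ * B‖ := by
  obtain ⟨θ₀, h₀, hmin⟩ := isCompact_Icc.exists_isMinOn (s := Set.Icc (0 : ℝ) 1) ⟨0, by simp⟩
    (f := fun θ : ℝ => ‖1 - γ * θ‖) (by fun_prop)
  refine ⟨‖1 - γ * θ₀‖, norm_pos_iff.2 (hγ θ₀ h₀.1 h₀.2), fun A B hB hBA => ?_⟩
  rcases eq_or_lt_of_le (hB.trans hBA) with hA | hA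
  · simp only [← hA, mul_zero]; positivity
  · have h1 : ‖1 - γ * θ₀‖ ≤ ‖1 - γ * ((B / A : ℝ) : ℂ)‖ :=
      hmin (a := B / A) ⟨by positivity, (div_le_one hA).2 hBA⟩
    have h2 : (A : ℂ) - γ * B = A * (1 - γ * ((B / A : ℝ) : ℂ)) := by
      have : (A : ℂ) ≠ 0 := by exact_mod_cast hA.ne'
      push_cast; field_simp
    rw [h2, norm_mul, Complex.norm_real, Real.norm_of_nonneg hA.le, mul_comm]
    gcongr

/-- The polynomial with conjugated coefficients. -/
def conjPoly (f : ℂ[X]) : ℂ[X] := f.map (starRingEnd ℂ)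

lemma eval_conjPoly (f : ℂ[X]) (y : ℝ) :
    (conjPoly f).eval (y : ℂ) = starRingEnd ℂ (f.eval (y : ℂ)) := by
  have := Polynomial.eval_map_apply (p := f) (starRingEnd ℂ) (y : ℂ)
  rwa [Complex.conj_ofReal] at this

lemma eval_mul_conjPoly (f : ℂ[X]) (y : ℝ) :
    (f * conjPoly f).eval (y : ℂ) = ((‖f.eval (y : ℂ)‖ ^ 2 : ℝ) : ℂ) := by
  rw [eval_mul, eval_conjPoly, Complex.mul_conj, Complex.normSq_eq_norm_sq]

lemma L_mul_conjPoly_ne_zero {γ : ℂ} (hγ : Adm γ) (b : ℝ) {f : ℂ[X]} (hf : f ≠ 0) :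
    L γ b (f * conjPoly f) ≠ 0 := by
  obtain ⟨c, hc, hcoer⟩ := hγ.exists_coercive
  set F : ℝ → ℝ := fun y => ‖f.eval (y : ℂ)‖ ^ 2 * gauss b y with hF
  have hFi : Integrable F := by
    refine (integrable_eval_mul_gauss (f * conjPoly f) b).re.congr
      (Eventually.of_forall fun y => ?_)
    simp only [eval_mul_conjPoly, hF, ← Complex.ofReal_mul]
    rfl
  have hF0 : ∀ y, 0 ≤ F y := fun y => mul_nonneg (sq_nonneg _) (gauss_pos b y).le
  have hL : L γ b (f * conjPoly f) = ((∫ y, F y : ℝ) : ℂ) -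
      γ * ((∫ y in Set.Ioi 0, F y : ℝ) : ℂ) := by
    simp only [L_apply, eval_mul_conjPoly, ← Complex.ofReal_mul, integral_complex_ofReal, hF]
  intro h0
  have h1 := hcoer (∫ y, F y) (∫ y in Set.Ioi 0, F y) (integral_nonneg hF0)
    (setIntegral_le_integral hFi (Eventually.of_forall hF0))
  rw [← hL, h0, norm_zero] at h1
  have h2 : ∫ y, F y = 0 :=
    le_antisymm (nonpos_of_mul_nonpos_right h1 hc) (integral_nonneg hF0)
  have h3 : F =ᵐ[volume] 0 := (integral_eq_zero_iff_of_nonneg hF0 hFi).1 h2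
  have hFc : Continuous F := by
    have : Continuous fun y : ℝ => f.eval (y : ℂ) := f.continuous.comp Complex.continuous_ofReal
    exact (this.norm.pow 2).mul (continuous_gauss b)
  have h4 : F = 0 := (hFc.ae_eq_iff_eq volume continuous_const).1 h3
  apply hf
  refine Polynomial.eq_zero_of_infinite_isRoot f
    ((Set.infinite_range_of_injective Complex.ofReal_injective).mono ?_)
  rintro _ ⟨y, rfl⟩
  have := congrFun h4 y
  simpa [hF, (gauss_pos b y).ne'] using this

section Functional

variable (Λ : ℂ[X] →ₗ[ℂ] ℂ)

lemma functional_C_mul (c : ℂ) (f : ℂ[X]) : Λ (C c * f) = c * Λ f := by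
  rw [← smul_eq_C_mul, map_smul, smul_eq_mul]

lemma functional_mul_eq_sum (g : ℂ[X]) {f : ℂ[X]} {n : ℕ} (hf : f.natDegree < n) :
    Λ (g * f) = ∑ k ∈ Finset.range n, f.coeff k * Λ (g * X ^ k) := by
  conv_lhs => rw [f.as_sum_range_C_mul_X_pow' hf]
  rw [Finset.mul_sum, map_sum]
  refine Finset.sum_congr rfl fun k _ => ?_
  rw [← functional_C_mul]
  congr 1; ring

lemma eq_zero_of_orthogonal {Λ : ℂ[X] →ₗ[ℂ] ℂ} (hΛ : ∀ f, f ≠ 0 → Λ (f * conjPoly f) ≠ 0) {f : ℂ[X]} {n : ℕ} (hf : f.natDegree < n)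
    (h : ∀ k < n, Λ (f * X ^ k) = 0) : f = 0 := by
  by_contra hne
  refine hΛ f hne ?_
  rw [functional_mul_eq_sum Λ f (f := conjPoly f) (n := n) (natDegree_map_le.trans_lt hf)]
  exact Finset.sum_eq_zero fun k hk => by rw [h k (Finset.mem_range.1 hk), mul_zero]

lemma hankel_det_ne_zero {Λ : ℂ[X] →ₗ[ℂ] ℂ} (hΛ : ∀ f, f ≠ 0 → Λ (f * conjPoly f) ≠ 0) (n : ℕ) :
    Matrix.det (Matrix.of fun j k : Fin n => Λ (X ^ ((j : ℕ) + (k : ℕ)))) ≠ 0 := by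
  intro hdet
  obtain ⟨v, hv, hMv⟩ := Matrix.exists_mulVec_eq_zero_iff.2 hdet
  rcases Nat.eq_zero_or_pos n with rfl | hn
  · exact hv (Subsingleton.elim _ _)
  set f : ℂ[X] := ∑ k : Fin n, C (v k) * X ^ (k : ℕ) with hfdef
  have hcoeff : ∀ k : Fin n, f.coeff k = v k := by
    intro k
    simp only [hfdef, finsetSum_coeff, coeff_C_mul_X_pow]
    rw [Finset.sum_eq_single k]
    · simp
    · intro j _ hj
      rw [if_neg]
      exact fun h => hj (Fin.ext h.symm)
    · simp
  have hdeg : f.natDegree < n := by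
    refine lt_of_le_of_lt (natDegree_sum_le_of_forall_le (n := n - 1) _ _ fun k _ => ?_)
      (Nat.sub_lt hn one_pos)
    exact (natDegree_C_mul_X_pow_le _ _).trans (by omega)
  have hf0 : f = 0 := by
    refine eq_zero_of_orthogonal hΛ hdeg fun j hj => ?_
    have := congrFun hMv ⟨j, hj⟩
    simp only [Matrix.mulVec, dotProduct, Matrix.of_apply, Pi.zero_apply] at this
    rw [hfdef, Finset.sum_mul, map_sum, ← this]
    refine Finset.sum_congr rfl fun k _ => ?_
    rw [mul_assoc, functional_C_mul, mul_comm, ← pow_add, add_comm]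
  exact hv (funext fun k => by rw [← hcoeff k, hf0]; simp)

end Functional

/-- The polynomial with coefficients `a 0, …, a n`. -/
def ofCoeffs (n : ℕ) (a : ℕ → ℂ) : ℂ[X] := ∑ k ∈ Finset.range (n + 1), C (a k) * X ^ k

lemma coeff_ofCoeffs (n : ℕ) (a : ℕ → ℂ) (k : ℕ) :
    (ofCoeffs n a).coeff k = if k ≤ n then a k else 0 := by
  simp only [ofCoeffs, finsetSum_coeff, coeff_C_mul_X_pow]
  rw [Finset.sum_ite_eq]
  simp

lemma natDegree_ofCoeffs_le (n : ℕ) (a : ℕ → ℂ) : (ofCoeffs n a).natDegree ≤ n :=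
  natDegree_le_iff_coeff_eq_zero.2 fun k hk => by
    rw [coeff_ofCoeffs, if_neg (by omega)]

lemma contDiff_L_X_pow (γ : ℂ) (m : ℕ) : ∀ k, ContDiff ℝ m (fun b : ℝ => L γ b (X ^ k)) := by
  induction m with
  | zero =>
    intro k
    exact contDiff_zero.2
      (continuous_iff_continuousAt.2 fun b => (hasDerivAt_L_X_pow γ k b).continuousAt)
  | succ m ih =>
    intro k
    have hd : deriv (fun b : ℝ => L γ b (X ^ k)) = fun b => -2 * L γ b (X ^ (k + 1)) :=
      funext fun b => (hasDerivAt_L_X_pow γ k b).deriv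
    have := contDiff_succ_iff_deriv (𝕜 := ℝ) (f := fun b : ℝ => L γ b (X ^ k)) (n := (m : ℕ∞))
    push_cast
    refine this.2 ⟨fun b => (hasDerivAt_L_X_pow γ k b).differentiableAt, by simp, ?_⟩
    rw [hd]
    exact contDiff_const.mul (ih (k + 1))

lemma contDiff_det {n : ℕ} {m : ℕ} {M : ℝ → Matrix (Fin n) (Fin n) ℂ}
    (hM : ∀ i j, ContDiff ℝ m fun b => M b i j) : ContDiff ℝ m fun b => (M b).det := by
  simp only [Matrix.det_apply']
  refine ContDiff.sum fun σ _ => contDiff_const.mul (contDiff_prod fun i _ => hM _ _)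

theorem exists_orthogonal {γ : ℂ} (hγ : Adm γ) (n : ℕ) :
    ∃ a a' a'' : ℝ → ℕ → ℂ, (∀ b, a b n = 1 ∧ a' b n = 0) ∧
      (∀ b k, HasDerivAt (fun b => a b k) (a' b k) b) ∧
      (∀ b k, HasDerivAt (fun b => a' b k) (a'' b k) b) ∧
      ∀ b, ∀ j < n, L γ b (ofCoeffs n (a b) * X ^ j) = 0 := by
  set M : ℝ → Matrix (Fin n) (Fin n) ℂ := fun b =>
    Matrix.of fun j k : Fin n => L γ b (X ^ ((j : ℕ) + (k : ℕ))) with hM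
  set v : ℝ → Fin n → ℂ := fun b j => L γ b (X ^ ((j : ℕ) + n)) with hv
  have hdet : ∀ b, (M b).det ≠ 0 := fun b =>
    hankel_det_ne_zero (fun f hf => L_mul_conjPoly_ne_zero hγ b hf) n
  set a : ℝ → ℕ → ℂ := fun b k => if h : k < n then
    -((M b).det⁻¹ * (M b).cramer (v b) ⟨k, h⟩) else if k = n then 1 else 0 with ha
  have hsmooth : ∀ k, ContDiff ℝ 2 (fun b => a b k) := by
    intro k
    by_cases h : k < n
    · simp only [ha, h, dif_pos, Matrix.cramer_apply]
      refine ((ContDiff.inv (contDiff_det (m := 2) fun i j => contDiff_L_X_pow γ 2 _) hdet).mul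
        (contDiff_det (m := 2) fun i j => ?_)).neg
      simp only [Matrix.updateCol_apply]
      split_ifs
      · exact contDiff_L_X_pow γ 2 _
      · exact contDiff_L_X_pow γ 2 _
    · simp only [ha, h, dif_neg, not_false_eq_true]
      exact contDiff_const
  refine ⟨a, fun b k => deriv (fun b => a b k) b, fun b k => deriv (deriv (fun b => a b k)) b,
    fun b => ⟨by simp [ha], by simp [ha]⟩,
    fun b k => ((hsmooth k).differentiable (by norm_num) b).hasDerivAt, fun b k => ?_,
    fun b j hj => ?_⟩
  · have := ((contDiff_succ_iff_deriv (𝕜 := ℝ) (n := 1)).1 (hsmooth k)).2.2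
    exact (this.differentiable (by norm_num) b).hasDerivAt
  · have h1 := congrFun (Matrix.mulVec_cramer (M b) (v b)) ⟨j, hj⟩
    simp only [Matrix.mulVec, dotProduct, Pi.smul_apply, smul_eq_mul] at h1
    rw [ofCoeffs, Finset.sum_range_succ, add_mul, map_add, Finset.sum_mul, map_sum,
      Finset.sum_range]
    have h2 : L γ b (C (a b n) * X ^ n * X ^ j) = v b ⟨j, hj⟩ := by
      simp [ha, hv, ← pow_add, add_comm]
    have h3 : ∀ i : Fin n, L γ b (C (a b i) * X ^ (i : ℕ) * X ^ j) =
        -(M b).det⁻¹ * (M b ⟨j, hj⟩ i * (M b).cramer (v b) i) := by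
      intro i
      rw [mul_assoc, L_C_mul, ← pow_add, add_comm]
      simp only [ha, i.2, dif_pos, hM, Matrix.of_apply, Fin.eta]
      ring
    rw [h2, Finset.sum_congr rfl fun i _ => h3 i, ← Finset.mul_sum, h1]
    field_simp [hdet b]
    ring

end

section

lemma L_ofCoeffs_mul_X_pow (γ : ℂ) (b : ℝ) (n : ℕ) (a : ℕ → ℂ) (j : ℕ) :
    L γ b (ofCoeffs n a * X ^ j) = ∑ k ∈ Finset.range (n + 1), a k * L γ b (X ^ (k + j)) := by
  rw [ofCoeffs, Finset.sum_mul, map_sum]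
  refine Finset.sum_congr rfl fun k _ => ?_
  rw [mul_assoc, L_C_mul, pow_add]

lemma hasDerivAt_L_ofCoeffs {γ : ℂ} {n : ℕ} {a a' : ℝ → ℕ → ℂ}
    (h : ∀ b k, HasDerivAt (fun b => a b k) (a' b k) b) (b : ℝ) (j : ℕ) :
    HasDerivAt (fun b => L γ b (ofCoeffs n (a b) * X ^ j))
      (L γ b (ofCoeffs n (a' b) * X ^ j) - 2 * L γ b (ofCoeffs n (a b) * X ^ (j + 1))) b := by
  simp only [L_ofCoeffs_mul_X_pow]
  refine (HasDerivAt.fun_sum fun k _ => (h b k).mul (hasDerivAt_L_X_pow γ (k + j) b)).congr_deriv ?_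
  rw [Finset.mul_sum, ← Finset.sum_sub_distrib]
  refine Finset.sum_congr rfl fun k _ => ?_
  rw [add_assoc]
  ring

section

variable {γ : ℂ} {n : ℕ} {a a' a'' : ℝ → ℕ → ℂ}

lemma norming_ne_zero (hγ : Adm γ) {a : ℕ → ℂ} {b : ℝ} (ha : a n = 1)
    (horth : ∀ j < n, L γ b (ofCoeffs n a * X ^ j) = 0) :
    L γ b (ofCoeffs n a * X ^ n) ≠ 0 := by
  intro h0
  have h1 : ofCoeffs n a = 0 := by
    refine eq_zero_of_orthogonal (fun f hf => L_mul_conjPoly_ne_zero hγ b hf) (n := n + 1)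
      (Nat.lt_succ_of_le (natDegree_ofCoeffs_le _ _)) fun k hk => ?_
    rcases Nat.lt_succ_iff_lt_or_eq.1 hk with h | rfl
    · exact horth k h
    · exact h0
  have h2 := coeff_ofCoeffs n a n
  rw [h1] at h2
  simp [ha] at h2

/-- The value at the jump of the monic orthogonal polynomial, as a function of the jump, solves a
closed second order differential equation involving the norming constant. -/
theorem orthogonal_ode (hγ : Adm γ) (hn : 0 < n) (ha : ∀ b, a b n = 1 ∧ a' b n = 0)
    (hd : ∀ b k, HasDerivAt (fun b => a b k) (a' b k) b)
    (hd' : ∀ b k, HasDerivAt (fun b => a' b k) (a'' b k) b)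
    (horth : ∀ b, ∀ j < n, L γ b (ofCoeffs n (a b) * X ^ j) = 0) (b : ℝ) :
    a'' b 0 = 2 * b * a' b 0 - 2 * n * a b 0 +
      2 * γ * a b 0 ^ 2 * a' b 0 / L γ b (ofCoeffs n (a b) * X ^ n) := by
  have hna : a'' b n = 0 := by
    have h1 : (fun b => a' b n) = fun _ => 0 := funext fun b => (ha b).2
    have h2 := hd' b n
    rw [h1] at h2
    exact h2.unique (hasDerivAt_const b 0)
  have h1 : ∀ b, ∀ j < n, L γ b (ofCoeffs n (a' b) * X ^ j) =
      2 * L γ b (ofCoeffs n (a b) * X ^ (j + 1)) := by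
    intro b j hj
    have e : (fun b => L γ b (ofCoeffs n (a b) * X ^ j)) = fun _ => 0 :=
      funext fun b => horth b j hj
    have h := hasDerivAt_L_ofCoeffs (γ := γ) (n := n) hd b j
    rw [e] at h
    linear_combination h.unique (hasDerivAt_const b 0)
  have h2 : ∀ j < n, L γ b (ofCoeffs n (a'' b) * X ^ j) =
      4 * L γ b (ofCoeffs n (a' b) * X ^ (j + 1)) -
        4 * L γ b (ofCoeffs n (a b) * X ^ (j + 2)) := by
    intro j hj
    have e : (fun b => L γ b (ofCoeffs n (a' b) * X ^ j)) =
        fun b => 2 * L γ b (ofCoeffs n (a b) * X ^ (j + 1)) := funext fun b => h1 b j hj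
    have h := hasDerivAt_L_ofCoeffs (γ := γ) (n := n) hd' b j
    rw [e] at h
    have h' := h.unique ((hasDerivAt_L_ofCoeffs (γ := γ) (n := n) hd b (j + 1)).const_mul 2)
    linear_combination h'
  set p := ofCoeffs n (a b) with hp
  set p₁ := ofCoeffs n (a' b) with hp₁
  set p₂ := ofCoeffs n (a'' b) with hp₂
  set h := L γ b (p * X ^ n) with hh
  have hh0 : h ≠ 0 := norming_ne_zero hγ (ha b).1 (horth b)
  have hc : ∀ k, p.coeff k = if k ≤ n then a b k else 0 := coeff_ofCoeffs n _
  have hc₁ : ∀ k, p₁.coeff k = if k ≤ n then a' b k else 0 := coeff_ofCoeffs n _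
  have hc₂ : ∀ k, p₂.coeff k = if k ≤ n then a'' b k else 0 := coeff_ofCoeffs n _
  set β := p₁.coeff (n - 1) with hβ
  have hdeg : p.natDegree ≤ n := natDegree_ofCoeffs_le _ _
  have hdeg₁ : p₁.natDegree < n := by
    refine lt_of_le_of_lt (natDegree_le_iff_coeff_eq_zero.2 fun k hk => ?_)
      (Nat.sub_lt hn one_pos)
    rw [hc₁]
    split_ifs with hk'
    · rw [show k = n by omega, (ha b).2]
    · rfl
  have hpX : ∀ f : ℂ[X], f.natDegree < n → L γ b (p * f) = 0 := by
    intro f hf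
    rw [functional_mul_eq_sum _ _ hf]
    exact Finset.sum_eq_zero fun k hk => by rw [horth b k (Finset.mem_range.1 hk), mul_zero]
  -- the polynomial identity
  set σ : ℂ := 2 * n - 4 * β with hσ
  have hE : p₂ - C (2 * (b : ℂ)) * p₁ + C 2 * (derivative p * X) - C 4 * (p₁ * X) - C σ * p = 0 := by
    refine eq_zero_of_orthogonal (fun f hf => L_mul_conjPoly_ne_zero hγ b hf) (n := n) ?_ ?_
    · refine lt_of_le_of_lt (natDegree_le_iff_coeff_eq_zero.2 fun k hk => ?_)
        (Nat.sub_lt hn one_pos)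
      obtain ⟨m, rfl⟩ : ∃ m, k = m + 1 := ⟨k - 1, by omega⟩
      simp only [coeff_sub, coeff_add, coeff_C_mul, coeff_mul_X, coeff_derivative, hc, hc₂]
      rcases eq_or_ne (m + 1) n with hm | hm
      · have hm' : m = n - 1 := by omega
        have h3 : p₁.coeff (m + 1) = 0 := by rw [hm, hc₁]; simp [(ha b).2]
        have h4 : p₁.coeff m = β := by rw [hm']
        rw [h3, h4, if_pos hm.le, if_pos hm.le, hm, hna, (ha b).1, hσ, ← hm]
        push_cast
        ring
      · have h3 : p₁.coeff (m + 1) = 0 := by rw [hc₁, if_neg (by omega)]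
        have h4 : p₁.coeff m = 0 := by
          rcases eq_or_ne m n with h5 | h5
          · rw [h5, hc₁, (ha b).2, ite_self]
          · rw [hc₁, if_neg (by omega)]
        rw [h3, h4, if_neg (by omega), if_neg (by omega)]
        simp
    · intro k hk
      have e3 := L_derivative γ b (p * X ^ (k + 1))
      have e4 : derivative (p * X ^ (k + 1)) =
          derivative p * X ^ (k + 1) + C ((k : ℂ) + 1) * (p * X ^ k) := by
        rw [derivative_mul, derivative_X_pow]
        simp only [Nat.add_sub_cancel]
        push_cast
        ring
      have e5 : X * (p * X ^ (k + 1)) = p * X ^ (k + 2) := by ring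
      have e6 : (p * X ^ (k + 1)).eval 0 = 0 := by simp
      rw [e4, map_add, L_C_mul, horth b k hk, e5, e6] at e3
      have e7 : (p₂ - C (2 * (b : ℂ)) * p₁ + C 2 * (derivative p * X) - C 4 * (p₁ * X) - C σ * p)
          * X ^ k = p₂ * X ^ k - C (2 * (b : ℂ)) * (p₁ * X ^ k)
          + C 2 * (derivative p * X ^ (k + 1)) - C 4 * (p₁ * X ^ (k + 1)) - C σ * (p * X ^ k) := by
        ring
      rw [e7]
      simp only [map_sub, map_add, L_C_mul]
      rw [horth b k hk, h1 b k hk, h2 k hk]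
      linear_combination 2 * e3
  have hE0 := congrArg (fun f : ℂ[X] => f.eval 0) hE
  simp only [eval_sub, eval_add, eval_mul, eval_C, eval_X, mul_zero, sub_zero, add_zero,
    eval_zero, ← coeff_zero_eq_eval_zero, hc, hc₁, hc₂, zero_le, if_true] at hE0
  -- the norming constant
  have hD := L_derivative γ b (p * p₁)
  have d1 : L γ b (derivative p * p₁) = 2 * n * h := by
    rw [mul_comm, functional_mul_eq_sum _ _ (f := derivative p) (n := n)
      (lt_of_le_of_lt (natDegree_derivative_le p) (by omega))]
    obtain ⟨m, rfl⟩ : ∃ m, n = m + 1 := ⟨n - 1, by omega⟩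
    rw [Finset.sum_range_succ, Finset.sum_eq_zero, zero_add, coeff_derivative, hc,
      if_pos le_rfl, (ha b).1, h1 b m (by omega), hh]
    · push_cast; ring
    · intro k hk
      rw [Finset.mem_range] at hk
      rw [h1 b k (by omega), horth b (k + 1) (by omega)]
      simp
  have d2 : L γ b (p * derivative p₁) = 0 :=
    hpX _ (lt_of_le_of_lt (natDegree_derivative_le _) (by omega))
  have d3 : L γ b (p * p₁) = 0 := hpX _ hdeg₁
  have d4 : L γ b (X * (p * p₁)) = β * h := by
    have : X * (p * p₁) = p * (p₁ * X) := by ring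
    rw [this, functional_mul_eq_sum _ _ (f := p₁ * X) (n := n + 1)
      (lt_of_le_of_lt natDegree_mul_le (by simpa using hdeg₁)), Finset.sum_range_succ,
      Finset.sum_eq_zero, zero_add]
    · obtain ⟨m, rfl⟩ : ∃ m, n = m + 1 := ⟨n - 1, by omega⟩
      rw [coeff_mul_X]
      rfl
    · intro k hk
      rw [horth b k (Finset.mem_range.1 hk), mul_zero]
  rw [derivative_mul, map_add, d1, d2, d3, d4, eval_mul, ← coeff_zero_eq_eval_zero,
    ← coeff_zero_eq_eval_zero, hc, hc₁, if_pos (Nat.zero_le _), if_pos (Nat.zero_le _)] at hD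
  field_simp
  rw [hσ] at hE0
  linear_combination h * hE0 + 2 * a b 0 * hD

end

end

section

/-- Monic Hermite polynomials for the weight `exp (-x²)`. -/
def he : ℕ → ℂ[X]
  | 0 => 1
  | n + 1 => X * he n - C (1 / 2) * derivative (he n)

/-- Real values of the monic Hermite polynomials. -/
def hr : ℕ → ℝ → ℝ
  | 0, _ => 1
  | 1, x => x
  | n + 2, x => x * hr (n + 1) x - (n + 1) / 2 * hr n x

lemma derivative_he (n : ℕ) : derivative (he (n + 1)) = C ((n : ℂ) + 1) * he n := by
  induction n with
  | zero => simp [he]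
  | succ n ih =>
    have h : he (n + 2) = X * he (n + 1) - C (1 / 2) * (C ((n : ℂ) + 1) * he n) := by
      rw [he, ih]
    rw [h]
    have h2 : he (n + 1) = X * he n - C (1 / 2) * derivative (he n) := rfl
    simp only [derivative_sub, derivative_mul, derivative_X, derivative_C, ih, zero_mul, zero_add,
      derivative_add, derivative_one, add_zero,
      Nat.cast_add, Nat.cast_one, C_add, C_1]
    linear_combination (-(C (n : ℂ) + 1) : ℂ[X]) * h2

lemma he_add_two (n : ℕ) : he (n + 2) = X * he (n + 1) - C (((n : ℂ) + 1) / 2) * he n := by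
  rw [he, derivative_he, ← mul_assoc, ← C_mul]
  ring_nf

lemma eval_he (n : ℕ) (x : ℝ) : (he n).eval (x : ℂ) = hr n x := by
  induction n using Nat.twoStepInduction with
  | zero => simp [he, hr]
  | one => simp [he, hr]
  | more n h1 h2 =>
    rw [he_add_two]
    simp [hr, h1, h2]

lemma he_monic (n : ℕ) : (he n).coeff n = 1 ∧ (he n).natDegree ≤ n := by
  induction n with
  | zero => simp [he]
  | succ n ih =>
    have h1 : (derivative (he n)).natDegree ≤ n - 1 :=
      (natDegree_derivative_le _).trans (Nat.sub_le_sub_right ih.2 1)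
    have h2 : (derivative (he n)).coeff (n + 1) = 0 :=
      coeff_eq_zero_of_natDegree_lt (by omega)
    refine ⟨?_, ?_⟩
    · rw [he, coeff_sub, coeff_X_mul, coeff_C_mul, ih.1, h2]; simp
    · rw [he]
      refine (natDegree_sub_le _ _).trans (max_le ?_ ?_)
      · exact natDegree_mul_le.trans (by rw [natDegree_X]; omega)
      · exact (natDegree_C_mul_le _ _).trans (by omega)

/-- The squared norm of the monic Hermite polynomial. -/
def Nn (n : ℕ) : ℝ := Real.sqrt Real.pi * n.factorial / 2 ^ n

lemma Nn_pos (n : ℕ) : 0 < Nn n := by unfold Nn; positivity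

lemma Nn_succ (n : ℕ) : Nn (n + 1) = (n + 1) / 2 * Nn n := by
  unfold Nn; rw [Nat.factorial_succ]; push_cast; field_simp; ring

lemma L_zero_derivative (f : ℂ[X]) : L 0 0 (derivative f) = 2 * L 0 0 (X * f) := by
  rw [L_derivative]; simp

lemma L_he_mul (m : ℕ) : ∀ f : ℂ[X], L 0 0 (he m * f) = (1 / 2) ^ m * L 0 0 (derivative^[m] f) := by
  induction m with
  | zero => intro f; simp [he]
  | succ m ih =>
    intro f
    have h1 := L_zero_derivative (he m * f)
    have e : he (m + 1) * f = X * (he m * f) - C (1 / 2) * (derivative (he m) * f) := by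
      rw [he]; ring
    rw [derivative_mul, map_add, ih] at h1
    rw [e, map_sub, L_C_mul, Function.iterate_succ_apply, pow_succ]
    linear_combination -(1 / 2) * h1

lemma L_one : L 0 0 1 = Real.sqrt Real.pi := by
  rw [L_apply]
  have : ∀ y : ℝ, gauss 0 y = Real.exp (-1 * y ^ 2) := fun y => by simp [gauss]
  simp only [eval_one, one_mul, zero_mul, sub_zero, this]
  rw [integral_complex_ofReal, integral_gaussian]; simp

lemma L_he_mul_of_natDegree_le {m : ℕ} {f : ℂ[X]} (hf : f.natDegree ≤ m) :
    L 0 0 (he m * f) = f.coeff m * Nn m := by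
  have h : derivative^[m] f = C (f.coeff m * m.factorial) := by
    rw [eq_C_of_natDegree_le_zero (p := derivative^[m] f)
      ((natDegree_iterate_derivative f m).trans (by omega)), coeff_iterate_derivative]
    simp [Nat.descFactorial_self, mul_comm]
  rw [L_he_mul, h, ← mul_one (C _), L_C_mul, L_one, Nn]
  push_cast
  rw [one_div, inv_pow]
  ring

lemma L_he_mul_he (m k : ℕ) : L 0 0 (he m * he k) = if m = k then (Nn m : ℂ) else 0 := by
  have key : ∀ m k, k < m → L 0 0 (he m * he k) = 0 := fun m k h => by
    rw [L_he_mul_of_natDegree_le ((he_monic k).2.trans h.le),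
      coeff_eq_zero_of_natDegree_lt ((he_monic k).2.trans_lt h), zero_mul]
  split_ifs with h
  · subst h
    rw [L_he_mul_of_natDegree_le (he_monic m).2, (he_monic m).1, one_mul]
  · rcases lt_or_gt_of_ne h with h | h
    · rw [mul_comm]; exact key _ _ h
    · exact key _ _ h

lemma hermite_expansion (n : ℕ) : ∀ f : ℂ[X], f.natDegree < n →
    f = ∑ k ∈ Finset.range n, C (L 0 0 (he k * f) / Nn k) * he k := by
  induction n with
  | zero => intro f hf; omega
  | succ n ih =>
    intro f hf
    have hN : (Nn n : ℂ) ≠ 0 := by exact_mod_cast (Nn_pos n).ne'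
    have h1 : L 0 0 (he n * f) = f.coeff n * Nn n := L_he_mul_of_natDegree_le (by omega)
    rw [Finset.sum_range_succ, h1, mul_div_assoc, div_self hN, mul_one]
    set g := f - C (f.coeff n) * he n with hg
    have hgn : g.natDegree ≤ n := (natDegree_sub_le _ _).trans
      (max_le (by omega) ((natDegree_C_mul_le _ _).trans (he_monic n).2))
    have hgc : g.coeff n = 0 := by
      rw [hg, coeff_sub, coeff_C_mul, (he_monic n).1]; ring
    have key : g = ∑ k ∈ Finset.range n, C (L 0 0 (he k * g) / Nn k) * he k := by
      rcases Nat.eq_zero_or_pos n with rfl | hn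
      · rw [eq_C_of_natDegree_le_zero hgn, hgc]; simp
      · refine ih g (lt_of_le_of_ne hgn fun h => ?_)
        have : g = 0 := by rw [← leadingCoeff_eq_zero, leadingCoeff, h, hgc]
        rw [this] at h; simp at h; omega
    have e : ∀ k ∈ Finset.range n, C (L 0 0 (he k * g) / Nn k) * he k =
        C (L 0 0 (he k * f) / Nn k) * he k := by
      intro k hk
      have : he k * g = he k * f - C (f.coeff n) * (he k * he n) := by rw [hg]; ring
      rw [this, map_sub, L_C_mul, L_he_mul_he, if_neg (Finset.mem_range.1 hk).ne]
      simp
    rw [Finset.sum_congr rfl e] at key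
    rw [← key, hg]; ring

/-- Hermite functions (not normalized). -/
def phi (n : ℕ) (x : ℝ) : ℝ := hr n x * Real.exp (-x ^ 2 / 2)

lemma hasDerivAt_hr (n : ℕ) (x : ℝ) : HasDerivAt (hr (n + 1)) ((n + 1) * hr n x) x := by
  have h := ((he (n + 1)).hasDerivAt (x : ℂ)).real_of_complex
  simp only [derivative_he, eval_mul, eval_C, eval_he] at h
  have h2 : ((n : ℂ) + 1) * (hr n x : ℂ) = (((n + 1) * hr n x : ℝ) : ℂ) := by push_cast; ring
  simpa only [h2, Complex.ofReal_re] using h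

lemma hr_succ_succ (n : ℕ) (x : ℝ) : hr (n + 2) x = x * hr (n + 1) x - (n + 1) / 2 * hr n x := rfl

lemma hasDerivAt_phi_zero (x : ℝ) : HasDerivAt (phi 0) (-phi 1 x) x := by
  have h1 : HasDerivAt (fun x : ℝ => -x ^ 2 / 2) (-x) x :=
    (((hasDerivAt_pow 2 x).neg).div_const 2).congr_deriv (by simp; ring)
  have h2 := h1.exp
  have : phi 0 = fun x => Real.exp (-x ^ 2 / 2) := by ext; simp [phi, hr]
  rw [this]
  exact h2.congr_deriv (by simp [phi, hr]; ring)

lemma hasDerivAt_phi (n : ℕ) (x : ℝ) :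
    HasDerivAt (phi (n + 1)) ((n + 1) / 2 * phi n x - phi (n + 2) x) x := by
  have h1 : HasDerivAt (fun x : ℝ => -x ^ 2 / 2) (-x) x :=
    (((hasDerivAt_pow 2 x).neg).div_const 2).congr_deriv (by simp; ring)
  exact ((hasDerivAt_hr n x).mul h1.exp).congr_deriv (by rw [phi, phi, hr_succ_succ]; ring)

lemma continuous_phi (n : ℕ) : Continuous (phi n) := by
  rcases n with _ | n
  · exact continuous_iff_continuousAt.2 fun x => (hasDerivAt_phi_zero x).continuousAt
  · exact continuous_iff_continuousAt.2 fun x => (hasDerivAt_phi n x).continuousAt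

lemma phi_mul_phi (j k : ℕ) (x y z : ℝ) : ((phi j (x + z) * phi k (y + z) : ℝ) : ℂ) =
    Real.exp (-(x ^ 2 + y ^ 2) / 2) *
      (((he j).comp (X + C (x : ℂ)) * (he k).comp (X + C (y : ℂ))).eval (z : ℂ) *
        (gauss ((x + y) / 2) z : ℂ)) := by
  have e1 : (z : ℂ) + x = ((x + z : ℝ) : ℂ) := by push_cast; ring
  have e2 : (z : ℂ) + y = ((y + z : ℝ) : ℂ) := by push_cast; ring
  simp only [eval_mul, eval_comp, eval_add, eval_X, eval_C, e1, e2, eval_he, phi, gauss]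
  norm_cast
  have : Real.exp (-(x + z) ^ 2 / 2) * Real.exp (-(y + z) ^ 2 / 2) =
    Real.exp (-(x ^ 2 + y ^ 2) / 2) * Real.exp (-z ^ 2 - 2 * ((x + y) / 2) * z) := by
    rw [← Real.exp_add, ← Real.exp_add]; congr 1; ring
  linear_combination (hr j (x + z) * hr k (y + z)) * this

lemma integrable_phi_mul_phi (j k : ℕ) (x y : ℝ) :
    Integrable fun z : ℝ => phi j (x + z) * phi k (y + z) := by
  have h := (integrable_eval_mul_gauss ((he j).comp (X + C (x : ℂ)) * (he k).comp (X + C (y : ℂ)))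
    ((x + y) / 2)).const_mul (Real.exp (-(x ^ 2 + y ^ 2) / 2) : ℂ)
  simp only [← phi_mul_phi] at h
  simpa using h.re

lemma integral_phi_mul_phi (j k : ℕ) :
    ∫ z : ℝ, phi j z * phi k z = if j = k then Nn j else 0 := by
  have h := L_he_mul_he j k
  have e : ∀ z : ℝ, (he j * he k).eval (z : ℂ) * (gauss 0 z : ℂ) =
      ((phi j z * phi k z : ℝ) : ℂ) := fun z => by
    have := phi_mul_phi j k 0 0 z
    simpa using this.symm
  rw [L_apply] at h
  simp only [e, zero_mul, sub_zero] at h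
  rw [integral_complex_ofReal] at h
  split_ifs at h ⊢ <;> exact_mod_cast h

/-- The Christoffel–Darboux kernel. -/
def Kn (n : ℕ) (x y : ℝ) : ℝ := ∑ k ∈ Finset.range n, phi k x * phi k y / Nn k

lemma hasDerivAt_Kn (n : ℕ) (x y z : ℝ) : HasDerivAt (fun z => Kn (n + 1) (x + z) (y + z))
    (-((phi n (x + z) * phi (n + 1) (y + z) + phi (n + 1) (x + z) * phi n (y + z)) / Nn n)) z := by
  induction n with
  | zero =>
    simp only [Kn, zero_add, Finset.sum_range_one]
    have h1 := (hasDerivAt_phi_zero (x + z)).comp_const_add x z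
    have h2 := (hasDerivAt_phi_zero (y + z)).comp_const_add y z
    exact ((h1.mul h2).div_const _).congr_deriv (by ring)
  | succ n ih =>
    have e : (fun z => Kn (n + 1 + 1) (x + z) (y + z)) = fun z => Kn (n + 1) (x + z) (y + z) +
        phi (n + 1) (x + z) * phi (n + 1) (y + z) / Nn (n + 1) := by
      ext z; rw [Kn, Finset.sum_range_succ]; rfl
    rw [e]
    have h1 := (hasDerivAt_phi n (x + z)).comp_const_add x z
    have h2 := (hasDerivAt_phi n (y + z)).comp_const_add y z
    refine (ih.add ((h1.mul h2).div_const _)).congr_deriv ?_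
    have hN := (Nn_pos n).ne'
    have : ((n : ℝ) + 1) ≠ 0 := by positivity
    rw [Nn_succ]
    field_simp
    ring

lemma Kn_eq_integral (n : ℕ) (x y : ℝ) : Kn (n + 1) x y = (Nn n)⁻¹ *
    ∫ z in Set.Ioi (0 : ℝ),
      (phi n (x + z) * phi (n + 1) (y + z) + phi (n + 1) (x + z) * phi n (y + z)) := by
  have hi : Integrable fun z : ℝ => -((phi n (x + z) * phi (n + 1) (y + z) +
      phi (n + 1) (x + z) * phi n (y + z)) / Nn n) :=
    (((integrable_phi_mul_phi _ _ _ _).add (integrable_phi_mul_phi _ _ _ _)).div_const _).neg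
  have hK : Integrable fun z : ℝ => Kn (n + 1) (x + z) (y + z) :=
    integrable_finsetSum _ fun k _ => (integrable_phi_mul_phi _ _ _ _).div_const _
  have h0 := tendsto_zero_of_hasDerivAt_of_integrableOn_Ioi (a := (0 : ℝ))
    (fun z _ => hasDerivAt_Kn n x y z) hi.integrableOn hK.integrableOn
  have h := integral_Ioi_of_hasDerivAt_of_tendsto' (a := (0 : ℝ))
    (fun z _ => hasDerivAt_Kn n x y z) hi.integrableOn h0
  rw [integral_neg, integral_div] at h
  simp only [add_zero, zero_sub, neg_inj] at h
  rw [← h]; ring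

end

section

section

variable {n : ℕ} {e : ℕ → ℝ → ℝ} {t : ℝ} {g r : ℝ → ℂ}

lemma integrable_ofReal_mul {μ : Measure ℝ} {f : ℝ → ℝ} (hf : MemLp f 2 μ) (hg : MemLp g 2 μ) :
    Integrable (fun s => (f s : ℂ) * g s) μ :=
  hf.ofReal.integrable_mul hg

/-- Bessel's inequality for real functions orthonormal on the line, tested on a half-line. -/
lemma bessel_Ioi (he2 : ∀ k < n, MemLp (e k) 2 volume)
    (horth : ∀ j < n, ∀ k < n, ∫ s, e j s * e k s = if j = k then 1 else 0)
    (hg : MemLp g 2 (volume.restrict (Set.Ioi t))) :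
    ∑ k ∈ Finset.range n, ‖∫ s in Set.Ioi t, (e k s : ℂ) * g s‖ ^ 2 ≤
      ∫ s in Set.Ioi t, ‖g s‖ ^ 2 := by
  set c : ℕ → ℂ := fun k => ∫ s in Set.Ioi t, (e k s : ℂ) * g s with hc
  set S : ℝ → ℂ := fun s => ∑ k ∈ Finset.range n, c k * e k s with hS
  have hS2 : MemLp S 2 volume := memLp_finsetSum _ fun k hk =>
    ((he2 k (Finset.mem_range.1 hk)).ofReal (K := ℂ)).const_mul (c k)
  have hS2' := hS2.restrict (Set.Ioi t)
  have hcs : Integrable (fun s => (starRingEnd ℂ (S s)) * g s) (volume.restrict (Set.Ioi t)) :=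
    hS2'.star.integrable_mul hg
  have h1 : ∫ s in Set.Ioi t, (starRingEnd ℂ (S s)) * g s =
      ((∑ k ∈ Finset.range n, ‖c k‖ ^ 2 : ℝ) : ℂ) := by
    have : ∀ s, (starRingEnd ℂ (S s)) * g s =
        ∑ k ∈ Finset.range n, (starRingEnd ℂ (c k)) * ((e k s : ℂ) * g s) := fun s => by
      simp only [hS, map_sum, map_mul, Complex.conj_ofReal, Finset.sum_mul, mul_assoc]
    simp only [this]
    rw [integral_finsetSum _ fun k hk => (integrable_ofReal_mul
      ((he2 k (Finset.mem_range.1 hk)).restrict _) hg).const_mul _]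
    push_cast
    refine Finset.sum_congr rfl fun k _ => ?_
    rw [integral_const_mul, mul_comm, Complex.mul_conj']
  have h2 : ∫ s, ‖S s‖ ^ 2 = ∑ k ∈ Finset.range n, ‖c k‖ ^ 2 := by
    have hsq : ∀ s, ((‖S s‖ ^ 2 : ℝ) : ℂ) = ∑ j ∈ Finset.range n, ∑ k ∈ Finset.range n,
        (starRingEnd ℂ (c j) * c k) * ((e j s * e k s : ℝ) : ℂ) := fun s => by
      push_cast
      rw [← Complex.conj_mul']
      simp only [hS, map_sum, map_mul, Complex.conj_ofReal, Finset.sum_mul_sum]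
      refine Finset.sum_congr rfl fun j _ => Finset.sum_congr rfl fun k _ => ?_
      ring
    have hInt : ∀ j < n, ∀ k < n, Integrable fun s => ((e j s * e k s : ℝ) : ℂ) :=
      fun j hj k hk => ((he2 j hj).integrable_mul (he2 k hk)).ofReal
    have : ((∫ s, ‖S s‖ ^ 2 : ℝ) : ℂ) = ((∑ k ∈ Finset.range n, ‖c k‖ ^ 2 : ℝ) : ℂ) := by
      rw [← integral_complex_ofReal]
      simp only [hsq]
      rw [integral_finsetSum _ fun j hj => integrable_finsetSum _ fun k hk =>
        (hInt j (Finset.mem_range.1 hj) k (Finset.mem_range.1 hk)).const_mul _, Complex.ofReal_sum]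
      refine Finset.sum_congr rfl fun j hj => ?_
      rw [integral_finsetSum _ fun k hk =>
        (hInt j (Finset.mem_range.1 hj) k (Finset.mem_range.1 hk)).const_mul _,
        Finset.sum_eq_single j]
      · rw [integral_const_mul, integral_complex_ofReal,
          horth j (Finset.mem_range.1 hj) j (Finset.mem_range.1 hj), if_pos rfl,
          Complex.conj_mul']
        simp
      · intro k hk hkj
        rw [integral_const_mul, integral_complex_ofReal,
          horth j (Finset.mem_range.1 hj) k (Finset.mem_range.1 hk), if_neg hkj.symm]
        simp
      · intro h; exact absurd hj h
    exact_mod_cast this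
  have hSi : Integrable fun s => ‖S s‖ ^ 2 := (memLp_two_iff_integrable_sq_norm hS2.1).1 hS2
  have hgi : Integrable (fun s => ‖g s‖ ^ 2) (volume.restrict (Set.Ioi t)) :=
    (memLp_two_iff_integrable_sq_norm hg.1).1 hg
  have h3 : ∫ s in Set.Ioi t, ‖S s‖ ^ 2 ≤ ∫ s, ‖S s‖ ^ 2 :=
    setIntegral_le_integral hSi (Eventually.of_forall fun s => by positivity)
  have h4 : 0 ≤ ∫ s in Set.Ioi t, ‖g s - S s‖ ^ 2 :=
    integral_nonneg fun s => by positivity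
  have h5 : ∀ s, ‖g s - S s‖ ^ 2 = ‖g s‖ ^ 2 + ‖S s‖ ^ 2 - 2 * ((starRingEnd ℂ (S s)) * g s).re := by
    intro s
    rw [← Complex.normSq_eq_norm_sq, Complex.normSq_sub, Complex.normSq_eq_norm_sq,
      Complex.normSq_eq_norm_sq, mul_comm (g s)]
  have h6 : ∫ s in Set.Ioi t, ((starRingEnd ℂ (S s)) * g s).re = ∑ k ∈ Finset.range n, ‖c k‖ ^ 2 := by
    have := integral_re hcs
    simp only [RCLike.re_to_complex] at this
    rw [this, h1, Complex.ofReal_re]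
  simp only [h5] at h4
  have hcr : Integrable (fun s => ((starRingEnd ℂ (S s)) * g s).re) (volume.restrict (Set.Ioi t)) :=
    hcs.re
  have hgs : Integrable (fun s => ‖g s‖ ^ 2 + ‖S s‖ ^ 2) (volume.restrict (Set.Ioi t)) :=
    hgi.add hSi.integrableOn
  rw [integral_sub hgs (hcr.const_mul 2),
    integral_add hgi hSi.integrableOn, integral_const_mul, h6] at h4
  linarith

/-- Coercivity of `1 - γ K` in `L²` of a half-line, for a projection kernel `K`. -/
lemma coercive_Ioi {γ : ℂ} {c0 : ℝ} (hc0 : 0 < c0)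
    (hc : ∀ A B : ℝ, 0 ≤ B → B ≤ A → c0 * A ≤ ‖(A : ℂ) - γ * B‖)
    (he2 : ∀ k < n, MemLp (e k) 2 volume)
    (horth : ∀ j < n, ∀ k < n, ∫ s, e j s * e k s = if j = k then 1 else 0)
    (hg : MemLp g 2 (volume.restrict (Set.Ioi t))) (hr : MemLp r 2 (volume.restrict (Set.Ioi t)))
    (heq : ∀ s ∈ Set.Ioi t, g s = r s + γ * ∑ k ∈ Finset.range n,
      e k s * ∫ y in Set.Ioi t, (e k y : ℂ) * g y) :
    c0 ^ 2 * ∫ s in Set.Ioi t, ‖g s‖ ^ 2 ≤ ∫ s in Set.Ioi t, ‖r s‖ ^ 2 := by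
  have hB := bessel_Ioi he2 horth hg
  set c : ℕ → ℂ := fun k => ∫ s in Set.Ioi t, (e k s : ℂ) * g s with hcdef
  set B : ℝ := ∑ k ∈ Finset.range n, ‖c k‖ ^ 2 with hBdef
  set G : ℝ := ∫ s in Set.Ioi t, ‖g s‖ ^ 2 with hG
  set R : ℝ := ∫ s in Set.Ioi t, ‖r s‖ ^ 2 with hR
  have hgi : Integrable (fun s => ‖g s‖ ^ 2) (volume.restrict (Set.Ioi t)) :=
    (memLp_two_iff_integrable_sq_norm hg.1).1 hg
  have hri : Integrable (fun s => ‖r s‖ ^ 2) (volume.restrict (Set.Ioi t)) :=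
    (memLp_two_iff_integrable_sq_norm hr.1).1 hr
  have hgr : Integrable (fun s => (starRingEnd ℂ (g s)) * r s) (volume.restrict (Set.Ioi t)) :=
    hg.star.integrable_mul hr
  have hge : ∀ k ∈ Finset.range n, Integrable (fun s => (e k s : ℂ) * (starRingEnd ℂ (g s)))
      (volume.restrict (Set.Ioi t)) := fun k hk =>
    integrable_ofReal_mul ((he2 k (Finset.mem_range.1 hk)).restrict _) hg.star
  have hconj : ∀ k, ∫ s in Set.Ioi t, (e k s : ℂ) * (starRingEnd ℂ (g s)) = starRingEnd ℂ (c k) := by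
    intro k
    rw [hcdef, ← integral_conj]
    simp
  have h1 : (G : ℂ) = (∫ s in Set.Ioi t, (starRingEnd ℂ (g s)) * r s) + γ * B := by
    have e1 : ∀ s ∈ Set.Ioi t, ((‖g s‖ ^ 2 : ℝ) : ℂ) = (starRingEnd ℂ (g s)) * r s +
        ∑ k ∈ Finset.range n, (γ * c k) * ((e k s : ℂ) * (starRingEnd ℂ (g s))) := by
      intro s hs
      have h : (starRingEnd ℂ (g s)) * g s = (starRingEnd ℂ (g s)) * (r s + γ * ∑ k ∈ Finset.range n,
        e k s * c k) := by rw [← heq s hs]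
      push_cast
      rw [← Complex.conj_mul', h, mul_add]
      congr 1
      rw [Finset.mul_sum, Finset.mul_sum]
      refine Finset.sum_congr rfl fun k _ => ?_
      ring
    rw [hG, ← integral_complex_ofReal, setIntegral_congr_fun measurableSet_Ioi e1,
      integral_add hgr (integrable_finsetSum _ fun k hk => (hge k hk).const_mul _),
      integral_finsetSum _ fun k hk => (hge k hk).const_mul _]
    congr 1
    rw [hBdef]
    push_cast
    rw [Finset.mul_sum]
    refine Finset.sum_congr rfl fun k _ => ?_
    rw [integral_const_mul, hconj, mul_assoc, Complex.mul_conj']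
  have hB0 : 0 ≤ B := Finset.sum_nonneg fun k _ => by positivity
  have h2 := hc G B hB0 hB
  rw [h1, add_sub_cancel_right] at h2
  have h3 : ‖∫ s in Set.Ioi t, (starRingEnd ℂ (g s)) * r s‖ ≤
      ∫ s in Set.Ioi t, (c0 / 2 * ‖g s‖ ^ 2 + (2 * c0)⁻¹ * ‖r s‖ ^ 2) := by
    refine norm_integral_le_of_norm_le ((hgi.const_mul _).add (hri.const_mul _))
      (Eventually.of_forall fun s => ?_)
    rw [norm_mul, RCLike.norm_conj]
    have h4 := sq_nonneg (c0 * ‖g s‖ - ‖r s‖)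
    have h5 : 0 ≤ (2 * c0)⁻¹ * (c0 * ‖g s‖ - ‖r s‖) ^ 2 := by positivity
    have h6 : (2 * c0)⁻¹ * (c0 * ‖g s‖ - ‖r s‖) ^ 2 =
      c0 / 2 * ‖g s‖ ^ 2 + (2 * c0)⁻¹ * ‖r s‖ ^ 2 - ‖g s‖ * ‖r s‖ := by field_simp; ring
    linarith
  rw [integral_add (hgi.const_mul _) (hri.const_mul _), integral_const_mul, integral_const_mul] at h3
  have h7 : c0 / 2 * G ≤ (2 * c0)⁻¹ * R := by linarith
  have h8 : c0 ^ 2 * G = 2 * c0 * (c0 / 2 * G) := by ring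
  rw [h8]
  calc 2 * c0 * (c0 / 2 * G) ≤ 2 * c0 * ((2 * c0)⁻¹ * R) := by gcongr
    _ = R := by field_simp

end

/-- The integral equation satisfied by a polynomial orthogonal for the jump weight. -/
lemma reproducing {γ : ℂ} {l : ℝ} {n : ℕ} (hn : 0 < n) {p : ℂ[X]} (hp : p.coeff n = 1)
    (hpn : p.natDegree ≤ n)
    (horth : ∀ f : ℂ[X], f.natDegree < n → L 0 0 (p * f) =
      γ * ∫ y in Set.Ioi l, (p * f).eval (y : ℂ) * (gauss 0 y : ℂ)) (x : ℝ) :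
    p.eval (x : ℂ) * (Real.exp (-x ^ 2 / 2) : ℂ) = phi n x + γ * ∑ k ∈ Finset.range n,
      (phi k x / Nn k : ℂ) * ∫ y in Set.Ioi l,
        (phi k y : ℂ) * (p.eval (y : ℂ) * (Real.exp (-y ^ 2 / 2) : ℂ)) := by
  have hf : (p - he n).natDegree < n := by
    refine lt_of_le_of_ne ((natDegree_sub_le _ _).trans (max_le hpn (he_monic n).2)) fun h => ?_
    have h1 : p - he n = 0 := by
      rw [← leadingCoeff_eq_zero, leadingCoeff, h, coeff_sub, hp, (he_monic n).1, sub_self]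
    rw [h1] at h; simp at h; omega
  have h := congrArg (fun q : ℂ[X] => q.eval (x : ℂ)) (hermite_expansion n _ hf)
  simp only [eval_sub, eval_he, eval_finsetSum, eval_mul, eval_C] at h
  have hk : ∀ k ∈ Finset.range n, L 0 0 (he k * (p - he n)) = γ * ∫ y in Set.Ioi l,
        (phi k y : ℂ) * (p.eval (y : ℂ) * (Real.exp (-y ^ 2 / 2) : ℂ)) := by
    intro k hk
    rw [mul_sub, map_sub, L_he_mul_he, if_neg (Finset.mem_range.1 hk).ne, sub_zero, mul_comm,
      horth _ ((he_monic k).2.trans_lt (Finset.mem_range.1 hk))]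
    congr 1
    refine integral_congr_ae (Eventually.of_forall fun y => ?_)
    have : gauss 0 y = Real.exp (-y ^ 2 / 2) * Real.exp (-y ^ 2 / 2) := by
      rw [← Real.exp_add, gauss]; congr 1; ring
    simp only [eval_mul, eval_he, phi, this]
    push_cast
    ring
  have h2 : p.eval (x : ℂ) = hr n x + ∑ k ∈ Finset.range n,
      (L 0 0 (he k * (p - he n)) / Nn k) * hr k x := by rw [← h]; ring
  rw [h2, add_mul, Finset.mul_sum, Finset.sum_mul]
  congr 1
  · rw [phi]; push_cast; ring
  · refine Finset.sum_congr rfl fun k hk' => ?_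
    rw [hk k hk', phi]
    push_cast
    ring

end

section

lemma hasDerivAt_vertical (c y : ℝ) : HasDerivAt (fun y : ℝ => (c : ℂ) + Complex.I * y) Complex.I y := by
  have := ((hasDerivAt_id y).ofReal_comp.const_mul Complex.I).const_add (c : ℂ)
  exact this.congr_deriv (by simp)

lemma norm_exp_sq_sub (c x y : ℝ) :
    ‖Complex.exp ((c + Complex.I * y) ^ 2 - 2 * x * (c + Complex.I * y))‖ =
      Real.exp (c ^ 2 - 2 * x * c) * gauss 0 y := by
  rw [Complex.norm_exp, gauss, ← Real.exp_add]
  congr 1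
  simp [pow_two]
  ring

lemma integrable_hermite_contour (n : ℕ) (c x : ℝ) : Integrable fun y : ℝ =>
    ((c : ℂ) + Complex.I * y) ^ n *
      Complex.exp ((c + Complex.I * y) ^ 2 - 2 * x * (c + Complex.I * y)) := by
  have h := ((integrable_eval_mul_gauss ((C (c : ℂ) + C Complex.I * X) ^ n) 0).norm).const_mul
    (Real.exp (c ^ 2 - 2 * x * c))
  refine h.mono' (Continuous.aestronglyMeasurable (by fun_prop)) (Eventually.of_forall fun y => ?_)
  rw [norm_mul, norm_exp_sq_sub, norm_mul, Complex.norm_real, Real.norm_of_nonneg (gauss_pos _ _).le]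
  simp only [eval_pow, eval_add, eval_mul, eval_C, eval_X]
  exact le_of_eq (by ring)

lemma hermite_contour (c x : ℝ) (n : ℕ) : ((hr n x * Real.exp (-x ^ 2) : ℝ) : ℂ) * Real.sqrt Real.pi =
    ∫ y : ℝ, ((c : ℂ) + Complex.I * y) ^ n *
      Complex.exp ((c + Complex.I * y) ^ 2 - 2 * x * (c + Complex.I * y)) := by
  set E : ℝ → ℂ := fun y => Complex.exp ((c + Complex.I * y) ^ 2 - 2 * x * (c + Complex.I * y)) with hE
  set J : ℕ → ℂ := fun n => ∫ y : ℝ, ((c : ℂ) + Complex.I * y) ^ n * E y with hJ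
  change _ = J n
  have hi : ∀ n, Integrable fun y : ℝ => ((c : ℂ) + Complex.I * y) ^ n * E y := fun n =>
    integrable_hermite_contour n c x
  have hEd : ∀ y, HasDerivAt E (E y * (Complex.I * (2 * (c + Complex.I * y) - 2 * x))) y := by
    intro y
    have h1 := hasDerivAt_vertical c y
    have h2 := (h1.pow 2).sub (h1.const_mul (2 * (x : ℂ)))
    exact h2.cexp.congr_deriv (by simp [hE]; ring_nf)
  have hrec0 : J 1 = x * J 0 := by
    have h := integral_eq_zero_of_hasDerivAt_of_integrable (f := E) (fun y => hEd y)
      ((((hi 1).const_mul (2 * Complex.I)).sub ((hi 0).const_mul (2 * Complex.I * x))).congr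
        (Eventually.of_forall fun y => by simp; ring_nf)) (by simpa using hi 0)
    have e : ∀ y : ℝ, E y * (Complex.I * (2 * (c + Complex.I * y) - 2 * x)) =
        2 * Complex.I * (((c : ℂ) + Complex.I * y) ^ 1 * E y) -
        2 * Complex.I * x * (((c : ℂ) + Complex.I * y) ^ 0 * E y) := fun y => by ring
    simp only [e] at h
    rw [integral_sub ((hi 1).const_mul _) ((hi 0).const_mul _), integral_const_mul,
      integral_const_mul] at h
    have h3 : 2 * Complex.I * (J 1 - x * J 0) = 0 := by simp only [hJ]; linear_combination h
    have h4 := (mul_eq_zero.1 h3).resolve_left (by simp)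
    linear_combination h4
  have hrec : ∀ n : ℕ, J (n + 2) = x * J (n + 1) - (n + 1) / 2 * J n := by
    intro n
    have hd : ∀ y, HasDerivAt (fun y : ℝ => ((c : ℂ) + Complex.I * y) ^ (n + 1) * E y)
        (2 * Complex.I * (((c : ℂ) + Complex.I * y) ^ (n + 2) * E y) -
        2 * Complex.I * x * (((c : ℂ) + Complex.I * y) ^ (n + 1) * E y) +
        Complex.I * (n + 1) * (((c : ℂ) + Complex.I * y) ^ n * E y)) y := by
      intro y
      refine (((hasDerivAt_vertical c y).pow (n + 1)).mul (hEd y)).congr_deriv ?_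
      simp
      ring_nf
    have hi1 := ((hi (n + 2)).const_mul (2 * Complex.I)).sub
      ((hi (n + 1)).const_mul (2 * Complex.I * x))
    have hi2 := (hi n).const_mul (Complex.I * (n + 1))
    have h := integral_eq_zero_of_hasDerivAt_of_integrable hd (hi1.add hi2) (hi (n + 1))
    have hi1' : Integrable fun y : ℝ => 2 * Complex.I * (((c : ℂ) + Complex.I * y) ^ (n + 2) * E y) -
        2 * Complex.I * x * (((c : ℂ) + Complex.I * y) ^ (n + 1) * E y) := hi1
    rw [integral_add hi1' hi2, integral_sub ((hi _).const_mul _) ((hi _).const_mul _),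
      integral_const_mul, integral_const_mul, integral_const_mul] at h
    have h3 : 2 * Complex.I * (J (n + 2) - (x * J (n + 1) - (n + 1) / 2 * J n)) = 0 := by
      simp only [hJ]; linear_combination h
    have h4 := (mul_eq_zero.1 h3).resolve_left (by simp)
    linear_combination h4
  have hzero : J 0 = Real.exp (-x ^ 2) * Real.sqrt Real.pi := by
    have h := integral_cexp_quadratic (b := -1) (by norm_num) (2 * Complex.I * (c - x))
      ((c : ℂ) ^ 2 - 2 * x * c)
    have e : ∀ y : ℝ, ((c : ℂ) + Complex.I * y) ^ 0 * E y =
        Complex.exp (-1 * (y : ℂ) ^ 2 + 2 * Complex.I * (c - x) * y + (c ^ 2 - 2 * x * c)) := by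
      intro y
      rw [pow_zero, one_mul, hE]
      ring_nf
      simp
      ring_nf
    simp only [hJ, e]
    rw [h, mul_comm]
    congr 1
    · push_cast
      congr 1
      ring_nf
      simp
    · rw [neg_neg, div_one, Real.sqrt_eq_rpow, Complex.ofReal_cpow Real.pi_pos.le]
      norm_num
  induction n using Nat.twoStepInduction with
  | zero => rw [hzero]; simp [hr]
  | one => rw [hrec0, hzero]; simp [hr]; ring
  | more n h1 h2 =>
    rw [hrec, ← h1, ← h2, hr_succ_succ]; push_cast; ring

end

section

/-- The small parameter `n^(-1/3)`. -/
def del (n : ℕ) : ℝ := (n : ℝ) ^ (-(1 : ℝ) / 3)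

lemma del_pos {n : ℕ} (hn : 0 < n) : 0 < del n := Real.rpow_pos_of_pos (by exact_mod_cast hn) _

lemma del_le_one {n : ℕ} (hn : 0 < n) : del n ≤ 1 :=
  Real.rpow_le_one_of_one_le_of_nonpos (by exact_mod_cast hn) (by norm_num)

lemma del_cube {n : ℕ} (hn : 0 < n) : (n : ℝ) * del n ^ 3 = 1 := by
  have : (0 : ℝ) < n := by exact_mod_cast hn
  rw [del, ← Real.rpow_natCast, ← Real.rpow_mul this.le]
  norm_num [Real.rpow_neg_one]
  field_simp

lemma tendsto_del : Tendsto del atTop (nhds 0) := by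
  have h := (tendsto_rpow_neg_atTop (y := 1 / 3) (by norm_num)).comp
    (tendsto_natCast_atTop_atTop (R := ℝ))
  refine h.congr fun n => ?_
  simp only [Function.comp, del]; norm_num

/-- The edge scaling. -/
def xs (n : ℕ) (s : ℝ) : ℝ := Real.sqrt (2 * n) * (1 + s / 2 * del n ^ 2)

lemma lam0_eq (s : ℝ) (n : ℕ) : lam0 s n = xs n s := by
  rw [lam0, xs, del, ← Real.rpow_natCast, ← Real.rpow_mul n.cast_nonneg]
  norm_num

/-- The saddle point scale `√(n/2)`. -/
def hh (n : ℕ) : ℝ := Real.sqrt (n / 2)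

lemma hh_sq (n : ℕ) : hh n ^ 2 = n / 2 := Real.sq_sqrt (by positivity)

lemma hh_pos {n : ℕ} (hn : 0 < n) : 0 < hh n := Real.sqrt_pos.2 (by positivity)

lemma xs_eq (n : ℕ) (s : ℝ) : xs n s = 2 * hh n * (1 + s / 2 * del n ^ 2) := by
  rw [xs, hh, show (2 * n : ℝ) = 2 ^ 2 * (n / 2) by ring, Real.sqrt_mul (by norm_num),
    Real.sqrt_sq (by norm_num)]

/-- The normalizing constant for Hermite functions at the edge. -/
def cn (n : ℕ) : ℝ := Real.exp (n / 2) / (2 * Real.sqrt Real.pi * hh n ^ (n + 1) * del n)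

lemma cn_pos {n : ℕ} (hn : 0 < n) : 0 < cn n := by
  have := hh_pos hn
  have := del_pos hn
  unfold cn; positivity

/-- Rescaled Hermite functions at the edge. -/
def Wn (n m : ℕ) (s : ℝ) : ℝ := cn n * hh n ^ n / hh n ^ m * phi m (xs n s)

/-- Integrand of the contour representation of the rescaled Hermite functions. -/
def Gf (n m : ℕ) (a s η : ℝ) : ℂ :=
  (1 + del n * (a + Complex.I * η)) ^ m *
    Complex.exp (-(n * (del n * (a + Complex.I * η))) + n * (del n * (a + Complex.I * η)) ^ 2 / 2
      - s * (a + Complex.I * η))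

lemma continuous_Gf (n m : ℕ) (a s : ℝ) : Continuous (Gf n m a s) := by
  unfold Gf; fun_prop

lemma Wn_eq_integral {n : ℕ} (hn : 0 < n) (m : ℕ) (a s : ℝ) :
    (Wn n m s : ℂ) = (Real.exp (s ^ 2 * del n / 4) / (2 * Real.pi) : ℝ) * ∫ η : ℝ, Gf n m a s η := by
  have hd := del_pos hn
  have hh0 := hh_pos hn
  have hnd := del_cube hn
  have hhs := hh_sq n
  have h := hermite_contour (hh n * (1 + del n * a)) (xs n s) m
  set F : ℝ → ℂ := fun y => (((hh n * (1 + del n * a) : ℝ) : ℂ) + Complex.I * y) ^ m *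
      Complex.exp (((hh n * (1 + del n * a) : ℝ) + Complex.I * y) ^ 2 -
        2 * xs n s * ((hh n * (1 + del n * a) : ℝ) + Complex.I * y)) with hF
  have hsub := Measure.integral_comp_mul_left F (hh n * del n)
  rw [← h, abs_of_pos (by positivity)] at hsub
  have key : ∀ η : ℝ, F (hh n * del n * η) = ((hh n ^ m * Real.exp (-(xs n s) ^ 2 / 2) *
      Real.exp (-n / 2 : ℝ) * Real.exp (s ^ 2 * del n / 4) : ℝ) : ℂ) * Gf n m a s η := by
    intro η
    have e1 : ((hh n * (1 + del n * a) : ℝ) : ℂ) + Complex.I * ((hh n * del n * η : ℝ) : ℂ) =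
      hh n * (1 + del n * (a + Complex.I * η)) := by push_cast; ring
    have hnd' : (n : ℂ) * (del n : ℂ) ^ 3 = 1 := by exact_mod_cast hnd
    have hhs' : (hh n : ℂ) ^ 2 = n / 2 := by
      have := congrArg (fun r : ℝ => (r : ℂ)) hhs
      push_cast at this
      exact this
    have hx : (xs n s : ℂ) = 2 * hh n * (1 + s / 2 * (del n : ℂ) ^ 2) := by
      rw [xs_eq]; push_cast; ring
    simp only [hF, Gf]
    rw [e1, mul_pow]
    push_cast
    have : Complex.exp ((hh n * (1 + del n * (a + Complex.I * η))) ^ 2 -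
        2 * xs n s * (hh n * (1 + del n * (a + Complex.I * η)))) =
        Complex.exp (-(xs n s : ℂ) ^ 2 / 2) * Complex.exp (-n / 2) *
          Complex.exp (s ^ 2 * del n / 4) *
        Complex.exp (-(n * (del n * (a + Complex.I * η))) + n * (del n * (a + Complex.I * η)) ^ 2 / 2
      - s * (a + Complex.I * η)) := by
      rw [← Complex.exp_add, ← Complex.exp_add, ← Complex.exp_add, hx]
      congr 1
      generalize (a : ℂ) + Complex.I * η = ζ
      linear_combination ((1 + (del n : ℂ) * ζ) ^ 2 -
        4 * (1 + s / 2 * (del n : ℂ) ^ 2) * (1 + (del n : ℂ) * ζ) +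
        2 * (1 + s / 2 * (del n : ℂ) ^ 2) ^ 2) * hhs' +
        (-(s : ℂ) * ζ + s ^ 2 / 4 * del n) * hnd'
    rw [this]
    ring
  simp only [key] at hsub
  rw [integral_const_mul] at hsub
  have hpi := Real.sqrt_pos.2 Real.pi_pos
  have hpi2 := Real.mul_self_sqrt Real.pi_pos.le
  set I := ∫ η : ℝ, Gf n m a s η with hI
  have h1 : ((hh n * del n : ℝ)⁻¹ : ℝ) • (((hr m (xs n s) * Real.exp (-(xs n s) ^ 2) : ℝ) : ℂ) *
      Real.sqrt Real.pi) = (((hh n * del n)⁻¹ * hr m (xs n s) * Real.exp (-(xs n s) ^ 2) *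
      Real.sqrt Real.pi : ℝ) : ℂ) := by
    rw [Complex.real_smul]; push_cast; ring
  rw [h1] at hsub
  have h2 : Wn n m s = Real.exp (s ^ 2 * del n / 4) / (2 * Real.pi) *
      ((hh n ^ m * Real.exp (-(xs n s) ^ 2 / 2) *
      Real.exp (-n / 2 : ℝ) * Real.exp (s ^ 2 * del n / 4))⁻¹ * ((hh n * del n)⁻¹ * hr m (xs n s) * Real.exp (-(xs n s) ^ 2) *
      Real.sqrt Real.pi)) := by
    have e2 : Real.exp (-(xs n s) ^ 2) = Real.exp (-(xs n s) ^ 2 / 2) * Real.exp (-(xs n s) ^ 2 / 2) := by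
      rw [← Real.exp_add]; congr 1; ring
    have e3 : Real.exp ((n : ℝ) / 2) = (Real.exp (-n / 2 : ℝ))⁻¹ := by
      rw [← Real.exp_neg]; congr 1; ring
    rw [Wn, cn, phi, e2, e3]
    have := (Real.exp_pos (-(xs n s) ^ 2 / 2)).ne'
    have := (Real.exp_pos (-n / 2 : ℝ)).ne'
    have := (Real.exp_pos (s ^ 2 * del n / 4)).ne'
    rw [show 2 * Real.pi = 2 * (Real.sqrt Real.pi * Real.sqrt Real.pi) by rw [hpi2]]
    field_simp
    ring
  rw [h2, Complex.ofReal_mul, Complex.ofReal_mul (_⁻¹), ← hsub]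
  have h3 : (0 : ℝ) < hh n ^ m * Real.exp (-(xs n s) ^ 2 / 2) *
      Real.exp (-n / 2 : ℝ) * Real.exp (s ^ 2 * del n / 4) := by positivity
  congr 1
  rw [← mul_assoc, ← Complex.ofReal_mul, inv_mul_cancel₀ h3.ne']
  simp

lemma norm_Gf_le {n m : ℕ} (hn : 0 < n) (hm : m ≤ n) {a : ℝ} (ha : 0 ≤ a) (s η : ℝ) :
    ‖Gf n m a s η‖ ≤ (1 + del n * a) ^ n *
      Real.exp (-(n * (del n * a)) + n * (del n * a) ^ 2 / 2 - s * a) *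
      Real.exp (-(a / (2 * (1 + del n * a))) * η ^ 2) := by
  have hd := del_pos hn
  have hnd := del_cube hn
  set σ := del n * a with hσ
  have hσ0 : 0 ≤ σ := by positivity
  set z : ℂ := 1 + del n * (a + Complex.I * η) with hz
  have hre : z.re = 1 + σ := by simp [hz, hσ]
  have him : z.im = del n * η := by simp [hz]
  have h1 : 1 ≤ ‖z‖ := by
    have := Complex.re_le_norm z
    rw [hre] at this; linarith
  have h2 : ‖z‖ ≤ (1 + σ) * Real.exp (del n ^ 2 * η ^ 2 / (2 * (1 + σ) ^ 2)) := by
    refine le_of_sq_le_sq ?_ (by positivity)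
    rw [← Complex.normSq_eq_norm_sq, Complex.normSq_apply, hre, him, mul_pow, ← Real.exp_nat_mul]
    have := Real.add_one_le_exp (del n ^ 2 * η ^ 2 / (1 + σ) ^ 2)
    have e : ((2 : ℕ) : ℝ) * (del n ^ 2 * η ^ 2 / (2 * (1 + σ) ^ 2)) =
      del n ^ 2 * η ^ 2 / (1 + σ) ^ 2 := by push_cast; field_simp
    rw [e]
    calc (1 + σ) * (1 + σ) + del n * η * (del n * η) =
        (1 + σ) ^ 2 * (del n ^ 2 * η ^ 2 / (1 + σ) ^ 2 + 1) := by field_simp; ring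
      _ ≤ _ := by gcongr
  have h3 : ‖z‖ ^ m ≤ (1 + σ) ^ n * Real.exp (n * (del n ^ 2 * η ^ 2 / (2 * (1 + σ) ^ 2))) := by
    calc ‖z‖ ^ m ≤ ‖z‖ ^ n := pow_le_pow_right₀ h1 hm
      _ ≤ ((1 + σ) * Real.exp (del n ^ 2 * η ^ 2 / (2 * (1 + σ) ^ 2))) ^ n := by gcongr
      _ = _ := by rw [mul_pow, ← Real.exp_nat_mul]
  rw [Gf, norm_mul, norm_pow, Complex.norm_exp]
  have h4 : (-(n * (del n * (a + Complex.I * η))) + n * (del n * (a + Complex.I * η)) ^ 2 / 2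
      - s * (a + Complex.I * η) : ℂ).re = -(n * σ) + n * σ ^ 2 / 2 - s * a
        - n * del n ^ 2 * η ^ 2 / 2 := by
    have : (-(n * (del n * (a + Complex.I * η))) + n * (del n * (a + Complex.I * η)) ^ 2 / 2
      - s * (a + Complex.I * η) : ℂ) = ((-(n * σ) + n * σ ^ 2 / 2 - s * a
        - n * del n ^ 2 * η ^ 2 / 2 : ℝ) : ℂ) +
        ((-(n * del n * η) + n * del n ^ 2 * a * η - s * η : ℝ) : ℂ) * Complex.I := by
      rw [hσ]; push_cast
      linear_combination (n * (del n : ℂ) ^ 2 * η ^ 2 / 2) * Complex.I_sq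
    rw [this, Complex.add_re, Complex.ofReal_re, Complex.re_ofReal_mul, Complex.I_re]; ring
  rw [h4, ← hz]
  refine (mul_le_mul_of_nonneg_right h3 (Real.exp_pos _).le).trans ?_
  rw [mul_assoc, ← Real.exp_add, mul_assoc ((1 + σ) ^ n), ← Real.exp_add]
  refine mul_le_mul_of_nonneg_left (Real.exp_le_exp.2 ?_) (by positivity)
  have ha' : a = n * del n ^ 2 * σ := by rw [hσ]; linear_combination (-a) * hnd
  have e : n * (del n ^ 2 * η ^ 2 / (2 * (1 + σ) ^ 2)) - n * del n ^ 2 * η ^ 2 / 2 +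
      n * del n ^ 2 * σ / (2 * (1 + σ)) * η ^ 2 =
      - (n * del n ^ 2 * η ^ 2 / 2 * (σ / (1 + σ) ^ 2)) := by field_simp; ring
  have e2 : 0 ≤ n * del n ^ 2 * η ^ 2 / 2 * (σ / (1 + σ) ^ 2) := by positivity
  have e3 : a / (2 * (1 + σ)) = n * del n ^ 2 * σ / (2 * (1 + σ)) := by rw [← ha']
  rw [e3]
  linarith

lemma one_add_le_exp_cubic {σ : ℝ} (h0 : 0 ≤ σ) (h1 : σ ≤ 1) :
    1 + σ ≤ Real.exp (σ - σ ^ 2 / 2 + σ ^ 3 / 2) := by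
  have hv : 0 ≤ σ - σ ^ 2 / 2 + σ ^ 3 / 2 := by
    have : 0 ≤ σ ^ 3 := by positivity
    nlinarith
  refine le_trans ?_ (Real.quadratic_le_exp_of_nonneg hv)
  have h4 : 0 ≤ σ ^ 4 := by positivity
  nlinarith [sq_nonneg (σ ^ 2 / 2 - σ ^ 3 / 2)]

/-- Uniform Gaussian bound on the steepest descent line. -/
lemma norm_Gf_one_le {n m : ℕ} (hn : 0 < n) (hm : m ≤ n) (s η : ℝ) :
    ‖Gf n m 1 s η‖ ≤ Real.exp (1 / 2 - s) * Real.exp (-(1 / 4) * η ^ 2) := by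
  have hd := del_pos hn
  have hd1 := del_le_one hn
  refine (norm_Gf_le hn hm zero_le_one s η).trans ?_
  rw [mul_one, mul_one]
  gcongr ?_ * Real.exp ?_
  · have h := pow_le_pow_left₀ (by positivity) (one_add_le_exp_cubic hd.le hd1) n
    rw [← Real.exp_nat_mul] at h
    refine (mul_le_mul_of_nonneg_right h (Real.exp_pos _).le).trans ?_
    rw [← Real.exp_add]
    refine Real.exp_le_exp.2 (le_of_eq ?_)
    linear_combination (1 / 2) * del_cube hn
  · refine mul_le_mul_of_nonneg_right (neg_le_neg ?_) (sq_nonneg η)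
    rw [div_le_div_iff₀ (by norm_num) (by positivity)]
    linarith

lemma norm_Gf_tail_le {n m : ℕ} (hn : 0 < n) (hm : m ≤ n) {s : ℝ} (hs : 2 ≤ s * del n) (η : ℝ) :
    ‖Gf n m (s * del n) s η‖ ≤ Real.exp (-(s ^ 2 * del n) / 2) * Real.exp (-(1 / 4) * η ^ 2) := by
  have hd := del_pos hn
  have hd1 := del_le_one hn
  have hnd := del_cube hn
  have hs0 : 0 ≤ s * del n := by linarith
  refine (norm_Gf_le hn hm hs0 s η).trans ?_
  gcongr ?_ * Real.exp ?_
  · have h1 : 1 + del n * (s * del n) ≤ Real.exp (del n * (s * del n)) := by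
      linarith [Real.add_one_le_exp (del n * (s * del n))]
    have h := pow_le_pow_left₀ (by positivity) h1 n
    rw [← Real.exp_nat_mul] at h
    refine (mul_le_mul_of_nonneg_right h (Real.exp_pos _).le).trans ?_
    rw [← Real.exp_add]
    refine Real.exp_le_exp.2 (le_of_eq ?_)
    linear_combination (s ^ 2 * del n / 2) * hnd
  · refine mul_le_mul_of_nonneg_right (neg_le_neg ?_) (sq_nonneg η)
    rw [div_le_div_iff₀ (by norm_num) (by positivity)]
    nlinarith

lemma integrable_gaussian_quarter : Integrable fun η : ℝ => Real.exp (-(1 / 4) * η ^ 2) :=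
  integrable_exp_neg_mul_sq (by norm_num)

lemma abs_Wn_le_of {n : ℕ} (hn : 0 < n) (m : ℕ) (a s : ℝ) {K : ℝ}
    (h : ∀ η, ‖Gf n m a s η‖ ≤ K * Real.exp (-(1 / 4) * η ^ 2)) :
    |Wn n m s| ≤ Real.exp (s ^ 2 * del n / 4) * K *
      ((2 * Real.pi)⁻¹ * ∫ η : ℝ, Real.exp (-(1 / 4) * η ^ 2)) := by
  have h1 := norm_integral_le_of_norm_le (integrable_gaussian_quarter.const_mul K)
    (Eventually.of_forall h)
  rw [integral_const_mul] at h1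
  have h2 := congrArg norm (Wn_eq_integral hn m a s)
  rw [Complex.norm_real, Real.norm_eq_abs, norm_mul, Complex.norm_real,
    Real.norm_of_nonneg (by positivity)] at h2
  rw [h2]
  calc _ ≤ Real.exp (s ^ 2 * del n / 4) / (2 * Real.pi) * (K * ∫ η : ℝ, Real.exp (-(1 / 4) * η ^ 2)) := by
        gcongr
    _ = _ := by ring

/-- Uniform exponential decay of the rescaled Hermite functions. -/
lemma exists_abs_Wn_le (T : ℝ) : ∃ C > 0, ∀ n m : ℕ, 0 < n → m ≤ n → ∀ s, T ≤ s →
    |Wn n m s| ≤ C * Real.exp (-s / 2) := by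
  set D := (2 * Real.pi)⁻¹ * ∫ η : ℝ, Real.exp (-(1 / 4) * η ^ 2) with hD
  have hD0 : 0 < D := by
    rw [hD, integral_gaussian]; positivity
  refine ⟨Real.exp (1 / 2 + |T| + T ^ 2 / 4) * D, by positivity, fun n m hn hm s hs => ?_⟩
  have hd := del_pos hn
  have hd1 := del_le_one hn
  have hT := neg_abs_le T
  have hT0 := abs_nonneg T
  have key : ∀ K, Real.exp (s ^ 2 * del n / 4) * K ≤ Real.exp (1 / 2 + |T| + T ^ 2 / 4) * Real.exp (-s / 2) →
      (∀ a : ℝ, (∀ η, ‖Gf n m a s η‖ ≤ K * Real.exp (-(1 / 4) * η ^ 2)) →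
      |Wn n m s| ≤ Real.exp (1 / 2 + |T| + T ^ 2 / 4) * D * Real.exp (-s / 2)) := by
    intro K hK a ha
    refine (abs_Wn_le_of hn m a s ha).trans ?_
    calc _ ≤ Real.exp (1 / 2 + |T| + T ^ 2 / 4) * Real.exp (-s / 2) * D := by gcongr
      _ = _ := by ring
  rcases le_total 2 (s * del n) with h | h
  · refine key _ ?_ _ (norm_Gf_tail_le hn hm h)
    rw [← Real.exp_add, ← Real.exp_add]
    refine Real.exp_le_exp.2 ?_
    have hs0 : 0 < s := by
      by_contra hneg
      nlinarith
    nlinarith [sq_nonneg T]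
  · refine key _ ?_ _ (norm_Gf_one_le hn hm s)
    rw [← Real.exp_add, ← Real.exp_add]
    refine Real.exp_le_exp.2 ?_
    rcases le_total 0 s with h0 | h0
    · nlinarith [sq_nonneg T]
    · have h1 : s ^ 2 ≤ T ^ 2 := by nlinarith
      nlinarith

/-- The Airy-type integrals along the line `Re ζ = 1`. -/
def Jf (k : ℕ) (s : ℝ) : ℂ := ∫ η : ℝ, (1 + Complex.I * η) ^ k *
  Complex.exp ((1 + Complex.I * η) ^ 3 / 3 - s * (1 + Complex.I * η))

lemma tendsto_Gf_one (k : ℕ) (s η : ℝ) : Tendsto (fun n => Gf n (n - k) 1 s η) atTop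
    (nhds (Complex.exp ((1 + Complex.I * η) ^ 3 / 3 - s * (1 + Complex.I * η)))) := by
  set ζ : ℂ := 1 + Complex.I * η with hζ
  have hdc : Tendsto (fun n => (del n : ℂ) * ζ) atTop (nhds 0) := by
    have := (Complex.continuous_ofReal.tendsto 0).comp tendsto_del
    simpa using this.mul_const ζ
  have hdn : Tendsto (fun n => ‖(del n : ℂ) * ζ‖) atTop (nhds 0) := by simpa using hdc.norm
  have herr : Tendsto (fun n : ℕ => (n : ℂ) * (Complex.log (1 + del n * ζ) -
      Complex.logTaylor 4 (del n * ζ))) atTop (nhds 0) := by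
    have hb : Tendsto (fun n => del n * (‖ζ‖ ^ 4 * 2)) atTop (nhds 0) := by
      simpa using tendsto_del.mul_const (‖ζ‖ ^ 4 * 2)
    refine squeeze_zero_norm' ?_ hb
    filter_upwards [hdn.eventually (gt_mem_nhds (show (0 : ℝ) < 1 / 2 by norm_num)),
      eventually_gt_atTop 0] with n h1 hn
    have hd := del_pos hn
    have h := Complex.norm_log_sub_logTaylor_le 3 (h1.trans (by norm_num))
    rw [norm_mul, Complex.norm_natCast]
    have h2 : (1 - ‖(del n : ℂ) * ζ‖)⁻¹ ≤ 2 := by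
      rw [inv_le_comm₀ (by linarith) (by norm_num)]; linarith
    have h3 : ‖(del n : ℂ) * ζ‖ = del n * ‖ζ‖ := by
      rw [norm_mul, Complex.norm_real, Real.norm_of_nonneg hd.le]
    calc _ ≤ (n : ℝ) * (‖(del n : ℂ) * ζ‖ ^ 4 * (1 - ‖(del n : ℂ) * ζ‖)⁻¹ / 4) := by
          gcongr; exact h.trans (le_of_eq (by norm_num))
      _ ≤ (n : ℝ) * (‖(del n : ℂ) * ζ‖ ^ 4 * 2 / 1) := by gcongr; norm_num
      _ = del n * (‖ζ‖ ^ 4 * 2) := by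
          rw [h3]; linear_combination (2 * del n * ‖ζ‖ ^ 4) * del_cube hn
  have h1 : Tendsto (fun n : ℕ => Complex.exp ((n : ℂ) * (Complex.log (1 + del n * ζ) -
      Complex.logTaylor 4 (del n * ζ)) + (ζ ^ 3 / 3 - s * ζ)) * ((1 + del n * ζ) ^ k)⁻¹) atTop
      (nhds (Complex.exp (0 + (ζ ^ 3 / 3 - s * ζ)) * ((1 + 0) ^ k)⁻¹)) := by
    refine Tendsto.mul ((Complex.continuous_exp.tendsto _).comp (herr.add_const _)) ?_
    exact ((hdc.const_add 1).pow k).inv₀ (by simp)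
  rw [zero_add, add_zero, one_pow, inv_one, mul_one] at h1
  refine h1.congr' ?_
  filter_upwards [hdn.eventually (gt_mem_nhds (show (0 : ℝ) < 1 / 2 by norm_num)),
      eventually_gt_atTop 0, eventually_ge_atTop k] with n hz hn hk
  have hne : (1 : ℂ) + del n * ζ ≠ 0 := by
    intro h0
    have : (del n : ℂ) * ζ = -1 := by linear_combination h0
    rw [this] at hz; norm_num at hz
  have hnd : (n : ℂ) * (del n : ℂ) ^ 3 = 1 := by exact_mod_cast del_cube hn
  have e : (n : ℂ) * (Complex.log (1 + del n * ζ) - Complex.logTaylor 4 (del n * ζ)) +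
      (ζ ^ 3 / 3 - s * ζ) = n * Complex.log (1 + del n * ζ) +
      (-(n * (del n * ζ)) + n * (del n * ζ) ^ 2 / 2 - s * ζ) := by
    simp only [Complex.logTaylor, Finset.sum_range_succ, Finset.sum_range_zero]
    push_cast
    linear_combination -(ζ ^ 3 / 3) * hnd
  rw [e, Complex.exp_add, Complex.exp_nat_mul, Complex.exp_log hne, Gf, Complex.ofReal_one, ← hζ,
    ← Nat.sub_add_cancel hk]
  simp only [Nat.add_sub_cancel]
  rw [pow_add]
  field_simp

/-- Plancherel–Rotach asymptotics at the edge for Hermite functions. -/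
lemma tendsto_Wn (k : ℕ) (s : ℝ) : Tendsto (fun n => (Wn n (n - k) s : ℂ)) atTop
    (nhds ((2 * Real.pi : ℝ)⁻¹ * Jf 0 s)) := by
  have h1 : Tendsto (fun n => ∫ η : ℝ, Gf n (n - k) 1 s η) atTop (nhds (Jf 0 s)) := by
    unfold Jf
    refine tendsto_integral_filter_of_dominated_convergence
      (fun η => Real.exp (1 / 2 - s) * Real.exp (-(1 / 4) * η ^ 2))
      (Eventually.of_forall fun n => (continuous_Gf _ _ _ _).aestronglyMeasurable) ?_
      (integrable_gaussian_quarter.const_mul _) (Eventually.of_forall fun η => ?_)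
    · filter_upwards [eventually_gt_atTop 0] with n hn
      exact Eventually.of_forall fun η => norm_Gf_one_le hn (Nat.sub_le _ _) s η
    · simpa using tendsto_Gf_one k s η
  have h2 : Tendsto (fun n => ((Real.exp (s ^ 2 * del n / 4) / (2 * Real.pi) : ℝ) : ℂ)) atTop
      (nhds ((2 * Real.pi : ℝ)⁻¹ : ℝ)) := by
    refine (Complex.continuous_ofReal.tendsto _).comp ?_
    have h3 : Tendsto (fun n => s ^ 2 * del n / 4) atTop (nhds 0) := by
      simpa using (tendsto_del.const_mul (s ^ 2)).div_const 4
    have h4 := (Real.continuous_exp.tendsto 0).comp h3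
    simpa using h4.div_const (2 * Real.pi)
  have h5 := h2.mul h1

  refine h5.congr' ?_
  filter_upwards [eventually_gt_atTop 0] with n hn
  rw [Wn_eq_integral hn _ 1 s]

end

section

/-- The integrand of `Jf`. -/
def airyInt (k : ℕ) (s η : ℝ) : ℂ := (1 + Complex.I * η) ^ k *
  Complex.exp ((1 + Complex.I * η) ^ 3 / 3 - s * (1 + Complex.I * η))

lemma Jf_eq (k : ℕ) (s : ℝ) : Jf k s = ∫ η, airyInt k s η := rfl

lemma continuous_airyInt (k : ℕ) (s : ℝ) : Continuous (airyInt k s) := by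
  unfold airyInt; fun_prop

lemma norm_airyInt_le (k : ℕ) (s η : ℝ) :
    ‖airyInt k s η‖ ≤ Real.exp ((k : ℝ) ^ 2 / 3 + 1 / 3 - s) * Real.exp (-(1 / 4) * η ^ 2) := by
  have h1 : ‖(1 : ℂ) + Complex.I * η‖ ≤ Real.exp |η| := by
    calc _ ≤ ‖(1 : ℂ)‖ + ‖Complex.I * η‖ := norm_add_le _ _
      _ = |η| + 1 := by simp [add_comm]
      _ ≤ _ := Real.add_one_le_exp _
  have h2 : ((1 + Complex.I * η) ^ 3 / 3 - s * (1 + Complex.I * η)).re = 1 / 3 - η ^ 2 - s := by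
    have : ((1 + Complex.I * η) ^ 3 / 3 - s * (1 + Complex.I * η) : ℂ) =
        ((1 / 3 - η ^ 2 - s : ℝ) : ℂ) + ((η - η ^ 3 / 3 - s * η : ℝ) : ℂ) * Complex.I := by
      push_cast
      linear_combination ((η : ℂ) ^ 2 + Complex.I * (η : ℂ) ^ 3 / 3) * Complex.I_sq
    rw [this, Complex.add_re, Complex.ofReal_re, Complex.re_ofReal_mul, Complex.I_re]; ring
  rw [airyInt, norm_mul, norm_pow, Complex.norm_exp, h2]
  calc _ ≤ Real.exp |η| ^ k * Real.exp (1 / 3 - η ^ 2 - s) := by gcongr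
    _ ≤ _ := by
      rw [← Real.exp_nat_mul, ← Real.exp_add, ← Real.exp_add, Real.exp_le_exp]
      nlinarith [sq_nonneg (3 / 2 * |η| - k), sq_abs η]

lemma integrable_airyInt (k : ℕ) (s : ℝ) : Integrable (airyInt k s) :=
  (integrable_gaussian_quarter.const_mul _).mono' (continuous_airyInt k s).aestronglyMeasurable
    (Eventually.of_forall (norm_airyInt_le k s))

lemma hasDerivAt_Jf (k : ℕ) (s : ℝ) : HasDerivAt (Jf k) (-Jf (k + 1) s) s := by
  have h := hasDerivAt_integral_of_dominated_loc_of_deriv_le (μ := volume)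
    (F := fun s η => airyInt k s η) (F' := fun s η => -airyInt (k + 1) s η) (x₀ := s)
    (s := Metric.ball s 1)
    (bound := fun η => Real.exp (((k + 1 : ℕ) : ℝ) ^ 2 / 3 + 1 / 3 - (s - 1)) *
      Real.exp (-(1 / 4) * η ^ 2))
    (Metric.ball_mem_nhds _ one_pos)
    (Eventually.of_forall fun x => (continuous_airyInt k x).aestronglyMeasurable)
    (integrable_airyInt k s) (continuous_airyInt (k + 1) s).neg.aestronglyMeasurable
    (Eventually.of_forall fun η x hx => ?_) (integrable_gaussian_quarter.const_mul _)
    (Eventually.of_forall fun η x _ => ?_)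
  · have h2 := h.2
    rw [integral_neg] at h2
    exact h2
  · rw [norm_neg]
    refine (norm_airyInt_le _ _ _).trans ?_
    rw [Metric.mem_ball, Real.dist_eq, abs_lt] at hx
    gcongr
    linarith [hx.1]
  · have h1 : HasDerivAt (fun x : ℝ => ((1 + Complex.I * η) ^ 3 / 3 - x * (1 + Complex.I * η) : ℂ))
        (-(1 * (1 + Complex.I * η))) x :=
      ((Complex.ofRealCLM.hasDerivAt (x := x)).mul_const _).const_sub _
    exact (h1.cexp.const_mul ((1 + Complex.I * η) ^ k)).congr_deriv (by simp only [airyInt]; ring)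

lemma Jf_two (s : ℝ) : Jf 2 s = s * Jf 0 s := by
  have h := integral_eq_zero_of_hasDerivAt_of_integrable (f := airyInt 0 s)
    (f' := fun η => Complex.I * (airyInt 2 s η - s * airyInt 0 s η)) (fun η => ?_)
    (((integrable_airyInt 2 s).sub ((integrable_airyInt 0 s).const_mul _)).const_mul _)
    (integrable_airyInt 0 s)
  · rw [integral_const_mul, integral_sub (integrable_airyInt 2 s)
      ((integrable_airyInt 0 s).const_mul _), integral_const_mul] at h
    simpa [sub_eq_zero, Jf_eq] using h
  · have h0 : HasDerivAt (fun η : ℝ => (1 + Complex.I * η : ℂ)) (Complex.I * 1) η :=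
      ((Complex.ofRealCLM.hasDerivAt (x := η)).const_mul _).const_add _
    have h1 := (((h0.pow 3).div_const 3).sub (h0.const_mul (s : ℂ))).cexp.const_mul
      ((1 + Complex.I * η) ^ 0 : ℂ)
    refine (h1.congr_deriv ?_)
    simp only [airyInt, Pi.sub_apply, Pi.pow_apply]
    push_cast
    ring

/-- The entire function `z ^ k * exp (z ^ 3 / 3)`. -/
def cubicExp (k : ℕ) (z : ℂ) : ℂ := z ^ k * Complex.exp (z ^ 3 / 3)

lemma differentiable_cubicExp (k : ℕ) : Differentiable ℂ (cubicExp k) := by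
  unfold cubicExp; fun_prop

lemma airyInt_zero (k : ℕ) (η : ℝ) : airyInt k 0 η = cubicExp k (1 + Complex.I * η) := by
  simp [airyInt, cubicExp]

lemma norm_cubicExp_le (k : ℕ) {ρ : ℝ} (hρ : 2 ≤ ρ) {z : ℂ} (h1 : 1 ≤ z.re) (h2 : z.re ≤ ρ / 2)
    (him : z.im = ρ * Real.sqrt 3 / 2) :
    ‖cubicExp k z‖ ≤ ρ ^ k * Real.exp (-(2 / 3) * ρ ^ 2) := by
  have h3 : Real.sqrt 3 ^ 2 = 3 := Real.sq_sqrt (by norm_num)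
  have him2 : z.im ^ 2 = 3 / 4 * ρ ^ 2 := by rw [him]; linear_combination ρ ^ 2 / 4 * h3
  have hre : (z ^ 3 / 3).re = (z.re ^ 3 - 3 * z.re * z.im ^ 2) / 3 := by
    have : z ^ 3 / 3 = (((z.re ^ 3 - 3 * z.re * z.im ^ 2) / 3 : ℝ) : ℂ) +
        (((3 * z.re ^ 2 * z.im - z.im ^ 3) / 3 : ℝ) : ℂ) * Complex.I := by
      conv_lhs => rw [← Complex.re_add_im z]
      push_cast
      linear_combination ((z.re : ℂ) * z.im ^ 2 + z.im ^ 3 / 3 * Complex.I) * Complex.I_sq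
    rw [this, Complex.add_re, Complex.ofReal_re, Complex.re_ofReal_mul, Complex.I_re]; ring
  have hn : ‖z‖ ≤ ρ := by
    rw [Complex.norm_def, Real.sqrt_le_left (by linarith), Complex.normSq_apply]
    nlinarith
  rw [cubicExp, norm_mul, norm_pow, Complex.norm_exp, hre]
  refine mul_le_mul (by gcongr) (Real.exp_le_exp.2 ?_) (Real.exp_pos _).le (by positivity)
  rw [him2]
  nlinarith [mul_nonneg (sub_nonneg.2 h1) (sq_nonneg ρ), mul_nonneg (by linarith : 0 ≤ z.re) (mul_nonneg (by linarith : 0 ≤ ρ / 2 - z.re) (by linarith : 0 ≤ ρ / 2 + z.re))]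

lemma exists_primitive_cubicExp (k : ℕ) : ∃ G : ℂ → ℂ, ∀ z, HasDerivAt G (cubicExp k z) z := by
  obtain ⟨g, hg⟩ := (differentiable_cubicExp k).isExactOn_univ
  exact ⟨g, fun z => hg z (Set.mem_univ z)⟩

lemma integral_segment {f G : ℂ → ℂ} (hf : Continuous f) (hG : ∀ z, HasDerivAt G (f z) z)
    (z v : ℂ) (r : ℝ) : (∫ x in (0 : ℝ)..r, v * f (z + v * x)) = G (z + v * r) - G z := by
  have h : ∀ x : ℝ, HasDerivAt (fun x : ℝ => G (z + v * x)) (v * f (z + v * x)) x := by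
    intro x
    have h0 : HasDerivAt (fun x : ℝ => (z + v * x : ℂ)) (v * 1) x :=
      ((Complex.ofRealCLM.hasDerivAt (x := x)).const_mul _).const_add _
    exact ((hG _).comp x h0).congr_deriv (by ring)
  rw [intervalIntegral.integral_eq_sub_of_hasDerivAt (fun x _ => h x)]
  · simp
  · exact Continuous.intervalIntegrable (by fun_prop) _ _

/-- The moments `∫₀^∞ r ^ k exp (-r ^ 3 / 3)`. -/
def cubicMoment (k : ℕ) : ℝ := ∫ r in Set.Ioi (0 : ℝ), r ^ k * Real.exp (-r ^ 3 / 3)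

lemma cubicMoment_eq (k : ℕ) : cubicMoment k =
    (1 / 3 : ℝ) ^ (-((k : ℝ) + 1) / 3) * (1 / 3) * Real.Gamma (((k : ℝ) + 1) / 3) := by
  rw [← integral_rpow_mul_exp_neg_mul_rpow (p := 3) (q := k) (by norm_num)
    (by have : (0 : ℝ) ≤ k := k.cast_nonneg
        linarith) (by norm_num), cubicMoment]
  refine setIntegral_congr_fun measurableSet_Ioi fun r hr => ?_
  simp only [Real.rpow_natCast]
  rw [show (3 : ℝ) = ((3 : ℕ) : ℝ) by norm_num, Real.rpow_natCast]
  congr 2; push_cast; ring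

lemma integrableOn_cubicMoment (k : ℕ) :
    IntegrableOn (fun r : ℝ => r ^ k * Real.exp (-r ^ 3 / 3)) (Set.Ioi 0) := by
  have h := integrableOn_rpow_mul_exp_neg_mul_rpow (p := 3) (s := k) (b := 1 / 3)
    (by have : (0 : ℝ) ≤ k := k.cast_nonneg
        linarith) (by norm_num) (by norm_num)
  refine h.congr_fun (fun r hr => ?_) measurableSet_Ioi
  simp only [Real.rpow_natCast]
  rw [show (3 : ℝ) = ((3 : ℕ) : ℝ) by norm_num, Real.rpow_natCast]
  congr 2; push_cast; ring

/-- The sixth root of unity `exp (I π / 3)`. -/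
def om : ℂ := 1 / 2 + (Real.sqrt 3 / 2 : ℝ) * Complex.I

lemma om_sq : om ^ 2 = -1 / 2 + (Real.sqrt 3 / 2 : ℝ) * Complex.I := by
  have h3 : ((Real.sqrt 3 : ℝ) : ℂ) ^ 2 = 3 := by
    exact_mod_cast Real.sq_sqrt (show (0 : ℝ) ≤ 3 by norm_num)
  rw [om]; push_cast
  linear_combination (((Real.sqrt 3 : ℝ) : ℂ) ^ 2 / 4) * Complex.I_sq - h3 / 4

lemma om_cube : om ^ 3 = -1 := by
  have h3 : ((Real.sqrt 3 : ℝ) : ℂ) ^ 2 = 3 := by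
    exact_mod_cast Real.sq_sqrt (show (0 : ℝ) ≤ 3 by norm_num)
  rw [pow_succ, om_sq, om]; push_cast
  linear_combination (((Real.sqrt 3 : ℝ) : ℂ) ^ 2 / 4) * Complex.I_sq - h3 / 4

lemma cubicExp_om (k : ℕ) (r : ℝ) :
    cubicExp k (0 + om * r) = om ^ k * (r ^ k * Real.exp (-r ^ 3 / 3) : ℝ) := by
  rw [cubicExp, zero_add, mul_pow, mul_pow, om_cube]
  push_cast
  ring_nf

lemma tendsto_horizontal {k : ℕ} {G : ℂ → ℂ} (hG : ∀ z, HasDerivAt G (cubicExp k z) z) :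
    Tendsto (fun ρ : ℝ => G (1 + Complex.I * (ρ * (Real.sqrt 3 / 2) : ℝ)) - G (0 + om * ρ)) atTop
      (nhds 0) := by
  have hlim : Tendsto (fun ρ : ℝ => ρ ^ (k + 1) * Real.exp (-ρ)) atTop (nhds 0) :=
    Real.tendsto_pow_mul_exp_neg_atTop_nhds_zero (k + 1)
  refine squeeze_zero_norm' ?_ hlim
  filter_upwards [eventually_ge_atTop 2] with ρ hρ
  set S : Set ℂ := {z | z.re ∈ Set.Icc 1 (ρ / 2) ∧ z.im = ρ * Real.sqrt 3 / 2} with hS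
  have hconv : Convex ℝ S := by
    have h1 : Convex ℝ (Complex.reLm ⁻¹' Set.Icc 1 (ρ / 2)) := (convex_Icc _ _).linear_preimage _
    have h2 : Convex ℝ (Complex.imLm ⁻¹' {ρ * Real.sqrt 3 / 2}) :=
      (convex_singleton _).linear_preimage _
    exact h1.inter h2
  have hx : (0 + om * ρ : ℂ) ∈ S := by
    constructor
    · simp only [om, Set.mem_Icc]
      norm_num
      constructor <;> linarith
    · simp [om]; ring
  have hy : (1 + Complex.I * (ρ * (Real.sqrt 3 / 2) : ℝ) : ℂ) ∈ S := by
    constructor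
    · simp; linarith
    · simp; ring
  have h := hconv.norm_image_sub_le_of_norm_hasDerivWithin_le (𝕜 := ℂ)
    (fun z _ => (hG z).hasDerivWithinAt)
    (fun z hz => norm_cubicExp_le k hρ hz.1.1 hz.1.2 hz.2) hx hy
  refine h.trans ?_
  have hd : ‖(1 + Complex.I * (ρ * (Real.sqrt 3 / 2) : ℝ) : ℂ) - (0 + om * ρ)‖ ≤ ρ := by
    have : (1 + Complex.I * (ρ * (Real.sqrt 3 / 2) : ℝ) : ℂ) - (0 + om * ρ) =
        ((1 - ρ / 2 : ℝ) : ℂ) := by rw [om]; push_cast; ring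
    rw [this, Complex.norm_real, Real.norm_eq_abs, abs_le]
    constructor <;> linarith
  calc _ ≤ ρ ^ k * Real.exp (-(2 / 3) * ρ ^ 2) * ρ := by gcongr
    _ = ρ ^ (k + 1) * Real.exp (-(2 / 3) * ρ ^ 2) := by ring
    _ ≤ _ := by
      gcongr
      nlinarith

lemma half_line (k : ℕ) : ∃ c : ℝ, Complex.I * ∫ η in Set.Ioi (0 : ℝ), airyInt k 0 η =
    om ^ (k + 1) * cubicMoment k + c := by
  obtain ⟨G, hG⟩ := exists_primitive_cubicExp k
  have hc := (differentiable_cubicExp k).continuous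
  have hreal : ∃ c : ℝ, G 0 - G 1 = c := by
    refine ⟨-∫ x in (0 : ℝ)..1, x ^ k * Real.exp (x ^ 3 / 3), ?_⟩
    have := integral_segment hc hG 0 1 1
    simp only [zero_add, one_mul, Complex.ofReal_one] at this
    rw [Complex.ofReal_neg, ← intervalIntegral.integral_ofReal]
    rw [← neg_sub, ← this]
    congr 1
    refine intervalIntegral.integral_congr fun x _ => ?_
    simp [cubicExp]
  obtain ⟨c, hcc⟩ := hreal
  refine ⟨c, ?_⟩
  have hR : Tendsto (fun ρ : ℝ => ρ * (Real.sqrt 3 / 2)) atTop atTop :=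
    tendsto_id.atTop_mul_const (by positivity)
  have h1 := (intervalIntegral_tendsto_integral_Ioi 0 (integrable_airyInt k 0).integrableOn
    hR).const_mul Complex.I
  have hi : IntegrableOn (fun r : ℝ => ((r ^ k * Real.exp (-r ^ 3 / 3) : ℝ) : ℂ)) (Set.Ioi 0) :=
    (integrableOn_cubicMoment k).ofReal
  have h2 := (intervalIntegral_tendsto_integral_Ioi 0 hi tendsto_id).const_mul (om ^ (k + 1))
  have h3 := ((tendsto_horizontal hG).add h2).add_const (c : ℂ)
  rw [zero_add] at h3
  refine (tendsto_nhds_unique h1 (h3.congr fun ρ => ?_)).trans ?_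
  · have e1 := integral_segment hc hG 1 Complex.I (ρ * (Real.sqrt 3 / 2))
    have e2 := integral_segment hc hG 0 om ρ
    simp only [cubicExp_om] at e2
    simp only [← airyInt_zero] at e1
    rw [intervalIntegral.integral_const_mul] at e1
    rw [e1, ← hcc]
    have e3 : (∫ x in (0 : ℝ)..ρ, om * (om ^ k * ((x ^ k * Real.exp (-x ^ 3 / 3) : ℝ) : ℂ))) =
        om ^ (k + 1) * ∫ x in (0 : ℝ)..ρ, ((x ^ k * Real.exp (-x ^ 3 / 3) : ℝ) : ℂ) := by
      rw [← intervalIntegral.integral_const_mul]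
      congr 1; ext x; ring
    rw [e3] at e2
    simp only [id]
    rw [e2]
    ring
  · congr 2
    exact integral_ofReal

lemma Jf_zero_eq (k : ℕ) (hk : k < 2) : Jf k 0 = (Real.sqrt 3 * cubicMoment k : ℝ) := by
  obtain ⟨c, hc⟩ := half_line k
  set Z := ∫ η in Set.Ioi (0 : ℝ), airyInt k 0 η with hZ
  have hJ : Jf k 0 = (starRingEnd ℂ) Z + Z := by
    rw [Jf_eq, ← integral_add_compl measurableSet_Iic (integrable_airyInt k 0),
      Set.compl_Iic]
    congr 1
    rw [hZ, ← integral_conj]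
    have := integral_comp_neg_Ioi (c := (0 : ℝ)) (fun η => airyInt k 0 η)
    rw [neg_zero] at this
    rw [← this]
    congr 1; ext η
    simp [airyInt, ← Complex.exp_conj, sub_eq_add_neg, map_ofNat]
  have him := congrArg Complex.im hc
  have hom : (om ^ (k + 1)).im = Real.sqrt 3 / 2 := by
    interval_cases k
    · simp [om]
    · rw [om_sq]; simp
  rw [Complex.I_mul_im, Complex.add_im, Complex.im_mul_ofReal, hom, Complex.ofReal_im] at him
  rw [hJ, add_comm, Complex.add_conj, him]
  congr 1; ring

lemma Gamma_third_mul : Real.Gamma (1 / 3) * Real.Gamma (2 / 3) * Real.sqrt 3 = 2 * Real.pi := by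
  have h := Real.Gamma_mul_Gamma_one_sub (1 / 3)
  rw [show (1 : ℝ) - 1 / 3 = 2 / 3 by norm_num, show Real.pi * (1 / 3) = Real.pi / 3 by ring,
    Real.sin_pi_div_three] at h
  rw [h]
  field_simp

lemma Jf_zero_zero : ((2 * Real.pi)⁻¹ : ℝ) * Jf 0 0 =
    ((3 : ℝ) ^ (-(2 : ℝ) / 3) / Real.Gamma (2 / 3) : ℝ) := by
  rw [Jf_zero_eq 0 (by norm_num), ← Complex.ofReal_mul, cubicMoment_eq]
  congr 1
  have h1 := Gamma_third_mul
  have h3 : Real.sqrt 3 ^ 2 = 3 := Real.sq_sqrt (by norm_num)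
  have hG := Real.Gamma_pos_of_pos (show (0 : ℝ) < 2 / 3 by norm_num)
  have e : (1 / 3 : ℝ) ^ (-(((0 : ℕ) : ℝ) + 1) / 3) = 3 * 3 ^ (-(2 : ℝ) / 3) := by
    rw [one_div, Real.inv_rpow (by norm_num), ← Real.rpow_neg (by norm_num),
      ← Real.rpow_one_add' (by norm_num) (by norm_num)]
    norm_num
  rw [e]
  have hp := Real.pi_pos
  simp only [Nat.cast_zero, zero_add]
  field_simp
  linear_combination h1

lemma Jf_one_zero : ((2 * Real.pi)⁻¹ : ℝ) * Jf 1 0 =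
    ((3 : ℝ) ^ (-(1 : ℝ) / 3) / Real.Gamma (1 / 3) : ℝ) := by
  rw [Jf_zero_eq 1 (by norm_num), ← Complex.ofReal_mul, cubicMoment_eq]
  congr 1
  have h1 := Gamma_third_mul
  have h3 : Real.sqrt 3 ^ 2 = 3 := Real.sq_sqrt (by norm_num)
  have hG := Real.Gamma_pos_of_pos (show (0 : ℝ) < 1 / 3 by norm_num)
  have e : (1 / 3 : ℝ) ^ (-(((1 : ℕ) : ℝ) + 1) / 3) = 3 * 3 ^ (-(1 : ℝ) / 3) := by
    rw [one_div, Real.inv_rpow (by norm_num), ← Real.rpow_neg (by norm_num),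
      ← Real.rpow_one_add' (by norm_num) (by norm_num)]
    norm_num
  have e2 : (((1 : ℕ) : ℝ) + 1) / 3 = 2 / 3 := by norm_num
  rw [e, e2]
  have hp := Real.pi_pos
  field_simp
  linear_combination h1

end

section

lemma airy_ode_eq_zero {f f' : ℝ → ℂ} (h1 : ∀ x, HasDerivAt f (f' x) x)
    (h2 : ∀ x : ℝ, HasDerivAt f' (x * f x) x) {t₀ : ℝ} (h3 : f t₀ = 0) (h4 : f' t₀ = 0) (x : ℝ) :
    f x = 0 := by
  set R : ℝ := |t₀| + |x| + 1 with hR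
  have hR1 : 1 ≤ R := by rw [hR]; linarith [abs_nonneg t₀, abs_nonneg x]
  have hmem : ∀ y, |y| < R → y ∈ Set.Ioo (-R) R := fun y hy => abs_lt.1 hy
  have h := ODE_solution_unique_of_mem_Ioo (a := -R) (b := R) (K := R.toNNReal) (t₀ := t₀)
    (v := fun (t : ℝ) (p : ℂ × ℂ) => ((p.2, t * p.1) : ℂ × ℂ)) (s := fun _ => Set.univ)
    (f := fun y => (f y, f' y)) (g := fun _ => (0, 0)) (fun t ht => ?_)
    (hmem _ (by rw [hR]; linarith [abs_nonneg x]))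
    (fun t _ => ⟨(h1 t).prodMk (h2 t), Set.mem_univ _⟩)
    (fun t _ => ⟨(hasDerivAt_const t ((0, 0) : ℂ × ℂ)).congr_deriv (by simp; rfl), Set.mem_univ _⟩)
    (by simp [h3, h4])
  · have := h (hmem x (by rw [hR]; linarith [abs_nonneg t₀]))
    simpa using congrArg Prod.fst this
  · refine LipschitzWith.lipschitzOnWith (LipschitzWith.of_dist_le_mul fun p q => ?_)
    rw [Real.coe_toNNReal _ (by linarith), Prod.dist_eq, Prod.dist_eq]
    have e1 := dist_nonneg (x := p.1) (y := q.1)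
    have e2 := dist_nonneg (x := p.2) (y := q.2)
    refine max_le ?_ ?_
    · exact (le_max_right _ _).trans (le_mul_of_one_le_left (e1.trans (le_max_left _ _)) hR1)
    · have : dist ((t : ℂ) * p.1) (t * q.1) = |t| * dist p.1 q.1 := by
        rw [dist_eq_norm, ← mul_sub, norm_mul, Complex.norm_real, ← dist_eq_norm, Real.norm_eq_abs]
      rw [this]
      have := (abs_lt.2 ht).le
      exact mul_le_mul this (le_max_left _ _) e1 (by linarith)

lemma airy_eq {A A' : ℝ → ℝ} (hA : IsAiry A A') (s : ℝ) :
    (A s : ℂ) = ((2 * Real.pi)⁻¹ : ℝ) * Jf 0 s := by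
  obtain ⟨h1, h2, h3, h4⟩ := hA
  have h := airy_ode_eq_zero (f := fun s => (A s : ℂ) - ((2 * Real.pi)⁻¹ : ℝ) * Jf 0 s)
    (f' := fun s => (A' s : ℂ) - ((2 * Real.pi)⁻¹ : ℝ) * (-Jf 1 s)) (t₀ := 0)
    (fun x => (h1 x).ofReal_comp.sub ((hasDerivAt_Jf 0 x).const_mul _))
    (fun x => ((h2 x).ofReal_comp.sub ((hasDerivAt_Jf 1 x).neg.const_mul _)).congr_deriv ?_)
    ?_ ?_ s
  · exact sub_eq_zero.1 h
  · rw [show 1 + 1 = 2 from rfl, Jf_two]; push_cast; ring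
  · rw [h3, Jf_zero_zero, sub_self]
  · rw [mul_neg, Jf_one_zero, h4]; push_cast; ring

lemma tendsto_Wn_airy {A A' : ℝ → ℝ} (hA : IsAiry A A') (k : ℕ) (s : ℝ) :
    Tendsto (fun n => Wn n (n - k) s) atTop (nhds (A s)) := by
  have h := tendsto_Wn k s
  rw [← airy_eq hA] at h
  exact tendsto_ofReal_iff.1 h

lemma exists_abs_airy_le {A A' : ℝ → ℝ} (hA : IsAiry A A') (T : ℝ) :
    ∃ C > 0, ∀ s, T ≤ s → |A s| ≤ C * Real.exp (-s / 2) := by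
  obtain ⟨C, hC, h⟩ := exists_abs_Wn_le T
  refine ⟨C, hC, fun s hs => ?_⟩
  refine le_of_tendsto (tendsto_Wn_airy hA 0 s).abs ?_
  filter_upwards [eventually_gt_atTop 0] with n hn
  exact h n _ hn (Nat.sub_le _ _) s hs

lemma airy_mul_deriv_nonpos {A A' : ℝ → ℝ} (hA : IsAiry A A') {s : ℝ} (hs : 0 ≤ s) :
    A s * A' s ≤ 0 := by
  by_contra! hpos
  have hd : ∀ x, HasDerivAt (fun x => A x * A' x) (A' x ^ 2 + x * A x ^ 2) x := fun x =>
    ((hA.1 x).mul (hA.2.1 x)).congr_deriv (by ring)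
  have hmono : MonotoneOn (fun x => A x * A' x) (Set.Ici 0) := by
    refine monotoneOn_of_deriv_nonneg (convex_Ici 0)
      (fun x _ => (hd x).continuousAt.continuousWithinAt)
      (fun x _ => (hd x).differentiableAt.differentiableWithinAt) fun x hx => ?_
    rw [interior_Ici, Set.mem_Ioi] at hx
    rw [(hd x).deriv]; positivity
  have hd2 : ∀ x, HasDerivAt (fun x => A x ^ 2 - 2 * (A s * A' s) * x)
      (2 * (A x * A' x) - 2 * (A s * A' s)) x := fun x =>
    (((hA.1 x).pow 2).sub ((hasDerivAt_id x).const_mul _)).congr_deriv (by push_cast; ring)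
  have hmono2 : MonotoneOn (fun x => A x ^ 2 - 2 * (A s * A' s) * x) (Set.Ici s) := by
    refine monotoneOn_of_deriv_nonneg (convex_Ici s)
      (fun x _ => (hd2 x).continuousAt.continuousWithinAt)
      (fun x _ => (hd2 x).differentiableAt.differentiableWithinAt) fun x hx => ?_
    rw [interior_Ici, Set.mem_Ioi] at hx
    rw [(hd2 x).deriv]
    have := hmono (Set.mem_Ici.2 hs) (Set.mem_Ici.2 (hs.trans hx.le)) hx.le
    simp only at this
    linarith
  obtain ⟨C, hC, hb⟩ := exists_abs_airy_le hA 0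
  set x : ℝ := s + (C ^ 2 + 1) / (2 * (A s * A' s)) with hx
  have hxs : s ≤ x := by rw [hx]; have : 0 ≤ (C ^ 2 + 1) / (2 * (A s * A' s)) := by positivity
                         linarith
  have h1 := hmono2 (Set.mem_Ici.2 le_rfl) (Set.mem_Ici.2 hxs) hxs
  have h2 : A x ^ 2 ≤ C ^ 2 := by
    rw [← sq_abs]
    refine pow_le_pow_left₀ (abs_nonneg _) ((hb x (hs.trans hxs)).trans ?_) 2
    have : Real.exp (-x / 2) ≤ 1 := Real.exp_le_one_iff.2 (by linarith)
    nlinarith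
  have h3 : 2 * (A s * A' s) * x = 2 * (A s * A' s) * s + (C ^ 2 + 1) := by
    have := hpos.ne'
    rw [hx, mul_add, mul_div_cancel₀]
    positivity
  simp only at h1
  nlinarith [sq_nonneg (A s)]

lemma airy_sq_antitone {A A' : ℝ → ℝ} (hA : IsAiry A A') : AntitoneOn (fun s => A s ^ 2) (Set.Ici 0) := by
  have hd2 : ∀ x, HasDerivAt (fun x => A x ^ 2) (2 * (A x * A' x)) x := fun x =>
    ((hA.1 x).pow 2).congr_deriv (by push_cast; ring)
  refine antitoneOn_of_deriv_nonpos (convex_Ici 0)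
    (fun x _ => (hd2 x).continuousAt.continuousWithinAt)
    (fun x _ => (hd2 x).differentiableAt.differentiableWithinAt) fun x hx => ?_
  rw [interior_Ici, Set.mem_Ioi] at hx
  rw [(hd2 x).deriv]
  linarith [airy_mul_deriv_nonpos hA hx.le]

lemma airy_ne_zero {A A' : ℝ → ℝ} (hA : IsAiry A A') {s : ℝ} (hs : 0 ≤ s) : A s ≠ 0 := by
  intro h0
  have hz : ∀ x, s ≤ x → A x = 0 := fun x hx => by
    have := airy_sq_antitone hA (Set.mem_Ici.2 hs) (Set.mem_Ici.2 (hs.trans hx)) hx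
    simp only [h0] at this
    nlinarith [sq_nonneg (A x)]
  have h0' : A' (s + 1) = 0 := by
    have h1 : HasDerivAt A 0 (s + 1) := by
      refine (hasDerivAt_const (s + 1) (0 : ℝ)).congr_of_eventuallyEq ?_
      filter_upwards [lt_mem_nhds (show s < s + 1 by linarith)] with x hx using hz x hx.le
    exact (hA.1 _).unique h1
  have h := airy_ode_eq_zero (f := fun x => (A x : ℂ)) (f' := fun x => (A' x : ℂ)) (t₀ := s + 1)
    (fun x => (hA.1 x).ofReal_comp) (fun x => (hA.2.1 x).ofReal_comp.congr_deriv (by push_cast; ring))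
    (by simp [hz (s + 1) (by linarith)]) (by simp [h0']) 0
  have h2 : A 0 = 0 := by exact_mod_cast h
  rw [hA.2.2.1] at h2
  have := Real.Gamma_pos_of_pos (show (0 : ℝ) < 2 / 3 by norm_num)
  have h3 : (0 : ℝ) < 3 ^ (-(2 : ℝ) / 3) / Real.Gamma (2 / 3) := by positivity
  linarith

lemma abs_airy_le_of_le {A A' : ℝ → ℝ} (hA : IsAiry A A') {s x : ℝ} (hs : 0 ≤ s) (hx : s ≤ x) :
    |A x| ≤ |A s| :=
  sq_le_sq.1 (airy_sq_antitone hA (Set.mem_Ici.2 hs) (Set.mem_Ici.2 (hs.trans hx)) hx)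

end

section

section affine
variable {E : Type*} [NormedAddCommGroup E]

lemma integrable_comp_affine {f : ℝ → E} (hf : Integrable f) (c : ℝ) {d : ℝ} (hd : 0 < d) :
    Integrable fun s => f (c + d * s) :=
  (hf.comp_add_left c).comp_mul_left' hd.ne'

variable [NormedSpace ℝ E]

lemma integral_comp_affine (f : ℝ → E) (c : ℝ) {d : ℝ} (hd : 0 < d) :
    ∫ s, f (c + d * s) = d⁻¹ • ∫ y, f y := by
  rw [Measure.integral_comp_mul_left (fun y => f (c + y)), integral_add_left_eq_self,
    abs_of_pos (inv_pos.2 hd)]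

lemma integral_Ioi_comp_affine (f : ℝ → E) (c t : ℝ) {d : ℝ} (hd : 0 < d) :
    ∫ s in Set.Ioi t, f (c + d * s) = d⁻¹ • ∫ y in Set.Ioi (c + d * t), f y := by
  rw [← integral_indicator measurableSet_Ioi, ← integral_indicator measurableSet_Ioi,
    ← integral_comp_affine _ c hd]
  congr 1; ext s
  simp only [Set.indicator, Set.mem_Ioi, add_lt_add_iff_left, mul_lt_mul_iff_right₀ hd]

end affine

/-- The derivative of `xs n`. -/
def dn (n : ℕ) : ℝ := hh n * del n ^ 2

lemma dn_pos {n : ℕ} (hn : 0 < n) : 0 < dn n := by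
  have := hh_pos hn
  have := del_pos hn
  unfold dn; positivity

lemma xs_affine (n : ℕ) (s : ℝ) : xs n s = 2 * hh n + dn n * s := by
  rw [xs_eq, dn]; ring

/-- Orthonormal Hermite functions in the edge variable. -/
def ek (n k : ℕ) (s : ℝ) : ℝ := Real.sqrt (dn n / Nn k) * phi k (xs n s)

lemma continuous_xs (n : ℕ) : Continuous (xs n) := by unfold xs; fun_prop

lemma memLp_phi_xs {n : ℕ} (hn : 0 < n) (k : ℕ) : MemLp (fun s => phi k (xs n s)) 2 volume := by
  refine (memLp_two_iff_integrable_sq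
    ((continuous_phi k).comp (continuous_xs n)).aestronglyMeasurable).2 ?_
  have h := integrable_comp_affine (integrable_phi_mul_phi k k 0 0) (2 * hh n) (dn_pos hn)
  refine h.congr (Eventually.of_forall fun s => ?_)
  simp only [zero_add, Function.comp, xs_affine]; ring

lemma memLp_ek {n : ℕ} (hn : 0 < n) (k : ℕ) : MemLp (ek n k) 2 volume :=
  (memLp_phi_xs hn k).const_mul _

lemma continuous_ek (n k : ℕ) : Continuous (ek n k) :=
  continuous_const.mul ((continuous_phi k).comp (continuous_xs n))

lemma ek_orthonormal {n : ℕ} (hn : 0 < n) (j k : ℕ) :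
    ∫ s, ek n j s * ek n k s = if j = k then 1 else 0 := by
  have hd := dn_pos hn
  have e : ∀ s, ek n j s * ek n k s = (Real.sqrt (dn n / Nn j) * Real.sqrt (dn n / Nn k)) *
      (fun y => phi j y * phi k y) (2 * hh n + dn n * s) := fun s => by
    simp only [ek, xs_affine]; ring
  rw [integral_congr_ae (Eventually.of_forall e), integral_const_mul,
    integral_comp_affine (fun y => phi j y * phi k y) _ hd, integral_phi_mul_phi]
  split_ifs with h
  · subst h
    have hN := Nn_pos j
    rw [Real.mul_self_sqrt (by positivity), smul_eq_mul]
    field_simp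
  · simp

/-- The rescaled Christoffel–Darboux kernel. -/
def Kt (n : ℕ) (s r : ℝ) : ℝ := ∑ k ∈ Finset.range n, ek n k s * ek n k r

/-- The orthogonality relations with respect to the Gaussian weight times `1 - γ 1_{x > l}`. -/
def IsOrth (γ : ℂ) (n : ℕ) (l : ℝ) (p : ℂ[X]) : Prop :=
  p.coeff n = 1 ∧ p.natDegree ≤ n ∧ ∀ f : ℂ[X], f.natDegree < n → L 0 0 (p * f) =
    γ * ∫ y in Set.Ioi l, (p * f).eval (y : ℂ) * (gauss 0 y : ℂ)

/-- Rescaled orthogonal polynomials at the edge. -/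
def Ff (n : ℕ) (p : ℂ[X]) (s : ℝ) : ℂ :=
  cn n * (p.eval (xs n s : ℂ) * (Real.exp (-xs n s ^ 2 / 2) : ℂ))

lemma continuous_Ff (n : ℕ) (p : ℂ[X]) : Continuous (Ff n p) := by
  have := continuous_xs n
  unfold Ff; fun_prop

lemma Wn_self {n : ℕ} (hn : 0 < n) (s : ℝ) : Wn n n s = cn n * phi n (xs n s) := by
  have := hh_pos hn
  rw [Wn, mul_div_assoc, div_self (by positivity), mul_one]

lemma Ff_eq_sum {γ : ℂ} {n : ℕ} (hn : 0 < n) {t : ℝ} {p : ℂ[X]} (hp : IsOrth γ n (xs n t) p)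
    (s : ℝ) : Ff n p s = Wn n n s + γ * ∑ k ∈ Finset.range n,
      (ek n k s : ℂ) * ∫ y in Set.Ioi t, (ek n k y : ℂ) * Ff n p y := by
  have hd := dn_pos hn
  rw [Ff, reproducing hn hp.1 hp.2.1 hp.2.2, Wn_self hn, mul_add, Complex.ofReal_mul]
  congr 1
  rw [mul_left_comm, Finset.mul_sum]
  congr 1
  refine Finset.sum_congr rfl fun k _ => ?_
  have e : ∀ y, (ek n k y : ℂ) * Ff n p y = (Real.sqrt (dn n / Nn k) * cn n : ℂ) *
      (fun x : ℝ => (phi k x : ℂ) * (p.eval (x : ℂ) * (Real.exp (-x ^ 2 / 2) : ℂ)))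
        (2 * hh n + dn n * y) := fun y => by
    simp only [ek, Ff, ← xs_affine]; push_cast; ring
  rw [integral_congr_ae (Eventually.of_forall e), integral_const_mul,
    integral_Ioi_comp_affine (fun x : ℝ => (phi k x : ℂ) * (p.eval (x : ℂ) *
      (Real.exp (-x ^ 2 / 2) : ℂ))) _ _ hd, ← xs_affine, ek]
  have hN := Nn_pos k
  have h2 : ((Real.sqrt (dn n / Nn k) : ℝ) : ℂ) * (Real.sqrt (dn n / Nn k) : ℝ) =
      (dn n : ℂ) / Nn k := by
    rw [← Complex.ofReal_mul, Real.mul_self_sqrt (by positivity)]; push_cast; ring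
  rw [Complex.real_smul]
  push_cast
  have hdc : (dn n : ℂ) ≠ 0 := by exact_mod_cast hd.ne'
  have e3 : ∀ a b c f I : ℂ, a * f * (a * c * (b⁻¹ * I)) = (a * a) * (c * f * b⁻¹ * I) := by
    intros; ring
  rw [e3, h2]
  field_simp

lemma memLp_Wn {n : ℕ} (hn : 0 < n) (m : ℕ) : MemLp (Wn n m) 2 volume :=
  (memLp_phi_xs hn m).const_mul _

lemma memLp_Ff {γ : ℂ} {n : ℕ} (hn : 0 < n) {t : ℝ} {p : ℂ[X]} (hp : IsOrth γ n (xs n t) p) :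
    MemLp (Ff n p) 2 volume := by
  have e : Ff n p = fun s => (Wn n n s : ℂ) + γ * ∑ k ∈ Finset.range n,
      (ek n k s : ℂ) * ∫ y in Set.Ioi t, (ek n k y : ℂ) * Ff n p y := by
    ext s; exact Ff_eq_sum hn hp s
  rw [e]
  have h1 : MemLp (fun s => (Wn n n s : ℂ)) 2 volume := (memLp_Wn hn n).ofReal
  have h2 : MemLp (fun s => ∑ k ∈ Finset.range n,
      (ek n k s : ℂ) * ∫ y in Set.Ioi t, (ek n k y : ℂ) * Ff n p y) 2 volume := by
    refine memLp_finsetSum _ fun k _ => ?_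
    have h3 : MemLp (fun s => (ek n k s : ℂ)) 2 volume := (memLp_ek hn k).ofReal
    exact h3.mul_const _
  exact h1.add (h2.const_mul γ)

lemma Ff_eq_integral {γ : ℂ} {n : ℕ} (hn : 0 < n) {t : ℝ} {p : ℂ[X]} (hp : IsOrth γ n (xs n t) p)
    (s : ℝ) : Ff n p s = Wn n n s + γ * ∫ y in Set.Ioi t, (Kt n s y : ℂ) * Ff n p y := by
  rw [Ff_eq_sum hn hp]
  congr 2
  have e : ∀ y, (Kt n s y : ℂ) * Ff n p y =
      ∑ k ∈ Finset.range n, (ek n k s : ℂ) * ((ek n k y : ℂ) * Ff n p y) := fun y => by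
    rw [Kt]; push_cast; rw [Finset.sum_mul]
    exact Finset.sum_congr rfl fun k _ => by ring
  simp only [e]
  rw [integral_finsetSum _ fun k _ => (integrable_ofReal_mul ((memLp_ek hn k).restrict _)
    ((memLp_Ff hn hp).restrict _)).const_mul _]
  simp only [integral_const_mul]

/-- The constant in the rescaled Christoffel–Darboux formula. -/
def alp (n : ℕ) : ℝ := dn n ^ 2 / (Nn (n - 1) * cn n ^ 2 * hh n)

lemma Kt_eq {n : ℕ} (hn : 0 < n) (s s' : ℝ) : Kt n s s' = alp n * ∫ z in Set.Ioi (0 : ℝ),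
    (Wn n (n - 1) (s + z) * Wn n n (s' + z) + Wn n n (s + z) * Wn n (n - 1) (s' + z)) := by
  have hd := dn_pos hn
  have hc := cn_pos hn
  have hh0 := hh_pos hn
  have h1 : Kt n s s' = dn n * Kn n (xs n s) (xs n s') := by
    rw [Kt, Kn, Finset.mul_sum]
    refine Finset.sum_congr rfl fun k _ => ?_
    have hN := Nn_pos k
    have h2 := Real.mul_self_sqrt (show 0 ≤ dn n / Nn k by positivity)
    rw [ek, ek]
    linear_combination phi k (xs n s) * phi k (xs n s') * h2
  obtain ⟨m, rfl⟩ : ∃ m, n = m + 1 := ⟨n - 1, by omega⟩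
  rw [h1, Kn_eq_integral]
  simp only [Nat.add_sub_cancel, alp]
  have h2 := integral_Ioi_comp_affine (fun z => phi m (xs (m + 1) s + z) *
    phi (m + 1) (xs (m + 1) s' + z) + phi (m + 1) (xs (m + 1) s + z) * phi m (xs (m + 1) s' + z))
    0 0 hd
  simp only [zero_add, mul_zero, smul_eq_mul] at h2
  have e : ∀ a z, xs (m + 1) a + dn (m + 1) * z = xs (m + 1) (a + z) := fun a z => by
    simp only [xs_affine]; ring
  simp only [e] at h2
  have e2 : ∀ z, Wn (m + 1) m (s + z) * Wn (m + 1) (m + 1) (s' + z) +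
      Wn (m + 1) (m + 1) (s + z) * Wn (m + 1) m (s' + z) = (cn (m + 1) ^ 2 * hh (m + 1)) *
      (phi m (xs (m + 1) (s + z)) * phi (m + 1) (xs (m + 1) (s' + z)) +
        phi (m + 1) (xs (m + 1) (s + z)) * phi m (xs (m + 1) (s' + z))) := fun z => by
    simp only [Wn]
    field_simp
    ring
  simp only [e2]
  rw [integral_const_mul, h2]
  have hN := Nn_pos m
  field_simp

end

section

lemma hh_pow_two_mul (n : ℕ) : hh n ^ (2 * n) = ((n : ℝ) / 2) ^ n := by rw [pow_mul, hh_sq]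

lemma stirlingSeq_pow_mul {n : ℕ} (hn : 0 < n) :
    (n.factorial : ℝ) = Stirling.stirlingSeq n * (2 * hh n) * n ^ n / Real.exp n := by
  have hn' : (0 : ℝ) < n := by exact_mod_cast hn
  have h2 : Real.sqrt (2 * n) = 2 * hh n := by
    rw [hh, show (2 * n : ℝ) = 2 ^ 2 * (n / 2) by ring, Real.sqrt_mul (by norm_num),
      Real.sqrt_sq (by norm_num)]
  have hh0 := hh_pos hn
  rw [Stirling.stirlingSeq, h2, div_pow, ← Real.exp_nat_mul, mul_one]
  field_simp

/-- Stirling's formula in the form needed at the edge. -/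
lemma cn_sq_mul_Nn {n : ℕ} (hn : 0 < n) :
    cn n ^ 2 * Nn n * (2 * Real.sqrt Real.pi * hh n * del n ^ 2) = Stirling.stirlingSeq n := by
  have hn' : (0 : ℝ) < n := by exact_mod_cast hn
  have hh0 := hh_pos hn
  have hd := del_pos hn
  have e1 : cn n ^ 2 = Real.exp n / (4 * Real.pi * (((n : ℝ) / 2) ^ n * hh n ^ 2) * del n ^ 2) := by
    rw [cn, div_pow, mul_pow, mul_pow, mul_pow, Real.sq_sqrt Real.pi_pos.le, ← Real.exp_nat_mul,
      ← hh_pow_two_mul]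
    push_cast
    congr 1
    · congr 1; ring
    · ring
  have h3 := Real.sq_sqrt Real.pi_pos.le
  have hsp := Real.sqrt_pos.2 Real.pi_pos
  rw [e1, Nn, stirlingSeq_pow_mul hn, div_pow]
  field_simp
  linear_combination (4 * Stirling.stirlingSeq n) * h3

lemma alp_eq {n : ℕ} (hn : 0 < n) : alp n = Real.sqrt Real.pi / (2 * Stirling.stirlingSeq n) := by
  have hn' : (0 : ℝ) < n := by exact_mod_cast hn
  have hh0 := hh_pos hn
  have hd := del_pos hn
  have hc := cn_pos hn
  have hN := Nn_pos (n - 1)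
  have hsp := Real.sqrt_pos.2 Real.pi_pos
  have hN2 : Nn n = n / 2 * Nn (n - 1) := by
    obtain ⟨m, rfl⟩ : ∃ m, n = m + 1 := ⟨n - 1, by omega⟩
    rw [Nn_succ]; simp
  rw [alp, ← cn_sq_mul_Nn hn, hN2, dn]
  have h1 := hh_sq n
  have h2 := del_cube hn
  field_simp
  linear_combination (2 * n * del n ^ 6) * h1 + (n * del n ^ 3 + 1) * h2

lemma tendsto_alp : Tendsto alp atTop (nhds (1 / 2)) := by
  have hsp := Real.sqrt_pos.2 Real.pi_pos
  have h := (Stirling.tendsto_stirlingSeq_sqrt_pi.const_mul 2).inv₀ (by positivity)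
  have h2 := h.const_mul (Real.sqrt Real.pi)
  have e : Real.sqrt Real.pi * (2 * Real.sqrt Real.pi)⁻¹ = 1 / 2 := by field_simp
  rw [e] at h2
  refine h2.congr' ?_
  filter_upwards [eventually_gt_atTop 0] with n hn
  rw [alp_eq hn, div_eq_mul_inv]

lemma alp_pos {n : ℕ} (hn : 0 < n) : 0 < alp n := by
  have := dn_pos hn
  have := cn_pos hn
  have := hh_pos hn
  have := Nn_pos (n - 1)
  unfold alp; positivity

lemma alp_le {n : ℕ} (hn : 0 < n) : alp n ≤ 1 / 2 := by
  have h := Stirling.sqrt_pi_le_stirlingSeq hn.ne'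
  have hsp := Real.sqrt_pos.2 Real.pi_pos
  rw [alp_eq hn, div_le_div_iff₀ (by linarith) (by norm_num)]
  linarith

lemma continuous_Wn (n m : ℕ) : Continuous (Wn n m) :=
  continuous_const.mul ((continuous_phi m).comp (continuous_xs n))

/-- The integrand in the Christoffel–Darboux formula. -/
def cdInt (n : ℕ) (s s' z : ℝ) : ℝ :=
  Wn n (n - 1) (s + z) * Wn n n (s' + z) + Wn n n (s + z) * Wn n (n - 1) (s' + z)

lemma continuous_cdInt (n : ℕ) (s s' : ℝ) : Continuous (cdInt n s s') := by
  have h1 := continuous_Wn n n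
  have h2 := continuous_Wn n (n - 1)
  unfold cdInt; fun_prop

lemma integrable_exp_neg_Ioi (C : ℝ) (t : ℝ) :
    Integrable (fun z : ℝ => C * Real.exp (-z)) (volume.restrict (Set.Ioi t)) :=
  (integrableOn_exp_neg_Ioi t).const_mul C

lemma exists_abs_cdInt_le (T : ℝ) : ∃ C > 0, ∀ n, 0 < n → ∀ s s', T ≤ s → T ≤ s' → ∀ z, 0 ≤ z →
    |cdInt n s s' z| ≤ C * (Real.exp (-s / 2) * Real.exp (-s' / 2)) * Real.exp (-z) := by
  obtain ⟨C, hC, h⟩ := exists_abs_Wn_le T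
  refine ⟨2 * C ^ 2, by positivity, fun n hn s s' hs hs' z hz => ?_⟩
  have h1 := h n n hn le_rfl (s + z) (by linarith)
  have h2 := h n n hn le_rfl (s' + z) (by linarith)
  have h3 := h n (n - 1) hn (Nat.sub_le _ _) (s + z) (by linarith)
  have h4 := h n (n - 1) hn (Nat.sub_le _ _) (s' + z) (by linarith)
  have e : Real.exp (-s / 2) * Real.exp (-s' / 2) * Real.exp (-z) =
      Real.exp (-(s + z) / 2) * Real.exp (-(s' + z) / 2) := by
    rw [← Real.exp_add, ← Real.exp_add, ← Real.exp_add]; ring_nf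
  refine (abs_add_le _ _).trans ?_
  rw [abs_mul, abs_mul, mul_assoc, e]
  have h5 := mul_le_mul h3 h2 (abs_nonneg _) (by positivity)
  have h6 := mul_le_mul h1 h4 (abs_nonneg _) (by positivity)
  calc _ ≤ _ := add_le_add h5 h6
    _ = _ := by ring

lemma exists_abs_Kt_le (T : ℝ) : ∃ C > 0, ∀ n, 0 < n → ∀ s s', T ≤ s → T ≤ s' →
    |Kt n s s'| ≤ C * (Real.exp (-s / 2) * Real.exp (-s' / 2)) := by
  obtain ⟨C, hC, h⟩ := exists_abs_cdInt_le T
  refine ⟨C, hC, fun n hn s s' hs hs' => ?_⟩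
  have h1 : |∫ z in Set.Ioi (0 : ℝ), cdInt n s s' z| ≤
      ∫ z in Set.Ioi (0 : ℝ), C * (Real.exp (-s / 2) * Real.exp (-s' / 2)) * Real.exp (-z) := by
    rw [← Real.norm_eq_abs]
    refine norm_integral_le_of_norm_le (integrable_exp_neg_Ioi _ _) ?_
    filter_upwards [ae_restrict_mem measurableSet_Ioi] with z hz
    exact h n hn s s' hs hs' z (le_of_lt hz)
  rw [integral_const_mul, integral_exp_neg_Ioi, neg_zero, Real.exp_zero, mul_one] at h1
  have h2 := Kt_eq hn s s'
  change _ = alp n * ∫ z in Set.Ioi (0 : ℝ), cdInt n s s' z at h2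
  rw [h2, abs_mul, abs_of_pos (alp_pos hn)]
  have := alp_le hn
  have := alp_pos hn
  nlinarith [abs_nonneg (∫ z in Set.Ioi (0 : ℝ), cdInt n s s' z)]

/-- The Airy kernel. -/
def airyK (A : ℝ → ℝ) (s s' : ℝ) : ℝ := ∫ z in Set.Ioi (0 : ℝ), A (s + z) * A (s' + z)

lemma tendsto_Kt {A A' : ℝ → ℝ} (hA : IsAiry A A') (s s' : ℝ) :
    Tendsto (fun n => Kt n s s') atTop (nhds (airyK A s s')) := by
  obtain ⟨C, hC, h⟩ := exists_abs_cdInt_le (min s s')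
  have h1 : Tendsto (fun n => ∫ z in Set.Ioi (0 : ℝ), cdInt n s s' z) atTop
      (nhds (∫ z in Set.Ioi (0 : ℝ), 2 * (A (s + z) * A (s' + z)))) := by
    refine tendsto_integral_filter_of_dominated_convergence
      (fun z => C * (Real.exp (-s / 2) * Real.exp (-s' / 2)) * Real.exp (-z))
      (Eventually.of_forall fun n => (continuous_cdInt _ _ _).aestronglyMeasurable) ?_
      (integrable_exp_neg_Ioi _ _) (Eventually.of_forall fun z => ?_)
    · filter_upwards [eventually_gt_atTop 0] with n hn
      filter_upwards [ae_restrict_mem measurableSet_Ioi] with z hz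
      exact h n hn s s' (min_le_left _ _) (min_le_right _ _) z (le_of_lt hz)
    · have := ((tendsto_Wn_airy hA 1 (s + z)).mul (tendsto_Wn_airy hA 0 (s' + z))).add
        ((tendsto_Wn_airy hA 0 (s + z)).mul (tendsto_Wn_airy hA 1 (s' + z)))
      rw [← two_mul] at this
      exact this
  have h2 := tendsto_alp.mul h1
  rw [integral_const_mul, ← mul_assoc, one_div, inv_mul_cancel₀ two_ne_zero, one_mul] at h2
  refine h2.congr' ?_
  filter_upwards [eventually_gt_atTop 0] with n hn
  exact (Kt_eq hn s s').symm

lemma continuous_Kt (n : ℕ) (s : ℝ) : Continuous (Kt n s) := by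
  unfold Kt
  exact continuous_finsetSum _ fun k _ => continuous_const.mul (continuous_ek n k)

end

section

lemma memLp_exp_half (t : ℝ) :
    MemLp (fun y : ℝ => Real.exp (-y / 2)) 2 (volume.restrict (Set.Ioi t)) := by
  rw [memLp_two_iff_integrable_sq (by fun_prop)]
  refine (integrableOn_exp_neg_Ioi t).congr (Eventually.of_forall fun y => ?_)
  simp only
  rw [← Real.exp_nat_mul]; congr 1; push_cast; ring

variable {t : ℝ} {G : ℝ → ℂ}

lemma integrable_exp_half_mul_norm (hG : MemLp G 2 (volume.restrict (Set.Ioi t))) :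
    Integrable (fun y => Real.exp (-y / 2) * ‖G y‖) (volume.restrict (Set.Ioi t)) :=
  (memLp_exp_half t).integrable_mul hG.norm

lemma sq_integral_exp_half_le (hG : MemLp G 2 (volume.restrict (Set.Ioi t))) :
    (∫ y in Set.Ioi t, Real.exp (-y / 2) * ‖G y‖) ^ 2 ≤
      Real.exp (-t) * ∫ y in Set.Ioi t, ‖G y‖ ^ 2 := by
  set I := ∫ y in Set.Ioi t, Real.exp (-y / 2) * ‖G y‖ with hI
  set x := I * Real.exp t
  have hi1 := integrable_exp_neg_Ioi (x ^ 2) t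
  have hi2 := (integrable_exp_half_mul_norm hG).const_mul (2 * x)
  have hi3 : Integrable (fun y => ‖G y‖ ^ 2) (volume.restrict (Set.Ioi t)) :=
    (memLp_two_iff_integrable_sq_norm hG.1).1 hG
  have h : 0 ≤ ∫ y in Set.Ioi t, (x * Real.exp (-y / 2) - ‖G y‖) ^ 2 :=
    integral_nonneg fun y => sq_nonneg _
  have e : ∀ y, (x * Real.exp (-y / 2) - ‖G y‖) ^ 2 =
      x ^ 2 * Real.exp (-y) - 2 * x * (Real.exp (-y / 2) * ‖G y‖) + ‖G y‖ ^ 2 := fun y => by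
    have : Real.exp (-y) = Real.exp (-y / 2) ^ 2 := by
      rw [← Real.exp_nat_mul]; congr 1; push_cast; ring
    rw [this]; ring
  have hi12 : Integrable (fun y => x ^ 2 * Real.exp (-y) - 2 * x * (Real.exp (-y / 2) * ‖G y‖))
    (volume.restrict (Set.Ioi t)) := hi1.sub hi2
  simp only [e] at h
  rw [integral_add hi12 hi3, integral_sub hi1 hi2, integral_const_mul, integral_const_mul,
    integral_exp_neg_Ioi, ← hI] at h
  have h1 : Real.exp t * Real.exp (-t) = 1 := by rw [← Real.exp_add]; simp
  have h2 : x * Real.exp (-t) = I := by simp only [x]; rw [mul_assoc, h1, mul_one]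
  have h3 : I ^ 2 = Real.exp (-t) * (x * I) := by rw [← mul_assoc, mul_comm _ x, h2, sq]
  have h4 : x ^ 2 * Real.exp (-t) = x * I := by rw [sq, mul_assoc, h2]
  rw [h4] at h
  rw [h3]
  exact mul_le_mul_of_nonneg_left (by linarith) (Real.exp_pos _).le

lemma norm_integral_kernel_le {k : ℝ → ℝ} {B : ℝ}
    (hG : MemLp G 2 (volume.restrict (Set.Ioi t)))
    (hk : ∀ y, t < y → |k y| ≤ B * Real.exp (-y / 2)) :
    ‖∫ y in Set.Ioi t, (k y : ℂ) * G y‖ ≤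
      B * ∫ y in Set.Ioi t, Real.exp (-y / 2) * ‖G y‖ := by
  rw [← integral_const_mul]
  refine norm_integral_le_of_norm_le ((integrable_exp_half_mul_norm hG).const_mul B) ?_
  filter_upwards [ae_restrict_mem measurableSet_Ioi] with y hy
  rw [norm_mul, Complex.norm_real, Real.norm_eq_abs, ← mul_assoc]
  exact mul_le_mul_of_nonneg_right (hk y hy) (norm_nonneg _)

variable {γ : ℂ}

lemma exists_norm_Ff_le (hγ : Adm γ) (T : ℝ) : ∃ M > 0, ∀ n, 0 < n → ∀ t, T ≤ t → ∀ p,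
    IsOrth γ n (xs n t) p → ∀ s, t ≤ s → ‖Ff n p s‖ ≤ M * Real.exp (-s / 2) := by
  obtain ⟨C, hC, hW⟩ := exists_abs_Wn_le T
  obtain ⟨K, hK, hKt⟩ := exists_abs_Kt_le T
  obtain ⟨c0, hc0, hc⟩ := hγ.exists_coercive
  refine ⟨C + ‖γ‖ * K * (C / c0 * Real.exp (-T)), by positivity, fun n hn t ht p hp s hs => ?_⟩
  have hF := (memLp_Ff hn hp).restrict (Set.Ioi t)
  have hWm : MemLp (fun s => (Wn n n s : ℂ)) 2 (volume.restrict (Set.Ioi t)) :=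
    ((memLp_Wn hn n).restrict _).ofReal
  have h1 := coercive_Ioi hc0 hc (fun k _ => memLp_ek hn k)
    (fun j _ k _ => ek_orthonormal hn j k) hF hWm (fun s _ => Ff_eq_sum hn hp s)
  have h2 : ∫ s in Set.Ioi t, ‖(Wn n n s : ℂ)‖ ^ 2 ≤ C ^ 2 * Real.exp (-t) := by
    rw [← integral_exp_neg_Ioi t, ← integral_const_mul]
    refine integral_mono_ae ((memLp_two_iff_integrable_sq_norm hWm.1).1 hWm)
      (integrable_exp_neg_Ioi _ _) ?_
    filter_upwards [ae_restrict_mem measurableSet_Ioi] with y hy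
    have := hW n n hn le_rfl y (ht.trans (le_of_lt hy))
    rw [Complex.norm_real, Real.norm_eq_abs]
    calc _ ≤ (C * Real.exp (-y / 2)) ^ 2 := by gcongr
      _ = _ := by
        rw [mul_pow, ← Real.exp_nat_mul]; congr 2; push_cast; ring
  have h3 := sq_integral_exp_half_le hF
  set I := ∫ y in Set.Ioi t, Real.exp (-y / 2) * ‖Ff n p y‖
  set Q := ∫ y in Set.Ioi t, ‖Ff n p y‖ ^ 2
  have h4 : I ≤ C / c0 * Real.exp (-t) := by
    refine (le_abs_self I).trans (abs_le_of_sq_le_sq ?_ (by positivity))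
    have h5 : Q ≤ C ^ 2 * Real.exp (-t) / c0 ^ 2 := by
      rw [le_div_iff₀ (by positivity)]; linarith
    calc I ^ 2 ≤ Real.exp (-t) * Q := h3
      _ ≤ Real.exp (-t) * (C ^ 2 * Real.exp (-t) / c0 ^ 2) := by gcongr
      _ = _ := by field_simp
  have h6 : I ≤ C / c0 * Real.exp (-T) := h4.trans (by gcongr)
  have h7 := norm_integral_kernel_le (k := Kt n s) (B := K * Real.exp (-s / 2)) hF fun y hy => by
    rw [mul_assoc]
    exact hKt n hn s y (ht.trans hs) (ht.trans hy.le)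
  rw [Ff_eq_integral hn hp]
  calc _ ≤ ‖(Wn n n s : ℂ)‖ + ‖γ * ∫ y in Set.Ioi t, (Kt n s y : ℂ) * Ff n p y‖ := norm_add_le _ _
    _ ≤ C * Real.exp (-s / 2) + ‖γ‖ * (K * Real.exp (-s / 2) * (C / c0 * Real.exp (-T))) := by
      rw [Complex.norm_real, norm_mul, Real.norm_eq_abs]
      refine add_le_add (hW n n hn le_rfl s (ht.trans hs)) ?_
      refine mul_le_mul_of_nonneg_left (h7.trans ?_) (norm_nonneg _)
      gcongr
    _ = _ := by ring

/-- The inhomogeneity in the equation for the difference of two rescaled polynomials. -/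
def rem (γ : ℂ) (t : ℝ) (F : ℕ → ℝ → ℂ) (x : ℕ × ℕ) (s : ℝ) : ℂ :=
  F x.1 s - F x.2 s - γ * ∑ k ∈ Finset.range x.1,
    (ek x.1 k s : ℂ) * ∫ y in Set.Ioi t, (ek x.1 k y : ℂ) * (F x.1 y - F x.2 y)

variable {p : ℕ → ℂ[X]}

lemma sum_ek_eq_integral {n : ℕ} (hn : 0 < n) (hG : MemLp G 2 (volume.restrict (Set.Ioi t)))
    (s : ℝ) : ∑ k ∈ Finset.range n, (ek n k s : ℂ) * ∫ y in Set.Ioi t, (ek n k y : ℂ) * G y =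
      ∫ y in Set.Ioi t, (Kt n s y : ℂ) * G y := by
  have e : ∀ y, (Kt n s y : ℂ) * G y =
      ∑ k ∈ Finset.range n, (ek n k s : ℂ) * ((ek n k y : ℂ) * G y) := fun y => by
    rw [Kt]; push_cast; rw [Finset.sum_mul]
    exact Finset.sum_congr rfl fun k _ => by ring
  simp only [e]
  rw [integral_finsetSum _ fun k _ => (integrable_ofReal_mul ((memLp_ek hn k).restrict _)
    hG).const_mul _]
  simp only [integral_const_mul]

lemma memLp_Kt {n : ℕ} (hn : 0 < n) (s : ℝ) : MemLp (Kt n s) 2 volume := by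
  have : Kt n s = fun y => ∑ k ∈ Finset.range n, ek n k s * ek n k y := rfl
  rw [this]
  exact memLp_finsetSum _ fun k _ => (memLp_ek hn k).const_mul _

lemma rem_eq {x : ℕ × ℕ} (h1 : 0 < x.1) (h2 : 0 < x.2) (hp : ∀ n, 0 < n → IsOrth γ n (xs n t) (p n))
    (s : ℝ) : rem γ t (fun n => Ff n (p n)) x s = Wn x.1 x.1 s - Wn x.2 x.2 s +
      γ * ∫ y in Set.Ioi t, ((Kt x.1 s y - Kt x.2 s y : ℝ) : ℂ) * Ff x.2 (p x.2) y := by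
  have m1 := (memLp_Ff h1 (hp _ h1)).restrict (Set.Ioi t)
  have m2 := (memLp_Ff h2 (hp _ h2)).restrict (Set.Ioi t)
  have i1 := integrable_ofReal_mul ((memLp_Kt h1 s).restrict (Set.Ioi t)) m1
  have i2 := integrable_ofReal_mul ((memLp_Kt h1 s).restrict (Set.Ioi t)) m2
  have i3 := integrable_ofReal_mul ((memLp_Kt h2 s).restrict (Set.Ioi t)) m2
  rw [rem, sum_ek_eq_integral (G := fun y => Ff x.1 (p x.1) y - Ff x.2 (p x.2) y) h1 (m1.sub m2)]
  simp only [mul_sub, Complex.ofReal_sub, sub_mul]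
  rw [integral_sub i1 i2, integral_sub i2 i3]
  linear_combination Ff_eq_integral h1 (hp _ h1) s - Ff_eq_integral h2 (hp _ h2) s

lemma exists_norm_rem_le (hγ : Adm γ) (hp : ∀ n, 0 < n → IsOrth γ n (xs n t) (p n)) :
    ∃ B > 0, ∀ x : ℕ × ℕ, 0 < x.1 → 0 < x.2 → ∀ s, t ≤ s →
      ‖rem γ t (fun n => Ff n (p n)) x s‖ ≤ B * Real.exp (-s / 2) := by
  obtain ⟨C, hC, hW⟩ := exists_abs_Wn_le t
  obtain ⟨K, hK, hKt⟩ := exists_abs_Kt_le t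
  obtain ⟨M, hM, hF⟩ := exists_norm_Ff_le hγ t
  refine ⟨2 * C + ‖γ‖ * (2 * K * M * Real.exp (-t)), by positivity, fun x h1 h2 s hs => ?_⟩
  rw [rem_eq h1 h2 hp]
  have e1 := hW x.1 x.1 h1 le_rfl s hs
  have e2 := hW x.2 x.2 h2 le_rfl s hs
  have e3 : ‖∫ y in Set.Ioi t, ((Kt x.1 s y - Kt x.2 s y : ℝ) : ℂ) * Ff x.2 (p x.2) y‖ ≤
      2 * K * M * Real.exp (-s / 2) * Real.exp (-t) := by
    rw [← integral_exp_neg_Ioi t, ← integral_const_mul]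
    refine norm_integral_le_of_norm_le (integrable_exp_neg_Ioi _ _) ?_
    filter_upwards [ae_restrict_mem measurableSet_Ioi] with y hy
    have hy' : t ≤ y := le_of_lt hy
    rw [norm_mul, Complex.norm_real, Real.norm_eq_abs]
    have a1 := hKt x.1 h1 s y hs hy'
    have a2 := hKt x.2 h2 s y hs hy'
    have a3 := hF x.2 h2 t le_rfl _ (hp _ h2) y hy'
    have a4 : |Kt x.1 s y - Kt x.2 s y| ≤
        2 * K * (Real.exp (-s / 2) * Real.exp (-y / 2)) := by
      refine (abs_sub _ _).trans ?_
      linarith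
    have a5 : Real.exp (-y) = Real.exp (-y / 2) * Real.exp (-y / 2) := by
      rw [← Real.exp_add]; congr 1; ring
    calc _ ≤ _ := mul_le_mul a4 a3 (norm_nonneg _) (by positivity)
      _ = _ := by rw [a5]; ring
  have e4 : ‖((Wn x.1 x.1 s : ℂ) - Wn x.2 x.2 s)‖ ≤ 2 * C * Real.exp (-s / 2) := by
    refine (norm_sub_le _ _).trans ?_
    rw [Complex.norm_real, Complex.norm_real, Real.norm_eq_abs, Real.norm_eq_abs]
    linarith
  refine (norm_add_le _ _).trans ?_
  rw [norm_mul]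
  calc _ ≤ _ := add_le_add e4 (mul_le_mul_of_nonneg_left e3 (norm_nonneg _))
    _ = _ := by ring

lemma tendsto_rem {A A' : ℝ → ℝ} (hA : IsAiry A A') (hγ : Adm γ)
    (hp : ∀ n, 0 < n → IsOrth γ n (xs n t) (p n)) {s : ℝ} (hs : t ≤ s) :
    Tendsto (fun x => rem γ t (fun n => Ff n (p n)) x s) (atTop ×ˢ atTop) (nhds 0) := by
  obtain ⟨K, hK, hKt⟩ := exists_abs_Kt_le t
  obtain ⟨M, hM, hF⟩ := exists_norm_Ff_le hγ t
  have hev : ∀ᶠ x : ℕ × ℕ in atTop ×ˢ atTop, 0 < x.1 ∧ 0 < x.2 :=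
    (eventually_gt_atTop 0).prod_mk (eventually_gt_atTop 0)
  have hI : Tendsto (fun x : ℕ × ℕ => ∫ y in Set.Ioi t,
      ((Kt x.1 s y - Kt x.2 s y : ℝ) : ℂ) * Ff x.2 (p x.2) y) (atTop ×ˢ atTop)
      (nhds (∫ y in Set.Ioi t, (0 : ℂ))) := by
    refine tendsto_integral_filter_of_dominated_convergence
      (fun y => 2 * K * M * Real.exp (-s / 2) * Real.exp (-y)) ?_ ?_
      (integrable_exp_neg_Ioi _ _) ?_
    · refine Eventually.of_forall fun x => Continuous.aestronglyMeasurable ?_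
      have c1 := continuous_Kt x.1 s
      have c2 := continuous_Kt x.2 s
      have c3 := continuous_Ff x.2 (p x.2)
      fun_prop
    · filter_upwards [hev] with x hx
      filter_upwards [ae_restrict_mem measurableSet_Ioi] with y hy
      have hy' : t ≤ y := le_of_lt hy
      rw [norm_mul, Complex.norm_real, Real.norm_eq_abs]
      have a1 := hKt x.1 hx.1 s y hs hy'
      have a2 := hKt x.2 hx.2 s y hs hy'
      have a3 := hF x.2 hx.2 t le_rfl _ (hp _ hx.2) y hy'
      have a4 : |Kt x.1 s y - Kt x.2 s y| ≤
          2 * K * (Real.exp (-s / 2) * Real.exp (-y / 2)) := by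
        refine (abs_sub _ _).trans ?_
        linarith
      have a5 : Real.exp (-y) = Real.exp (-y / 2) * Real.exp (-y / 2) := by
        rw [← Real.exp_add]; congr 1; ring
      calc _ ≤ _ := mul_le_mul a4 a3 (norm_nonneg _) (by positivity)
        _ = _ := by rw [a5]; ring
    · filter_upwards [ae_restrict_mem measurableSet_Ioi] with y hy
      have hy' : t ≤ y := le_of_lt hy
      have l1 := ((tendsto_Kt hA s y).comp tendsto_fst).sub
        ((tendsto_Kt hA s y).comp (tendsto_snd (f := (atTop : Filter ℕ))))
      have l2 := (l1.norm).mul_const (M * Real.exp (-y / 2))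
      rw [sub_self, norm_zero, zero_mul] at l2
      refine squeeze_zero_norm' ?_ l2
      filter_upwards [hev] with x hx
      rw [norm_mul, Complex.norm_real]
      exact mul_le_mul_of_nonneg_left (hF x.2 hx.2 t le_rfl _ (hp _ hx.2) y hy') (norm_nonneg _)
  rw [integral_zero] at hI
  have l1 := ((tendsto_Wn_airy hA 0 s).comp tendsto_fst).sub
    ((tendsto_Wn_airy hA 0 s).comp (tendsto_snd (f := (atTop : Filter ℕ))))
  have l2 := ((Complex.continuous_ofReal.tendsto _).comp l1).add (hI.const_mul γ)
  rw [sub_self, Complex.ofReal_zero, mul_zero, add_zero] at l2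
  refine l2.congr' ?_
  filter_upwards [hev] with x hx
  rw [rem_eq hx.1 hx.2 hp]
  simp

lemma exists_tendsto_Ff {A A' : ℝ → ℝ} (hA : IsAiry A A') (hγ : Adm γ)
    (hp : ∀ n, 0 < n → IsOrth γ n (xs n t) (p n)) :
    ∃ q, Tendsto (fun n => Ff n (p n) t) atTop (nhds q) := by
  obtain ⟨K, hK, hKt⟩ := exists_abs_Kt_le t
  obtain ⟨B, hB, hr⟩ := exists_norm_rem_le hγ hp
  obtain ⟨c0, hc0, hc⟩ := hγ.exists_coercive
  have hev : ∀ᶠ x : ℕ × ℕ in atTop ×ˢ atTop, 0 < x.1 ∧ 0 < x.2 :=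
    (eventually_gt_atTop 0).prod_mk (eventually_gt_atTop 0)
  refine cauchySeq_tendsto_of_complete ?_
  rw [cauchySeq_iff_tendsto_dist_atTop_0, ← prod_atTop_atTop_eq]
  have hR : Tendsto (fun x : ℕ × ℕ => ∫ s in Set.Ioi t, ‖rem γ t (fun n => Ff n (p n)) x s‖ ^ 2)
      (atTop ×ˢ atTop) (nhds (∫ s in Set.Ioi t, (0 : ℝ))) := by
    refine tendsto_integral_filter_of_dominated_convergence
      (fun y => B ^ 2 * Real.exp (-y)) ?_ ?_ (integrable_exp_neg_Ioi _ _) ?_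
    · refine Eventually.of_forall fun x => Continuous.aestronglyMeasurable ?_
      have c1 := continuous_Ff x.1 (p x.1)
      have c2 := continuous_Ff x.2 (p x.2)
      have c3 := continuous_ek x.1
      unfold rem
      fun_prop
    · filter_upwards [hev] with x hx
      filter_upwards [ae_restrict_mem measurableSet_Ioi] with y hy
      have := hr x hx.1 hx.2 y (le_of_lt hy)
      rw [norm_pow, norm_norm]
      calc _ ≤ (B * Real.exp (-y / 2)) ^ 2 := by gcongr
        _ = _ := by rw [mul_pow, ← Real.exp_nat_mul]; congr 2; push_cast; ring
    · filter_upwards [ae_restrict_mem measurableSet_Ioi] with y hy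
      have := ((tendsto_rem hA hγ hp (le_of_lt hy)).norm).pow 2
      simpa using this
  rw [integral_zero] at hR
  have h1 : Tendsto (fun x : ℕ × ℕ => ‖rem γ t (fun n => Ff n (p n)) x t‖ +
      ‖γ‖ * (K * Real.exp (-t / 2) * Real.sqrt (Real.exp (-t) *
        ((∫ s in Set.Ioi t, ‖rem γ t (fun n => Ff n (p n)) x s‖ ^ 2) / c0 ^ 2))))
      (atTop ×ˢ atTop) (nhds 0) := by
    have := (tendsto_rem hA hγ hp le_rfl).norm.add (((((hR.div_const (c0 ^ 2)).const_mul
      (Real.exp (-t))).sqrt).const_mul (K * Real.exp (-t / 2))).const_mul ‖γ‖)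
    simpa using this
  refine squeeze_zero' (Eventually.of_forall fun _ => dist_nonneg) ?_ h1
  filter_upwards [hev] with x hx
  have m1 := (memLp_Ff hx.1 (hp _ hx.1)).restrict (Set.Ioi t)
  have m2 := (memLp_Ff hx.2 (hp _ hx.2)).restrict (Set.Ioi t)
  have m : MemLp (fun y => Ff x.1 (p x.1) y - Ff x.2 (p x.2) y) 2 (volume.restrict (Set.Ioi t)) :=
    m1.sub m2
  have mr : MemLp (rem γ t (fun n => Ff n (p n)) x) 2 (volume.restrict (Set.Ioi t)) := by
    obtain ⟨C, hC⟩ : ∃ C : ℕ → ℂ, ∀ k, C k = ∫ y in Set.Ioi t,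
        (ek x.1 k y : ℂ) * (Ff x.1 (p x.1) y - Ff x.2 (p x.2) y) := ⟨_, fun _ => rfl⟩
    have h4 : MemLp (fun s => ∑ k ∈ Finset.range x.1, (ek x.1 k s : ℂ) * C k) 2
        (volume.restrict (Set.Ioi t)) := by
      refine memLp_finsetSum _ fun k _ => ?_
      have h3 : MemLp (fun s => (ek x.1 k s : ℂ)) 2 (volume.restrict (Set.Ioi t)) :=
        ((memLp_ek hx.1 k).restrict _).ofReal
      exact h3.mul_const _
    have h6 : MemLp (fun s => γ * ∑ k ∈ Finset.range x.1, (ek x.1 k s : ℂ) * C k) 2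
        (volume.restrict (Set.Ioi t)) := h4.const_mul γ
    have h7 : rem γ t (fun n => Ff n (p n)) x = fun s => (Ff x.1 (p x.1) s - Ff x.2 (p x.2) s) -
        γ * ∑ k ∈ Finset.range x.1, (ek x.1 k s : ℂ) * C k := by
      funext s; simp only [rem, hC]
    rw [h7]
    exact m.sub h6
  have h2 := coercive_Ioi hc0 hc (fun k _ => memLp_ek hx.1 k)
    (fun j _ k _ => ek_orthonormal hx.1 j k) m mr (fun s _ => by rw [rem]; ring)
  have h3 := norm_integral_kernel_le (k := Kt x.1 t) (B := K * Real.exp (-t / 2)) m fun y hy => by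
    rw [mul_assoc]
    exact hKt x.1 hx.1 t y le_rfl hy.le
  have h4 := sq_integral_exp_half_le m
  have h5 : Ff x.1 (p x.1) t - Ff x.2 (p x.2) t = rem γ t (fun n => Ff n (p n)) x t +
      γ * ∫ y in Set.Ioi t, (Kt x.1 t y : ℂ) * (Ff x.1 (p x.1) y - Ff x.2 (p x.2) y) := by
    rw [← sum_ek_eq_integral hx.1 m, rem]; ring
  rw [dist_eq_norm, h5]
  refine (norm_add_le _ _).trans ?_
  rw [norm_mul]
  gcongr
  refine h3.trans ?_
  gcongr
  refine Real.le_sqrt_of_sq_le (h4.trans ?_)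
  gcongr
  rw [le_div_iff₀ (by positivity)]
  linarith

end

section

variable {γ : ℂ}

lemma integral_exp_neg_half_Ioi (c : ℝ) :
    ∫ z in Set.Ioi c, Real.exp (-z / 2) = 2 * Real.exp (-c / 2) := by
  have e : (fun z : ℝ => Real.exp (-z / 2)) = fun z => Real.exp ((-1 / 2) * z) := by
    funext z; congr 1; ring
  rw [e]
  rw [integral_exp_mul_Ioi (by norm_num)]
  ring_nf

lemma integrableOn_exp_neg_half_Ioi (c : ℝ) :
    IntegrableOn (fun z => Real.exp (-z / 2)) (Set.Ioi c) := by
  have e : (fun z : ℝ => Real.exp (-z / 2)) = fun z => Real.exp ((-1 / 2) * z) := by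
    funext z; congr 1; ring
  rw [e]
  exact integrableOn_exp_mul_Ioi (by norm_num) c

lemma exists_abs_airyK_le {A A' : ℝ → ℝ} (hA : IsAiry A A') :
    ∃ C > 0, ∀ t y, 0 ≤ t → 0 ≤ y → |airyK A t y| ≤ C * |A t| * Real.exp (-y / 2) := by
  obtain ⟨C, hC, h⟩ := exists_abs_airy_le hA 0
  refine ⟨C * 2, by positivity, fun t y ht hy => ?_⟩
  have h1 : ‖airyK A t y‖ ≤ ∫ z in Set.Ioi (0 : ℝ),
      |A t| * (C * Real.exp (-y / 2)) * Real.exp (-z / 2) := by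
    refine norm_integral_le_of_norm_le ((integrableOn_exp_neg_half_Ioi 0).const_mul _) ?_
    filter_upwards [ae_restrict_mem measurableSet_Ioi] with z hz
    have hz' : 0 < z := hz
    rw [norm_mul, Real.norm_eq_abs, Real.norm_eq_abs, mul_assoc]
    refine mul_le_mul (abs_airy_le_of_le hA ht (by linarith)) ((h _ (by linarith)).trans
      (le_of_eq ?_)) (abs_nonneg _) (abs_nonneg _)
    rw [mul_assoc, ← Real.exp_add]
    congr 2; ring
  rw [integral_const_mul, integral_exp_neg_half_Ioi] at h1
  rw [← Real.norm_eq_abs]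
  refine h1.trans (le_of_eq ?_)
  simp; ring

lemma exists_norm_limit_sub_airy_le {A A' : ℝ → ℝ} (hA : IsAiry A A') (hγ : Adm γ) :
    ∃ D > 0, ∀ t, 0 ≤ t → ∀ p : ℕ → ℂ[X], (∀ n, 0 < n → IsOrth γ n (xs n t) (p n)) →
      ∀ q, Tendsto (fun n => Ff n (p n) t) atTop (nhds q) →
        ‖q - A t‖ ≤ D * |A t| * Real.exp (-t) := by
  obtain ⟨M, hM, hF⟩ := exists_norm_Ff_le hγ 0
  obtain ⟨K, hK, hKt⟩ := exists_abs_Kt_le 0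
  obtain ⟨C, hC, hC'⟩ := exists_abs_airyK_le hA
  refine ⟨(‖γ‖ + 1) * (C * M), by positivity, fun t ht p hp q hq => ?_⟩
  have hI : Tendsto (fun n => ∫ y in Set.Ioi t, |Kt n t y| * (M * Real.exp (-y / 2))) atTop
      (nhds (∫ y in Set.Ioi t, |airyK A t y| * (M * Real.exp (-y / 2)))) := by
    refine tendsto_integral_filter_of_dominated_convergence
      (fun y => K * M * Real.exp (-t / 2) * Real.exp (-y)) ?_ ?_ (integrable_exp_neg_Ioi _ _) ?_
    · refine Eventually.of_forall fun n => Continuous.aestronglyMeasurable ?_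
      have c1 := continuous_Kt n t
      fun_prop
    · filter_upwards [eventually_gt_atTop 0] with n hn
      filter_upwards [ae_restrict_mem measurableSet_Ioi] with y hy
      have hy' : t < y := hy
      have a1 := hKt n hn t y ht (by linarith)
      have a5 : Real.exp (-y) = Real.exp (-y / 2) * Real.exp (-y / 2) := by
        rw [← Real.exp_add]; congr 1; ring
      rw [Real.norm_eq_abs, abs_of_nonneg (by positivity)]
      calc _ ≤ _ := mul_le_mul_of_nonneg_right a1 (by positivity)
        _ = _ := by rw [a5]; ring
    · exact Eventually.of_forall fun y => ((tendsto_Kt hA t y).abs).mul_const _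
  have hI' : ∫ y in Set.Ioi t, |airyK A t y| * (M * Real.exp (-y / 2)) ≤
      C * M * |A t| * Real.exp (-t) := by
    rw [← integral_exp_neg_Ioi t, ← integral_const_mul]
    refine (le_abs_self _).trans ?_
    rw [← Real.norm_eq_abs]
    refine norm_integral_le_of_norm_le (integrable_exp_neg_Ioi _ _) ?_
    filter_upwards [ae_restrict_mem measurableSet_Ioi] with y hy
    have hy' : t < y := hy
    have a5 : Real.exp (-y) = Real.exp (-y / 2) * Real.exp (-y / 2) := by
      rw [← Real.exp_add]; congr 1; ring
    rw [Real.norm_eq_abs, abs_of_nonneg (by positivity)]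
    calc _ ≤ _ := mul_le_mul_of_nonneg_right (hC' t y ht (by linarith)) (by positivity)
      _ = _ := by rw [a5]; ring
  have hW := (Complex.continuous_ofReal.tendsto _).comp (tendsto_Wn_airy hA 0 t)
  have hl : Tendsto (fun n => ‖Ff n (p n) t - (Wn n (n - 0) t : ℂ)‖) atTop (nhds ‖q - A t‖) :=
    (hq.sub hW).norm
  have hb : ‖q - A t‖ ≤ ‖γ‖ * ∫ y in Set.Ioi t, |airyK A t y| * (M * Real.exp (-y / 2)) := by
    refine le_of_tendsto_of_tendsto hl (hI.const_mul ‖γ‖) ?_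
    filter_upwards [eventually_gt_atTop 0] with n hn
    rw [Ff_eq_integral hn (hp n hn), Nat.sub_zero, add_sub_cancel_left, norm_mul]
    gcongr
    refine norm_integral_le_of_norm_le ?_ ?_
    · refine Integrable.mono' (integrable_exp_neg_Ioi (K * M * Real.exp (-t / 2)) t) ?_ ?_
      · have c1 := continuous_Kt n t
        exact Continuous.aestronglyMeasurable (by fun_prop)
      filter_upwards [ae_restrict_mem measurableSet_Ioi] with y hy
      have hy' : t < y := hy
      have a1 := hKt n hn t y ht (by linarith)
      have a5 : Real.exp (-y) = Real.exp (-y / 2) * Real.exp (-y / 2) := by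
        rw [← Real.exp_add]; congr 1; ring
      rw [Real.norm_eq_abs, abs_of_nonneg (by positivity)]
      calc _ ≤ _ := mul_le_mul_of_nonneg_right a1 (by positivity)
        _ = _ := by rw [a5]; ring
    · filter_upwards [ae_restrict_mem measurableSet_Ioi] with y hy
      rw [norm_mul, Complex.norm_real, Real.norm_eq_abs]
      exact mul_le_mul_of_nonneg_left (hF n hn t ht _ (hp n hn) y (le_of_lt hy)) (abs_nonneg _)
  refine hb.trans ((mul_le_mul_of_nonneg_left hI' (norm_nonneg γ)).trans ?_)
  have : 0 ≤ C * M * |A t| * Real.exp (-t) := by positivity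
  nlinarith [norm_nonneg γ]

end

section

lemma norm_deriv_le_of_norm_second_deriv_le {α β B C η : ℝ} (hαβ : α < β) {Y Y' Y'' : ℝ → ℂ}
    (hY : ∀ s, HasDerivAt Y (Y' s) s) (hY' : ∀ s, HasDerivAt Y' (Y'' s) s)
    (hB : ∀ s ∈ Set.Icc α β, ‖Y s‖ ≤ B)
    (hC : ∀ s ∈ Set.Icc α β, ‖Y'' s‖ ≤ C + η * ‖Y' s‖) (hη : 0 ≤ η) (hη' : (β - α) * η ≤ 1 / 2) :
    ∀ s ∈ Set.Icc α β, ‖Y' s‖ ≤ 2 * (2 * B / (β - α) + (β - α) * C) := by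
  have hne : (Set.Icc α β).Nonempty := Set.nonempty_Icc.2 hαβ.le
  have hα : α ∈ Set.Icc α β := Set.left_mem_Icc.2 hαβ.le
  have hβ : β ∈ Set.Icc α β := Set.right_mem_Icc.2 hαβ.le
  have hl : 0 < β - α := sub_pos.2 hαβ
  have hcont : Continuous Y' := continuous_iff_continuousAt.2 fun s => (hY' s).continuousAt
  obtain ⟨s1, hs1, hmax⟩ := isCompact_Icc.exists_isMaxOn hne hcont.norm.continuousOn
  have hmax' : ∀ s ∈ Set.Icc α β, ‖Y' s‖ ≤ ‖Y' s1‖ := fun s hs => hmax hs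
  set M := ‖Y' s1‖ with hM
  have hC' : ∀ s ∈ Set.Icc α β, ‖Y'' s‖ ≤ C + η * M := fun s hs => (hC s hs).trans (by
    gcongr; exact hmax' s hs)
  have hCM : 0 ≤ C + η * M := (norm_nonneg _).trans (hC' α hα)
  have h1 : ∀ s ∈ Set.Icc α β, ‖Y' s - Y' s1‖ ≤ (C + η * M) * (β - α) := fun s hs => by
    refine ((convex_Icc α β).norm_image_sub_le_of_norm_hasDerivWithin_le
      (fun x hx => (hY' x).hasDerivWithinAt) hC' hs1 hs).trans ?_
    gcongr
    rw [Real.norm_eq_abs, abs_le]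
    constructor <;> linarith [hs.1, hs.2, hs1.1, hs1.2]
  have h2 : ‖(Y β - (β : ℂ) * Y' s1) - (Y α - (α : ℂ) * Y' s1)‖ ≤
      (C + η * M) * (β - α) * ‖β - α‖ := by
    refine (convex_Icc α β).norm_image_sub_le_of_norm_hasDerivWithin_le
      (f := fun s : ℝ => Y s - (s : ℂ) * Y' s1) (f' := fun s => Y' s - Y' s1)
      (fun x _ => ?_) h1 hα hβ
    have := (hY x).sub ((Complex.ofRealCLM.hasDerivAt (x := x)).mul_const (Y' s1))
    exact (this.congr_deriv (by simp)).hasDerivWithinAt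
  rw [Real.norm_eq_abs, abs_of_pos hl] at h2
  have h3 : (β - α) * M ≤ 2 * B + (C + η * M) * (β - α) * (β - α) := by
    have e : (((β - α : ℝ) : ℂ)) * Y' s1 = (Y β - Y α) -
        ((Y β - (β : ℂ) * Y' s1) - (Y α - (α : ℂ) * Y' s1)) := by push_cast; ring
    have := norm_sub_le (Y β - Y α) ((Y β - (β : ℂ) * Y' s1) - (Y α - (α : ℂ) * Y' s1))
    rw [← e, norm_mul, Complex.norm_real, Real.norm_eq_abs, abs_of_pos hl] at this
    have h4 := norm_sub_le (Y β) (Y α)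
    linarith [hB α hα, hB β hβ]
  have hM0 : 0 ≤ M := norm_nonneg _
  have h5 : M ≤ 2 * B / (β - α) + (C + η * M) * (β - α) := by
    rw [← sub_le_iff_le_add, le_div_iff₀ hl]
    linarith
  intro s hs
  refine (hmax' s hs).trans ?_
  nlinarith

/-- Limits of solutions of second order equations are solutions of the limit equation. -/
lemma exists_hasDerivAt_of_tendsto {Y Y' Y'' : ℕ → ℝ → ℂ} {q : ℝ → ℂ} {Φ : ℝ → ℂ → ℂ}
    (hΦ : Continuous fun x : ℝ × ℂ => Φ x.1 x.2)
    (hY : ∀ n s, HasDerivAt (Y n) (Y' n s) s) (hY' : ∀ n s, HasDerivAt (Y' n) (Y'' n s) s)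
    (hc : ∀ n, Continuous (Y'' n))
    (hb : ∀ a b, ∃ M, ∀ᶠ n in atTop, ∀ s ∈ Set.uIcc a b, ‖Y' n s‖ ≤ M ∧ ‖Y'' n s‖ ≤ M)
    (hq : ∀ s, Tendsto (fun n => Y n s) atTop (nhds (q s)))
    (hq'' : ∀ s, Tendsto (fun n => Y'' n s) atTop (nhds (Φ s (q s)))) :
    ∃ v : ℝ → ℂ, ∀ s, HasDerivAt q (v s) s ∧ HasDerivAt v (Φ s (q s)) s := by
  have hc' : ∀ n, Continuous (Y' n) := fun n =>
    continuous_iff_continuousAt.2 fun s => (hY' n s).continuousAt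
  have h1 : ∀ s, ∃ v, Tendsto (fun n => Y' n s) atTop (nhds v) := fun s => by
    obtain ⟨M, hM⟩ := hb s (s + 1)
    have hI : Tendsto (fun n => ∫ x in s..(s + 1), ((s + 1 - x : ℝ) : ℂ) * Y'' n x) atTop
        (nhds (∫ x in s..(s + 1), ((s + 1 - x : ℝ) : ℂ) * Φ x (q x))) := by
      refine intervalIntegral.tendsto_integral_filter_of_dominated_convergence (fun _ => 1 * M)
        ?_ ?_ (by simp) ?_
      · refine Eventually.of_forall fun n => Continuous.aestronglyMeasurable ?_
        have := hc n
        fun_prop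
      · filter_upwards [hM] with n hn
        refine Eventually.of_forall fun x hx => ?_
        have hx' := Set.uIoc_subset_uIcc hx
        have h3 := (hn x hx').2
        rw [Set.uIcc_of_le (by linarith)] at hx'
        rw [norm_mul, Complex.norm_real, Real.norm_eq_abs, abs_of_nonneg (by linarith [hx'.2])]
        exact mul_le_mul (by linarith [hx'.1]) h3 (norm_nonneg _) zero_le_one
      · exact Eventually.of_forall fun x _ => (hq'' x).const_mul _
    refine ⟨_, Tendsto.congr (fun n => ?_) (((hq (s + 1)).sub (hq s)).sub hI)⟩
    have h4 : ∀ x, HasDerivAt (fun x : ℝ => ((s + 1 - x : ℝ) : ℂ) * Y' n x + Y n x)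
        (((s + 1 - x : ℝ) : ℂ) * Y'' n x) x := fun x => by
      have h5 : HasDerivAt (fun x : ℝ => ((s + 1 - x : ℝ) : ℂ)) ((-1 : ℝ) : ℂ) x :=
        ((hasDerivAt_id x).const_sub (s + 1)).ofReal_comp
      exact ((h5.mul (hY' n x)).add (hY n x)).congr_deriv (by push_cast; ring)
    rw [intervalIntegral.integral_eq_sub_of_hasDerivAt (fun x _ => h4 x)
      (Continuous.intervalIntegrable (by have := hc n; fun_prop) _ _)]
    push_cast; ring
  choose v hv using h1
  have hvint : ∀ a b, v b - v a = ∫ x in a..b, Φ x (q x) := fun a b => by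
    obtain ⟨M, hM⟩ := hb a b
    have hI : Tendsto (fun n => ∫ x in a..b, Y'' n x) atTop (nhds (∫ x in a..b, Φ x (q x))) := by
      refine intervalIntegral.tendsto_integral_filter_of_dominated_convergence (fun _ => M)
        (Eventually.of_forall fun n => (hc n).aestronglyMeasurable) ?_ (by simp)
        (Eventually.of_forall fun x _ => hq'' x)
      filter_upwards [hM] with n hn
      exact Eventually.of_forall fun x hx => (hn x (Set.uIoc_subset_uIcc hx)).2
    refine tendsto_nhds_unique ((hv b).sub (hv a)) (hI.congr fun n => ?_)
    exact intervalIntegral.integral_eq_sub_of_hasDerivAt (fun x _ => hY' n x)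
      ((hc n).intervalIntegrable _ _)
  have hqint : ∀ a b, q b - q a = ∫ x in a..b, v x := fun a b => by
    obtain ⟨M, hM⟩ := hb a b
    have hI : Tendsto (fun n => ∫ x in a..b, Y' n x) atTop (nhds (∫ x in a..b, v x)) := by
      refine intervalIntegral.tendsto_integral_filter_of_dominated_convergence (fun _ => M)
        (Eventually.of_forall fun n => (hc' n).aestronglyMeasurable) ?_ (by simp)
        (Eventually.of_forall fun x _ => hv x)
      filter_upwards [hM] with n hn
      exact Eventually.of_forall fun x hx => (hn x (Set.uIoc_subset_uIcc hx)).1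
    refine tendsto_nhds_unique ((hq b).sub (hq a)) (hI.congr fun n => ?_)
    exact intervalIntegral.integral_eq_sub_of_hasDerivAt (fun x _ => hY n x)
      ((hc' n).intervalIntegrable _ _)
  have hqc : Continuous q := continuous_iff_continuousAt.2 fun s => by
    obtain ⟨M, hM⟩ := hb (s - 1) (s + 1)
    rw [Set.uIcc_of_le (by linarith)] at hM
    have hlip : ∀ x ∈ Set.Icc (s - 1) (s + 1), ‖q x - q s‖ ≤ M * ‖x - s‖ := fun x hx => by
      refine le_of_tendsto ((hq x).sub (hq s)).norm ?_
      filter_upwards [hM] with n hn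
      exact (convex_Icc (s - 1) (s + 1)).norm_image_sub_le_of_norm_hasDerivWithin_le
        (fun y _ => (hY n y).hasDerivWithinAt) (fun y hy => (hn y hy).1)
        ⟨by linarith, by linarith⟩ hx
    rw [ContinuousAt, tendsto_iff_norm_sub_tendsto_zero]
    have hl : Tendsto (fun x => M * ‖x - s‖) (nhds s) (nhds 0) := by
      have : Continuous fun x => M * ‖x - s‖ := by fun_prop
      simpa using this.tendsto s
    refine squeeze_zero' (Eventually.of_forall fun _ => norm_nonneg _) ?_ hl
    filter_upwards [Icc_mem_nhds (show s - 1 < s by linarith) (show s < s + 1 by linarith)]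
      with x hx using hlip x hx
  have hvd : ∀ s, HasDerivAt v (Φ s (q s)) s := fun s => by
    have hR : Continuous fun x => Φ x (q x) := hΦ.comp (continuous_id.prodMk hqc)
    have e : v = fun x => v 0 + ∫ y in (0 : ℝ)..x, Φ y (q y) := by
      funext x; rw [← hvint]; ring
    rw [e]
    exact (hR.integral_hasStrictDerivAt 0 s).hasDerivAt.const_add _
  refine ⟨v, fun s => ⟨?_, hvd s⟩⟩
  have hR : Continuous v := continuous_iff_continuousAt.2 fun s => (hvd s).continuousAt
  have e : q = fun x => q 0 + ∫ y in (0 : ℝ)..x, v y := by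
    funext x; rw [← hqint]; ring
  rw [e]
  exact (hR.integral_hasStrictDerivAt 0 s).hasDerivAt.const_add _

end

section

variable {γ : ℂ} {n : ℕ} {a : ℕ → ℂ} {l : ℝ}

lemma gauss_eq_exp_mul (l y : ℝ) : gauss l y = Real.exp (l ^ 2) * gauss 0 (l + 1 * y) := by
  rw [gauss, gauss, ← Real.exp_add]; congr 1; ring

lemma L_eq_comp (γ : ℂ) (l : ℝ) (g : ℂ[X]) : L γ l g = Real.exp (l ^ 2) *
    (L 0 0 (g.comp (X - C (l : ℂ))) -
      γ * ∫ y in Set.Ioi l, (g.comp (X - C (l : ℂ))).eval (y : ℂ) * (gauss 0 y : ℂ)) := by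
  obtain ⟨f, hf⟩ : ∃ f : ℝ → ℂ, ∀ y, f y =
    (g.comp (X - C (l : ℂ))).eval (y : ℂ) * (gauss 0 y : ℂ) := ⟨_, fun _ => rfl⟩
  have e : ∀ y : ℝ, g.eval (y : ℂ) * (gauss l y : ℂ) = Real.exp (l ^ 2) * f (l + 1 * y) :=
    fun y => by
      rw [hf, gauss_eq_exp_mul]
      simp only [eval_comp, eval_sub, eval_X, eval_C]
      push_cast
      rw [show (l : ℂ) + 1 * y - l = y by ring]
      ring
  rw [L_apply, L_apply]
  simp only [← hf]
  rw [integral_congr_ae (Eventually.of_forall e),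
    setIntegral_congr_fun measurableSet_Ioi (fun y _ => e y), integral_const_mul,
    integral_const_mul, integral_comp_affine f l one_pos, integral_Ioi_comp_affine f l 0 one_pos]
  simp
  ring

lemma monic_ofCoeffs (ha : a n = 1) : (ofCoeffs n a).Monic :=
  monic_of_natDegree_le_of_coeff_eq_one n (natDegree_ofCoeffs_le n a) (by simp [coeff_ofCoeffs, ha])

lemma natDegree_ofCoeffs (ha : a n = 1) : (ofCoeffs n a).natDegree = n :=
  le_antisymm (natDegree_ofCoeffs_le n a) (le_natDegree_of_ne_zero (by simp [coeff_ofCoeffs, ha]))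

lemma L_mul_eq_zero_of_natDegree_lt {P : ℂ[X]} (h : ∀ j < n, L γ l (P * X ^ j) = 0) {g : ℂ[X]}
    (hg : g.natDegree < n) : L γ l (P * g) = 0 := by
  rw [g.as_sum_range_C_mul_X_pow, Finset.mul_sum, map_sum]
  refine Finset.sum_eq_zero fun k hk => ?_
  rw [mul_left_comm, L_C_mul, h k (by simp at hk; omega), mul_zero]

lemma L_mul_eq_of_coeff_eq_one {P : ℂ[X]} (h : ∀ j < n, L γ l (P * X ^ j) = 0) (hn : 0 < n)
    {g : ℂ[X]} (hg : g.natDegree ≤ n) (hg' : g.coeff n = 1) :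
    L γ l (P * g) = L γ l (P * X ^ n) := by
  rw [← sub_eq_zero, ← map_sub, ← mul_sub]
  refine L_mul_eq_zero_of_natDegree_lt h ?_
  have h1 : (g - X ^ n).degree < (n : WithBot ℕ) := by
    refine (degree_lt_iff_coeff_zero _ _).2 fun m hm => ?_
    rw [coeff_sub, coeff_X_pow]
    rcases hm.eq_or_lt with rfl | hm
    · simp [hg']
    · rw [if_neg hm.ne', coeff_eq_zero_of_natDegree_lt (by omega), sub_zero]
  by_cases h0 : g - X ^ n = 0
  · rw [h0]; simpa using hn
  · exact (natDegree_lt_iff_degree_lt h0).2 h1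

lemma comp_mul_eq (P f : ℂ[X]) (c : ℂ) :
    P.comp (X - C c) * f = (P * f.comp (X + C c)).comp (X - C c) := by
  rw [mul_comp, comp_assoc]; simp

lemma isOrth_comp (ha : a n = 1) (h : ∀ j < n, L γ l (ofCoeffs n a * X ^ j) = 0) :
    IsOrth γ n l ((ofCoeffs n a).comp (X - C (l : ℂ))) := by
  have hm := (monic_ofCoeffs ha).comp_X_sub_C (l : ℂ)
  have hd : ((ofCoeffs n a).comp (X - C (l : ℂ))).natDegree = n := by
    rw [natDegree_comp, natDegree_X_sub_C, mul_one, natDegree_ofCoeffs ha]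
  refine ⟨?_, hd.le, fun f hf => ?_⟩
  · rwa [Monic, leadingCoeff, hd] at hm
  have h1 : L γ l (ofCoeffs n a * f.comp (X + C (l : ℂ))) = 0 :=
    L_mul_eq_zero_of_natDegree_lt h (by rw [natDegree_comp, natDegree_X_add_C, mul_one]; exact hf)
  rw [L_eq_comp, ← comp_mul_eq, mul_eq_zero, sub_eq_zero] at h1
  exact h1.resolve_left (by simp [Complex.exp_ne_zero])

lemma norming_eq (hn : 0 < n) (ha : a n = 1) (h : ∀ j < n, L γ l (ofCoeffs n a * X ^ j) = 0) :
    L γ l (ofCoeffs n a * X ^ n) = Real.exp (l ^ 2) * (Nn n - γ * ∫ y in Set.Ioi l,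
      ((ofCoeffs n a).comp (X - C (l : ℂ)) * he n).eval (y : ℂ) * (gauss 0 y : ℂ)) := by
  have ho := isOrth_comp ha h
  have hm : (he n).Monic := monic_of_natDegree_le_of_coeff_eq_one n (he_monic n).2 (he_monic n).1
  have hd : (he n).natDegree = n := le_antisymm (he_monic n).2
    (le_natDegree_of_ne_zero (by rw [(he_monic n).1]; exact one_ne_zero))
  have hd' : ((he n).comp (X + C (l : ℂ))).natDegree = n := by
    rw [natDegree_comp, natDegree_X_add_C, mul_one, hd]
  have hc : ((he n).comp (X + C (l : ℂ))).coeff n = 1 := by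
    have := hm.comp_X_add_C (l : ℂ)
    rwa [Monic, leadingCoeff, hd'] at this
  rw [← L_mul_eq_of_coeff_eq_one h hn hd'.le hc, L_eq_comp, ← comp_mul_eq]
  congr 2
  rw [mul_comm, L_he_mul_of_natDegree_le ho.2.1, ho.1, one_mul]

lemma norming_eq_rescaled (hn : 0 < n) {s : ℝ} (ha : a n = 1)
    (h : ∀ j < n, L γ (xs n s) (ofCoeffs n a * X ^ j) = 0) :
    L γ (xs n s) (ofCoeffs n a * X ^ n) = Real.exp (xs n s ^ 2) * (Nn n * (1 - γ *
      ((dn n / (cn n ^ 2 * Nn n) : ℝ) * ∫ y in Set.Ioi s,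
        Ff n ((ofCoeffs n a).comp (X - C (xs n s : ℂ))) y * (Wn n n y : ℂ)))) := by
  have hc := cn_pos hn
  have hN := Nn_pos n
  have hd := dn_pos hn
  rw [norming_eq hn ha h]
  obtain ⟨f, hf⟩ : ∃ f : ℝ → ℂ, ∀ y, f y = ((ofCoeffs n a).comp (X - C (xs n s : ℂ)) * he n).eval
    (y : ℂ) * (gauss 0 y : ℂ) := ⟨_, fun _ => rfl⟩
  simp only [← hf]
  have e : ∀ y, Ff n ((ofCoeffs n a).comp (X - C (xs n s : ℂ))) y * (Wn n n y : ℂ) =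
      (cn n ^ 2 : ℝ) * f (2 * hh n + dn n * y) := fun y => by
    have e1 : gauss 0 (xs n y) = Real.exp (-xs n y ^ 2 / 2) * Real.exp (-xs n y ^ 2 / 2) := by
      rw [gauss, ← Real.exp_add]; congr 1; ring
    rw [← xs_affine, hf, Wn_self hn, Ff, phi, e1, eval_mul, eval_he]
    push_cast; ring
  rw [setIntegral_congr_fun measurableSet_Ioi (fun y _ => e y), integral_const_mul,
    integral_Ioi_comp_affine f _ s hd, ← xs_affine, Complex.real_smul]
  congr 1
  have hc' : (cn n : ℂ) ≠ 0 := by exact_mod_cast hc.ne'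
  have hN' : (Nn n : ℂ) ≠ 0 := by exact_mod_cast hN.ne'
  have hd' : (dn n : ℂ) ≠ 0 := by exact_mod_cast hd.ne'
  push_cast
  field_simp

/-- The coefficient `dn n / (cn n ^ 2 * Nn n)`. -/
def en (n : ℕ) : ℝ := dn n / (cn n ^ 2 * Nn n)

lemma en_eq (hn : 0 < n) : en n = Real.sqrt Real.pi * del n / Stirling.stirlingSeq n := by
  have hc := cn_pos hn
  have hN := Nn_pos n
  have hh0 := hh_pos hn
  have hd := del_pos hn
  have hpi := Real.sqrt_pos.2 Real.pi_pos
  rw [en, ← cn_sq_mul_Nn hn, dn, div_eq_div_iff (by positivity) (by positivity)]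
  have h1 := del_cube hn
  have h2 := hh_sq n
  have : (n : ℝ) = 2 * hh n ^ 2 := by rw [h2]; ring
  rw [this] at h1
  linear_combination Real.sqrt Real.pi * del n * (cn n ^ 2 * Nn n) * h1

lemma tendsto_en : Tendsto en atTop (nhds 0) := by
  have hsp := Real.sqrt_pos.2 Real.pi_pos
  have h := (tendsto_del.const_mul (Real.sqrt Real.pi)).div Stirling.tendsto_stirlingSeq_sqrt_pi
    hsp.ne'
  rw [mul_zero, zero_div] at h
  refine h.congr' ?_
  filter_upwards [eventually_gt_atTop 0] with n hn
  rw [en_eq hn]; rfl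

lemma en_mul_eq (hn : 0 < n) (s : ℝ) : en n * dn n * xs n s =
    Real.sqrt Real.pi * (2 + del n ^ 2 * s) / (2 * Stirling.stirlingSeq n) := by
  have h1 := del_cube hn
  have h2 := hh_sq n
  have : (n : ℝ) = 2 * hh n ^ 2 := by rw [h2]; ring
  rw [this] at h1
  rw [en_eq hn, dn, xs_eq, div_mul_eq_mul_div, div_mul_eq_mul_div, mul_comm (2 : ℝ), ← div_div]
  congr 1
  linear_combination Real.sqrt Real.pi * (1 + s / 2 * del n ^ 2) * h1

end

section

/-- Coefficients, as functions of the jump location `b`, of the monic orthogonal polynomials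
translated by `b`, together with their first two derivatives. -/
def OrthFamily (γ : ℂ) (n : ℕ) (a a' a'' : ℝ → ℕ → ℂ) : Prop :=
  (∀ b, a b n = 1 ∧ a' b n = 0) ∧ (∀ b k, HasDerivAt (fun b => a b k) (a' b k) b) ∧
    (∀ b k, HasDerivAt (fun b => a' b k) (a'' b k) b) ∧
    ∀ b, ∀ j < n, L γ b (ofCoeffs n (a b) * X ^ j) = 0

/-- The orthogonal polynomial with jump location `l`. -/
def orthPoly (n : ℕ) (a : ℝ → ℕ → ℂ) (l : ℝ) : ℂ[X] := (ofCoeffs n (a l)).comp (X - C (l : ℂ))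

/-- The rescaled value of the orthogonal polynomial at its jump location. -/
def Yn (n : ℕ) (a : ℝ → ℕ → ℂ) (s : ℝ) : ℂ :=
  cn n * (a (xs n s) 0 * (Real.exp (-xs n s ^ 2 / 2) : ℂ))

/-- The derivative of `Yn`. -/
def Yn' (n : ℕ) (a a' : ℝ → ℕ → ℂ) (s : ℝ) : ℂ :=
  cn n * dn n * ((a' (xs n s) 0 - xs n s * a (xs n s) 0) * (Real.exp (-xs n s ^ 2 / 2) : ℂ))

/-- The second derivative of `Yn`. -/
def Yn'' (n : ℕ) (a a' a'' : ℝ → ℕ → ℂ) (s : ℝ) : ℂ :=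
  cn n * dn n ^ 2 * ((a'' (xs n s) 0 - 2 * xs n s * a' (xs n s) 0 - a (xs n s) 0 +
    xs n s ^ 2 * a (xs n s) 0) * (Real.exp (-xs n s ^ 2 / 2) : ℂ))

/-- The ratio of the norming constant to the one of the Hermite polynomials. -/
def rho (γ : ℂ) (n : ℕ) (a : ℝ → ℕ → ℂ) (s : ℝ) : ℂ :=
  1 - γ * ((en n : ℝ) * ∫ y in Set.Ioi s, Ff n (orthPoly n a (xs n s)) y * (Wn n n y : ℂ))

variable {γ : ℂ} {n : ℕ} {a a' a'' : ℝ → ℕ → ℂ}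

lemma OrthFamily.isOrth (h : OrthFamily γ n a a' a'') (l : ℝ) : IsOrth γ n l (orthPoly n a l) :=
  isOrth_comp (h.1 l).1 (h.2.2.2 l)

lemma Ff_orthPoly (s : ℝ) : Ff n (orthPoly n a (xs n s)) s = Yn n a s := by
  have : (ofCoeffs n (a (xs n s))).eval 0 = a (xs n s) 0 := by
    rw [← coeff_zero_eq_eval_zero, coeff_ofCoeffs, if_pos (Nat.zero_le _)]
  rw [Ff, Yn, orthPoly, eval_comp]
  simp only [eval_sub, eval_X, eval_C, sub_self, this]

lemma hasDerivAt_xs (n : ℕ) (s : ℝ) : HasDerivAt (xs n) (dn n) s := by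
  have e : xs n = fun s => 2 * hh n + dn n * s := funext (xs_affine n)
  rw [e]
  exact (((hasDerivAt_id s).const_mul (dn n)).const_add _).congr_deriv (by simp)

lemma hasDerivAt_exp_xs (n : ℕ) (s : ℝ) : HasDerivAt
    (fun s => (Real.exp (-xs n s ^ 2 / 2) : ℂ))
    (-(dn n * xs n s) * (Real.exp (-xs n s ^ 2 / 2) : ℂ)) s := by
  have h := (((hasDerivAt_xs n s).fun_pow 2).fun_neg.div_const 2).exp.ofReal_comp
  exact h.congr_deriv (by push_cast; ring)

lemma OrthFamily.hasDerivAt_Yn (h : OrthFamily γ n a a' a'') (s : ℝ) :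
    HasDerivAt (Yn n a) (Yn' n a a' s) s := by
  have h1 : HasDerivAt (fun s => a (xs n s) 0) (dn n * a' (xs n s) 0) s :=
    ((h.2.1 (xs n s) 0).scomp s (hasDerivAt_xs n s)).congr_deriv (by simp)
  refine ((h1.mul (hasDerivAt_exp_xs n s)).const_mul (cn n : ℂ)).congr_deriv ?_
  rw [Yn']; ring

lemma OrthFamily.hasDerivAt_Yn' (h : OrthFamily γ n a a' a'') (s : ℝ) :
    HasDerivAt (Yn' n a a') (Yn'' n a a' a'' s) s := by
  have h1 : HasDerivAt (fun s => a (xs n s) 0) (dn n * a' (xs n s) 0) s :=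
    ((h.2.1 (xs n s) 0).scomp s (hasDerivAt_xs n s)).congr_deriv (by simp)
  have h2 : HasDerivAt (fun s => a' (xs n s) 0) (dn n * a'' (xs n s) 0) s :=
    ((h.2.2.1 (xs n s) 0).scomp s (hasDerivAt_xs n s)).congr_deriv (by simp)
  refine (((h2.sub ((hasDerivAt_xs n s).ofReal_comp.mul h1)).mul
    (hasDerivAt_exp_xs n s)).const_mul (cn n * dn n : ℂ)).congr_deriv ?_
  rw [Yn'']
  simp only [Pi.sub_apply, Pi.mul_apply]
  ring

lemma OrthFamily.norming_eq (h : OrthFamily γ n a a' a'') (hn : 0 < n) (s : ℝ) :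
    L γ (xs n s) (ofCoeffs n (a (xs n s)) * X ^ n) =
      Real.exp (xs n s ^ 2) * (Nn n * rho γ n a s) :=
  norming_eq_rescaled hn (h.1 _).1 (h.2.2.2 _)

lemma OrthFamily.rho_ne_zero (h : OrthFamily γ n a a' a'') (hγ : Adm γ) (hn : 0 < n) (s : ℝ) :
    rho γ n a s ≠ 0 := by
  have := norming_ne_zero hγ (h.1 (xs n s)).1 (h.2.2.2 (xs n s))
  rw [h.norming_eq hn] at this
  exact right_ne_zero_of_mul (right_ne_zero_of_mul this)

lemma OrthFamily.second_deriv_eq (h : OrthFamily γ n a a' a'') (hγ : Adm γ) (hn : 0 < n) (b : ℝ) :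
    a'' b 0 = 2 * b * a' b 0 - 2 * n * a b 0 +
      2 * γ * a b 0 ^ 2 * a' b 0 / L γ b (ofCoeffs n (a b) * X ^ n) :=
  orthogonal_ode hγ hn h.1 h.2.1 h.2.2.1 h.2.2.2 b

lemma OrthFamily.continuous_Yn'' (h : OrthFamily γ n a a' a'') (hγ : Adm γ) (hn : 0 < n) :
    Continuous (Yn'' n a a' a'') := by
  have c0 : Continuous fun b => a b 0 :=
    continuous_iff_continuousAt.2 fun b => (h.2.1 b 0).continuousAt
  have c1 : Continuous fun b => a' b 0 :=
    continuous_iff_continuousAt.2 fun b => (h.2.2.1 b 0).continuousAt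
  have cL : Continuous fun b => L γ b (ofCoeffs n (a b) * X ^ n) :=
    continuous_iff_continuousAt.2 fun b => (hasDerivAt_L_ofCoeffs h.2.1 b n).continuousAt
  have c2 : Continuous fun b => a'' b 0 := by
    have e : (fun b => a'' b 0) = fun b : ℝ => 2 * (b : ℂ) * a' b 0 - 2 * n * a b 0 +
        2 * γ * a b 0 ^ 2 * a' b 0 / L γ b (ofCoeffs n (a b) * X ^ n) :=
      funext (h.second_deriv_eq hγ hn)
    rw [e]
    refine Continuous.add (by fun_prop) (Continuous.div (by fun_prop) cL fun b => ?_)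
    exact norming_ne_zero hγ (h.1 b).1 (h.2.2.2 b)
  have cx := continuous_xs n
  have d0 := c0.comp cx
  have d1 := c1.comp cx
  have d2 := c2.comp cx
  simp only [Function.comp_def] at d0 d1 d2
  unfold Yn''
  fun_prop

lemma dn_sq_eq (hn : 0 < n) : dn n ^ 2 = del n / 2 := by
  rw [dn, mul_pow, hh_sq]
  linear_combination del n / 2 * del_cube hn

lemma dn_sq_mul_eq (hn : 0 < n) (s : ℝ) :
    dn n ^ 2 * (xs n s ^ 2 - 2 * n) = s + s ^ 2 * del n ^ 2 / 4 := by
  have h1 := del_cube hn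
  rw [dn_sq_eq hn, xs_eq, mul_pow, mul_pow, hh_sq]
  linear_combination (s + s ^ 2 * del n ^ 2 / 4) * h1

lemma OrthFamily.Yn''_eq (h : OrthFamily γ n a a' a'') (hγ : Adm γ) (hn : 0 < n) (s : ℝ) :
    Yn'' n a a' a'' s = ((s + s ^ 2 * del n ^ 2 / 4 - del n / 2 : ℝ) : ℂ) * Yn n a s +
      2 * γ * ((en n * dn n * xs n s : ℝ) / rho γ n a s) * Yn n a s ^ 3 +
      2 * γ * ((en n : ℝ) / rho γ n a s) * Yn n a s ^ 2 * Yn' n a a' s := by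
  have hρ := h.rho_ne_zero hγ hn s
  have hc : (cn n : ℂ) ≠ 0 := by exact_mod_cast (cn_pos hn).ne'
  have hN : (Nn n : ℂ) ≠ 0 := by exact_mod_cast (Nn_pos n).ne'
  have hd : (dn n : ℂ) ≠ 0 := by exact_mod_cast (dn_pos hn).ne'
  have hE : (Real.exp (-xs n s ^ 2 / 2) : ℂ) ≠ 0 := by exact_mod_cast (Real.exp_pos _).ne'
  have hE2 : (Real.exp (xs n s ^ 2) : ℂ) * (Real.exp (-xs n s ^ 2 / 2) : ℂ) ^ 2 = 1 := by
    norm_cast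
    rw [← Real.exp_nat_mul, ← Real.exp_add, ← Real.exp_zero]
    congr 1; push_cast; ring
  have hE3 : (Real.exp (xs n s ^ 2) : ℂ) ≠ 0 := by exact_mod_cast (Real.exp_pos _).ne'
  have hen : ((en n : ℝ) : ℂ) = dn n / (cn n ^ 2 * Nn n) := by rw [en]; push_cast; ring
  rw [← dn_sq_eq hn, ← dn_sq_mul_eq hn, Yn'', Yn', Yn, h.second_deriv_eq hγ hn, h.norming_eq hn]
  generalize (Real.exp (-xs n s ^ 2 / 2) : ℂ) = E at *
  generalize (Real.exp (xs n s ^ 2) : ℂ) = E' at *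
  push_cast
  rw [hen]
  have hE4 : E' = 1 / E ^ 2 := by field_simp; exact hE2
  subst hE4
  field_simp
  ring

end

section

variable {γ : ℂ} {a a' a'' : ℕ → ℝ → ℕ → ℂ}

lemma en_pos {n : ℕ} (hn : 0 < n) : 0 < en n := by
  have := dn_pos hn
  have := cn_pos hn
  have := Nn_pos n
  unfold en; positivity

lemma exists_norm_rho_sub_one_le (hγ : Adm γ) (h : ∀ n, OrthFamily γ n (a n) (a' n) (a'' n))
    (T : ℝ) : ∃ C > 0, ∀ n, 0 < n → ∀ s, T ≤ s → ‖rho γ n (a n) s - 1‖ ≤ C * en n := by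
  obtain ⟨M, hM, hF⟩ := exists_norm_Ff_le hγ T
  obtain ⟨C, hC, hW⟩ := exists_abs_Wn_le T
  refine ⟨(‖γ‖ + 1) * (M * C * Real.exp (-T)), by positivity, fun n hn s hs => ?_⟩
  have he := en_pos hn
  have h1 : ‖∫ y in Set.Ioi s, Ff n (orthPoly n (a n) (xs n s)) y * (Wn n n y : ℂ)‖ ≤
      M * C * Real.exp (-T) := by
    have h2 : ‖∫ y in Set.Ioi s, Ff n (orthPoly n (a n) (xs n s)) y * (Wn n n y : ℂ)‖ ≤
        ∫ y in Set.Ioi s, M * C * Real.exp (-y) := by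
      refine norm_integral_le_of_norm_le (integrable_exp_neg_Ioi _ _) ?_
      filter_upwards [ae_restrict_mem measurableSet_Ioi] with y hy
      have hy' : s < y := hy
      have a5 : Real.exp (-y) = Real.exp (-y / 2) * Real.exp (-y / 2) := by
        rw [← Real.exp_add]; congr 1; ring
      rw [norm_mul, Complex.norm_real, Real.norm_eq_abs]
      calc _ ≤ _ := mul_le_mul (hF n hn s hs _ ((h n).isOrth _) y hy'.le)
            (hW n n hn le_rfl y (by linarith)) (abs_nonneg _) (by positivity)
        _ = _ := by rw [a5]; ring
    rw [integral_const_mul, integral_exp_neg_Ioi] at h2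
    refine h2.trans ?_
    gcongr
  rw [rho, sub_sub_cancel_left, norm_neg, norm_mul, norm_mul, Complex.norm_real, Real.norm_eq_abs,
    abs_of_pos he]
  calc _ ≤ (‖γ‖ + 1) * (en n * (M * C * Real.exp (-T))) := by
        gcongr; linarith
    _ = _ := by ring

lemma eventually_half_le_norm_rho (hγ : Adm γ) (h : ∀ n, OrthFamily γ n (a n) (a' n) (a'' n))
    (T : ℝ) : ∀ᶠ n in atTop, ∀ s, T ≤ s → 1 / 2 ≤ ‖rho γ n (a n) s‖ := by
  obtain ⟨C, hC, hρ⟩ := exists_norm_rho_sub_one_le hγ h T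
  have h1 := tendsto_en.const_mul C
  rw [mul_zero] at h1
  filter_upwards [eventually_gt_atTop 0, h1.eventually_lt_const (show (0 : ℝ) < 1 / 2 by norm_num)]
    with n hn h2 s hs
  have h3 := norm_sub_norm_le (1 : ℂ) (rho γ n (a n) s)
  rw [norm_one, norm_sub_rev] at h3
  linarith [hρ n hn s hs]

lemma tendsto_rho (hγ : Adm γ) (h : ∀ n, OrthFamily γ n (a n) (a' n) (a'' n)) (s : ℝ) :
    Tendsto (fun n => rho γ n (a n) s) atTop (nhds 1) := by
  obtain ⟨C, hC, hρ⟩ := exists_norm_rho_sub_one_le hγ h s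
  rw [tendsto_iff_norm_sub_tendsto_zero]
  have h1 := tendsto_en.const_mul C
  rw [mul_zero] at h1
  refine squeeze_zero' (Eventually.of_forall fun _ => norm_nonneg _) ?_ h1
  filter_upwards [eventually_gt_atTop 0] with n hn using hρ n hn s le_rfl

lemma tendsto_en_mul (s : ℝ) : Tendsto (fun n => en n * dn n * xs n s) atTop (nhds 1) := by
  have hsp := Real.sqrt_pos.2 Real.pi_pos
  have h := (((tendsto_del.pow 2).mul_const s).const_add 2 |>.const_mul (Real.sqrt Real.pi)).div
    (Stirling.tendsto_stirlingSeq_sqrt_pi.const_mul 2) (by positivity)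
  have e : Real.sqrt Real.pi * (2 + 0 ^ 2 * s) / (2 * Real.sqrt Real.pi) = 1 := by
    field_simp; ring
  rw [e] at h
  refine h.congr' ?_
  filter_upwards [eventually_gt_atTop 0] with n hn
  rw [en_mul_eq hn]; rfl

lemma eventually_abs_en_mul_le :
    ∀ᶠ n in atTop, ∀ s, |en n * dn n * xs n s| ≤ 2 + |s| := by
  have hsp := Real.sqrt_pos.2 Real.pi_pos
  filter_upwards [eventually_gt_atTop 0, Stirling.tendsto_stirlingSeq_sqrt_pi.eventually_const_lt
    (show Real.sqrt Real.pi / 2 < Real.sqrt Real.pi by linarith)] with n hn h s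
  have hd := del_pos hn
  have hd1 := del_le_one hn
  have h1 : |2 + del n ^ 2 * s| ≤ 2 + |s| := by
    refine (abs_add_le _ _).trans ?_
    rw [abs_mul, abs_of_pos (show (0 : ℝ) < 2 by norm_num), abs_of_pos (by positivity : 0 < del n ^ 2)]
    have : del n ^ 2 ≤ 1 := pow_le_one₀ hd.le hd1
    nlinarith [abs_nonneg s]
  have hS : 0 < Stirling.stirlingSeq n := by linarith
  rw [en_mul_eq hn, abs_div, abs_mul, abs_of_pos hsp, abs_of_pos (by positivity :
    0 < 2 * Stirling.stirlingSeq n), div_le_iff₀ (by positivity)]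
  have : 0 ≤ 2 + |s| := by positivity
  nlinarith

lemma exists_norm_Yn_le (hγ : Adm γ) (h : ∀ n, OrthFamily γ n (a n) (a' n) (a'' n)) (T : ℝ) :
    ∃ B > 0, ∀ n, 0 < n → ∀ s, T ≤ s → ‖Yn n (a n) s‖ ≤ B := by
  obtain ⟨M, hM, hF⟩ := exists_norm_Ff_le hγ T
  refine ⟨M * Real.exp (-T / 2), by positivity, fun n hn s hs => ?_⟩
  rw [← Ff_orthPoly]
  refine (hF n hn s hs _ ((h n).isOrth _) s le_rfl).trans ?_
  gcongr

lemma exists_norm_Yn''_le (hγ : Adm γ) (h : ∀ n, OrthFamily γ n (a n) (a' n) (a'' n))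
    (S : ℝ) (hS : 0 ≤ S) : ∃ C > 0, ∃ D > 0, ∀ᶠ n in atTop, ∀ s, |s| ≤ S →
      ‖Yn n (a n) s‖ ≤ C ∧
      ‖Yn'' n (a n) (a' n) (a'' n) s‖ ≤ C + D * en n * ‖Yn' n (a n) (a' n) s‖ := by
  obtain ⟨B, hB, hY⟩ := exists_norm_Yn_le hγ h (-S)
  refine ⟨B + (S + S ^ 2 + 1) * B + 2 * ‖γ‖ * (2 * (2 + S)) * B ^ 3, by positivity,
    2 * (‖γ‖ + 1) * 2 * B ^ 2, by positivity, ?_⟩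
  filter_upwards [eventually_gt_atTop 0, eventually_half_le_norm_rho hγ h (-S),
    eventually_abs_en_mul_le] with n hn hρ hen s hs
  have hs' := abs_le.1 hs
  have hd := del_pos hn
  have hd1 := del_le_one hn
  have he := en_pos hn
  have y1 := hY n hn s hs'.1
  have r1 := hρ s hs'.1
  have r0 : 0 < ‖rho γ n (a n) s‖ := by linarith
  have e1 := hen s
  have h0 : 0 ≤ (S + S ^ 2 + 1) * B + 2 * ‖γ‖ * (2 * (2 + S)) * B ^ 3 := by positivity
  refine ⟨by linarith, ?_⟩
  rw [(h n).Yn''_eq hγ hn]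
  have b1 : ‖((s + s ^ 2 * del n ^ 2 / 4 - del n / 2 : ℝ) : ℂ) * Yn n (a n) s‖ ≤
      (S + S ^ 2 + 1) * B := by
    rw [norm_mul, Complex.norm_real, Real.norm_eq_abs]
    have k1 : |s + s ^ 2 * del n ^ 2 / 4 - del n / 2| ≤ S + S ^ 2 + 1 := by
      have k2 : s ^ 2 ≤ S ^ 2 := by rw [← sq_abs s]; gcongr
      have k3 : del n ^ 2 ≤ 1 := pow_le_one₀ hd.le hd1
      have k4 : s ^ 2 * del n ^ 2 ≤ S ^ 2 * 1 := by gcongr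
      have k5 : 0 ≤ s ^ 2 * del n ^ 2 := by positivity
      rw [abs_le]
      constructor <;> nlinarith
    exact mul_le_mul k1 y1 (norm_nonneg _) (by positivity)
  have b2 : ‖2 * γ * ((en n * dn n * xs n s : ℝ) / rho γ n (a n) s) * Yn n (a n) s ^ 3‖ ≤
      2 * ‖γ‖ * (2 * (2 + S)) * B ^ 3 := by
    rw [norm_mul, norm_mul, norm_mul, norm_div, norm_pow, Complex.norm_real, Real.norm_eq_abs,
      Complex.norm_two]
    have k1 : |en n * dn n * xs n s| / ‖rho γ n (a n) s‖ ≤ 2 * (2 + S) := by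
      rw [div_le_iff₀ r0]
      nlinarith
    gcongr
  have b3 : ‖2 * γ * ((en n : ℝ) / rho γ n (a n) s) * Yn n (a n) s ^ 2 * Yn' n (a n) (a' n) s‖ ≤
      2 * (‖γ‖ + 1) * 2 * B ^ 2 * en n * ‖Yn' n (a n) (a' n) s‖ := by
    rw [norm_mul, norm_mul, norm_mul, norm_mul, norm_div, norm_pow, Complex.norm_real,
      Real.norm_eq_abs, Complex.norm_two, abs_of_pos he]
    have k1 : en n / ‖rho γ n (a n) s‖ ≤ 2 * en n := by
      rw [div_le_iff₀ r0]
      nlinarith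
    calc _ ≤ 2 * (‖γ‖ + 1) * (2 * en n) * B ^ 2 * ‖Yn' n (a n) (a' n) s‖ := by
          gcongr; linarith
      _ = _ := by ring
  refine norm_add₃_le.trans ?_
  linarith

lemma exists_norm_Yn'_le (hγ : Adm γ) (h : ∀ n, OrthFamily γ n (a n) (a' n) (a'' n))
    (S : ℝ) (hS : 0 < S) : ∃ M, ∀ᶠ n in atTop, ∀ s, |s| ≤ S →
      ‖Yn' n (a n) (a' n) s‖ ≤ M ∧ ‖Yn'' n (a n) (a' n) (a'' n) s‖ ≤ M := by
  obtain ⟨C, hC, D, hD, hY⟩ := exists_norm_Yn''_le hγ h S hS.le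
  set M := 2 * (2 * C / (S - -S) + (S - -S) * C) with hM
  refine ⟨C + M, ?_⟩
  have h1 := tendsto_en.const_mul D
  rw [mul_zero] at h1
  have h2 := h1.const_mul (S - -S)
  rw [mul_zero] at h2
  filter_upwards [eventually_gt_atTop 0, hY, h1.eventually_lt_const one_pos,
    h2.eventually_lt_const (show (0 : ℝ) < 1 / 2 by norm_num)] with n hn hY k1 k2
  have he := en_pos hn
  have h3 := norm_deriv_le_of_norm_second_deriv_le (by linarith : -S < S)
    (h n).hasDerivAt_Yn (h n).hasDerivAt_Yn' (fun s hs => (hY s (abs_le.2 hs)).1)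
    (fun s hs => (hY s (abs_le.2 hs)).2) (by positivity) k2.le
  intro s hs
  have h4 := h3 s (abs_le.1 hs)
  have h5 := (hY s hs).2
  rw [← hM] at h4
  refine ⟨by linarith, h5.trans ?_⟩
  have : D * en n * ‖Yn' n (a n) (a' n) s‖ ≤ 1 * M :=
    mul_le_mul k1.le h4 (norm_nonneg _) zero_le_one
  linarith

lemma tendsto_Yn'' (hγ : Adm γ) (h : ∀ n, OrthFamily γ n (a n) (a' n) (a'' n)) {s : ℝ} {q : ℂ}
    (hq : Tendsto (fun n => Yn n (a n) s) atTop (nhds q)) :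
    Tendsto (fun n => Yn'' n (a n) (a' n) (a'' n) s) atTop (nhds (s * q + 2 * γ * q ^ 3)) := by
  obtain ⟨M, hM⟩ := exists_norm_Yn'_le hγ h (|s| + 1) (by positivity)
  have hc := Complex.continuous_ofReal
  have hr := tendsto_rho hγ h s
  have t1 : Tendsto (fun n => ((s + s ^ 2 * del n ^ 2 / 4 - del n / 2 : ℝ) : ℂ)) atTop
      (nhds ((s + s ^ 2 * 0 ^ 2 / 4 - 0 / 2 : ℝ) : ℂ)) :=
    (hc.tendsto _).comp (((((tendsto_del.pow 2).const_mul (s ^ 2)).div_const 4).const_add s).sub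
      (tendsto_del.div_const 2))
  have t2 : Tendsto (fun n => ((en n * dn n * xs n s : ℝ) : ℂ) / rho γ n (a n) s) atTop
      (nhds (((1 : ℝ) : ℂ) / 1)) :=
    ((hc.tendsto _).comp (tendsto_en_mul s)).div hr one_ne_zero
  have t3 : Tendsto (fun n => ((en n : ℝ) : ℂ) / rho γ n (a n) s) atTop
      (nhds (((0 : ℝ) : ℂ) / 1)) :=
    ((hc.tendsto _).comp tendsto_en).div hr one_ne_zero
  have t4 : Tendsto (fun n => 2 * γ * ((en n : ℝ) / rho γ n (a n) s) * Yn n (a n) s ^ 2 *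
      Yn' n (a n) (a' n) s) atTop (nhds 0) := by
    have t5 := (((t3.const_mul (2 * γ)).mul (hq.pow 2)).norm).mul_const M
    simp only [Complex.ofReal_zero, zero_div, mul_zero, zero_mul, norm_zero] at t5
    refine squeeze_zero_norm' ?_ t5
    filter_upwards [hM] with n hn
    rw [norm_mul]
    exact mul_le_mul_of_nonneg_left (hn s (by linarith)).1 (norm_nonneg _)
  have t6 := ((t1.mul hq).add ((t2.const_mul (2 * γ)).mul (hq.pow 3))).add t4
  have e : ((s + s ^ 2 * 0 ^ 2 / 4 - 0 / 2 : ℝ) : ℂ) * q + 2 * γ * (((1 : ℝ) : ℂ) / 1) * q ^ 3 + 0 =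
      s * q + 2 * γ * q ^ 3 := by push_cast; ring
  rw [e] at t6
  refine t6.congr' ?_
  filter_upwards [eventually_gt_atTop 0] with n hn
  rw [(h n).Yn''_eq hγ hn]

/-- The rescaled orthogonal polynomials converge to a solution of a Painlevé II equation. -/
lemma exists_painleve_limit {A A' : ℝ → ℝ} (hA : IsAiry A A') (hγ : Adm γ)
    (h : ∀ n, OrthFamily γ n (a n) (a' n) (a'' n)) :
    ∃ q v : ℝ → ℂ, (∀ s, Tendsto (fun n => Yn n (a n) s) atTop (nhds (q s))) ∧
      (∀ s, HasDerivAt q (v s) s) ∧ (∀ s, HasDerivAt v (s * q s + 2 * γ * q s ^ 3) s) ∧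
      Tendsto (fun s => q s / (A s : ℂ)) atTop (nhds 1) := by
  have h1 : ∀ s, ∃ q, Tendsto (fun n => Yn n (a n) s) atTop (nhds q) := fun s => by
    obtain ⟨q, hq⟩ := exists_tendsto_Ff hA hγ (t := s) (p := fun n => orthPoly n (a n) (xs n s))
      fun n _ => (h n).isOrth _
    exact ⟨q, hq.congr fun n => Ff_orthPoly s⟩
  choose q hq using h1
  obtain ⟨v, hv⟩ := exists_hasDerivAt_of_tendsto
    (Φ := fun s z => (s : ℂ) * z + 2 * γ * z ^ 3) (q := q)
    (Y := fun n => Yn (n + 1) (a (n + 1))) (Y' := fun n => Yn' (n + 1) (a (n + 1)) (a' (n + 1)))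
    (Y'' := fun n => Yn'' (n + 1) (a (n + 1)) (a' (n + 1)) (a'' (n + 1)))
    (by have := Complex.continuous_ofReal; fun_prop)
    (fun n => (h (n + 1)).hasDerivAt_Yn) (fun n => (h (n + 1)).hasDerivAt_Yn')
    (fun n => (h (n + 1)).continuous_Yn'' hγ n.succ_pos)
    (fun x y => by
      obtain ⟨M, hM⟩ := exists_norm_Yn'_le hγ h (|x| + |y| + 1) (by positivity)
      refine ⟨M, ((tendsto_add_atTop_nat 1).eventually hM).mono fun n hn s hs => hn s ?_⟩
      have hx := neg_abs_le x
      have hx' := le_abs_self x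
      have hy := neg_abs_le y
      have hy' := le_abs_self y
      rw [abs_le]
      rcases Set.mem_uIcc.1 hs with h | h <;> constructor <;>
        linarith [h.1, h.2, abs_nonneg x, abs_nonneg y])
    (fun s => (hq s).comp (tendsto_add_atTop_nat 1))
    (fun s => (tendsto_Yn'' hγ h (hq s)).comp (tendsto_add_atTop_nat 1))
  refine ⟨q, v, hq, fun s => (hv s).1, fun s => (hv s).2, ?_⟩
  obtain ⟨D, hD, hb⟩ := exists_norm_limit_sub_airy_le hA hγ
  rw [tendsto_iff_norm_sub_tendsto_zero]
  have h2 := (Real.tendsto_exp_neg_atTop_nhds_zero).const_mul D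
  rw [mul_zero] at h2
  refine squeeze_zero' (Eventually.of_forall fun _ => norm_nonneg _) ?_ h2
  filter_upwards [eventually_ge_atTop 0] with s hs
  have hA0 : (A s : ℂ) ≠ 0 := by exact_mod_cast airy_ne_zero hA hs
  have h3 := hb s hs (fun n => orthPoly n (a n) (xs n s)) (fun n _ => (h n).isOrth _) (q s)
    ((hq s).congr fun n => (Ff_orthPoly s).symm)
  rw [div_sub_one hA0, norm_div, Complex.norm_real, Real.norm_eq_abs,
    div_le_iff₀ (abs_pos.2 (airy_ne_zero hA hs))]
  linarith

end

section

lemma adm_one_sub_exp {β : ℂ} (hβ : |β.re| < 1 / 2) :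
    Adm (1 - Complex.exp (-(2 * Real.pi * Complex.I * β))) := by
  intro θ h0 _ h
  set z : ℂ := -(2 * Real.pi * Complex.I * β) with hz
  have him : z.im = -(2 * Real.pi * β.re) := by simp [hz]
  have hre := congrArg Complex.re h
  have him' := congrArg Complex.im h
  simp only [Complex.sub_re, Complex.sub_im, Complex.mul_re, Complex.mul_im, Complex.one_re,
    Complex.one_im, Complex.ofReal_re, Complex.ofReal_im, Complex.zero_re, Complex.zero_im,
    Complex.exp_re, Complex.exp_im] at hre him'
  have hθ : θ ≠ 0 := by
    rintro rfl
    simp at hre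
  have hE := Real.exp_pos z.re
  have hb := abs_lt.1 hβ
  have hpi := Real.pi_pos
  have hs : Real.sin z.im = 0 := by
    have h1 : (Real.exp z.re * θ) * Real.sin z.im = 0 := by linarith
    exact (mul_eq_zero.1 h1).resolve_left (by positivity)
  have hz0 : z.im = 0 := (Real.sin_eq_zero_iff_of_lt_of_lt (by rw [him]; nlinarith)
    (by rw [him]; nlinarith)).1 hs
  rw [hz0, Real.cos_zero] at hre
  have hθ' : 0 < θ := lt_of_le_of_ne h0 (Ne.symm hθ)
  nlinarith [mul_pos hE hθ']

variable {β : ℂ} {l : ℝ}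

lemma w_eq (l : ℝ) (β : ℂ) (x : ℝ) : w l β x = Complex.exp (Real.pi * Complex.I * β) *
    ((gauss 0 x : ℂ) - (1 - Complex.exp (-(2 * Real.pi * Complex.I * β))) *
      (Set.Ici l).indicator (fun x => (gauss 0 x : ℂ)) x) := by
  have e : gauss 0 x = Real.exp (-x ^ 2) := by rw [gauss]; congr 1; ring
  have e2 : Complex.exp (-(Real.pi * Complex.I * β)) = Complex.exp (Real.pi * Complex.I * β) *
      Complex.exp (-(2 * Real.pi * Complex.I * β)) := by
    rw [← Complex.exp_add]; congr 1; ring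
  rw [w, ← e]
  rcases lt_or_ge x l with h | h
  · rw [if_pos h, Set.indicator_of_notMem (by simpa using h)]; ring
  · rw [if_neg (not_lt.2 h), Set.indicator_of_mem (by simpa using h), e2]; ring

lemma integral_eval_mul_w (f : ℂ[X]) : ∫ x : ℝ, f.eval (x : ℂ) * w l β x =
    Complex.exp (Real.pi * Complex.I * β) * (Real.exp (l ^ 2) : ℂ)⁻¹ *
      L (1 - Complex.exp (-(2 * Real.pi * Complex.I * β))) l (f.comp (X + C (l : ℂ))) := by
  set γ := 1 - Complex.exp (-(2 * Real.pi * Complex.I * β)) with hγ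
  have hE : (Real.exp (l ^ 2) : ℂ) ≠ 0 := by exact_mod_cast (Real.exp_pos _).ne'
  have e1 : (f.comp (X + C (l : ℂ))).comp (X - C (l : ℂ)) = f := by
    rw [comp_assoc]; simp
  have hi := integrable_eval_mul_gauss f 0
  have e2 : ∀ x : ℝ, f.eval (x : ℂ) * w l β x = Complex.exp (Real.pi * Complex.I * β) *
      (f.eval (x : ℂ) * (gauss 0 x : ℂ) - γ *
        (Set.Ici l).indicator (fun x => f.eval (x : ℂ) * (gauss 0 x : ℂ)) x) := fun x => by
    have e3 : (Set.Ici l).indicator (fun x => f.eval (x : ℂ) * (gauss 0 x : ℂ)) x =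
        f.eval (x : ℂ) * (Set.Ici l).indicator (fun x => (gauss 0 x : ℂ)) x :=
      Set.indicator_mul_right _ _ _
    rw [w_eq, e3]; ring
  rw [integral_congr_ae (Eventually.of_forall e2), integral_const_mul,
    integral_sub hi ((hi.indicator measurableSet_Ici).const_mul γ), integral_const_mul,
    integral_indicator measurableSet_Ici, integral_Ici_eq_integral_Ioi, L_eq_comp, e1, L_apply]
  field_simp
  simp

/-- The moment functional of the discontinuous Gaussian weight. -/
def moment (l : ℝ) (β : ℂ) : ℂ[X] →ₗ[ℂ] ℂ where
  toFun f := ∫ x : ℝ, f.eval (x : ℂ) * w l β x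
  map_add' f g := by
    simp only [integral_eval_mul_w, add_comp, map_add, mul_add]
  map_smul' c f := by
    simp only [integral_eval_mul_w, smul_comp, map_smul, smul_eq_mul, RingHom.id_apply]
    ring

lemma moment_mul_conjPoly_ne_zero (hβ : |β.re| < 1 / 2) (l : ℝ) {f : ℂ[X]} (hf : f ≠ 0) :
    moment l β (f * conjPoly f) ≠ 0 := by
  have e : (conjPoly f).comp (X + C (l : ℂ)) = conjPoly (f.comp (X + C (l : ℂ))) := by
    rw [conjPoly, conjPoly, Polynomial.map_comp]; simp
  change (∫ x : ℝ, (f * conjPoly f).eval (x : ℂ) * w l β x) ≠ 0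
  rw [integral_eval_mul_w, mul_comp, e]
  refine mul_ne_zero (by simp [Complex.exp_ne_zero])
    (L_mul_conjPoly_ne_zero (adm_one_sub_exp hβ) l fun h0 => hf ?_)
  have e1 : (f.comp (X + C (l : ℂ))).comp (X - C (l : ℂ)) = f := by
    rw [comp_assoc]; simp
  rw [← e1, h0, zero_comp]

lemma H_ne_zero (hβ : |β.re| < 1 / 2) (n : ℕ) (l : ℝ) : H n l β ≠ 0 := by
  have := hankel_det_ne_zero (fun f hf => moment_mul_conjPoly_ne_zero hβ l hf) n
  simpa [moment, H] using this

lemma monicOrthPoly_orthPoly {n : ℕ} {a a' a'' : ℝ → ℕ → ℂ}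
    (h : OrthFamily (1 - Complex.exp (-(2 * Real.pi * Complex.I * β))) n a a' a'') (l : ℝ) :
    MonicOrthPoly n l β (orthPoly n a l) := by
  refine ⟨(monic_ofCoeffs (h.1 l).1).comp_X_sub_C _, ?_, fun m hm => ?_⟩
  · rw [orthPoly, natDegree_comp, natDegree_X_sub_C, mul_one, natDegree_ofCoeffs (h.1 l).1]
  have h1 := integral_eval_mul_w (l := l) (β := β) (orthPoly n a l * X ^ m)
  rw [orthPoly, comp_mul_eq, comp_assoc] at h1
  simp only [sub_comp, X_comp, C_comp, add_sub_cancel_right, comp_X] at h1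
  rw [L_mul_eq_zero_of_natDegree_lt (h.2.2.2 l) (by
    rw [natDegree_comp, natDegree_X_add_C, natDegree_X_pow, mul_one]; exact hm), mul_zero] at h1
  rw [← h1]
  refine integral_congr_ae (Eventually.of_forall fun x => ?_)
  simp [orthPoly]

lemma normalization_eq {n : ℕ} (hn : 0 < n) (t : ℝ) :
    (2 / ((n : ℝ) * Real.exp 1)) ^ ((n : ℝ) / 2) * (n : ℝ) ^ (-(1 : ℝ) / 6) *
      Real.exp (-(t * (n : ℝ) ^ ((1 : ℝ) / 3))) / Real.sqrt (2 * Real.pi) =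
    cn n * Real.exp (-xs n t ^ 2 / 2) * Real.exp (t ^ 2 / 4 * del n) := by
  have hn' : (0 : ℝ) < n := by exact_mod_cast hn
  have hh0 := hh_pos hn
  have hd := del_pos hn
  have h3 := del_cube hn
  have hpi := Real.sqrt_pos.2 Real.pi_pos
  have h2 := Real.sqrt_pos.2 (show (0 : ℝ) < 2 by norm_num)
  have e1 : (2 / ((n : ℝ) * Real.exp 1)) ^ ((n : ℝ) / 2) = (hh n ^ n * Real.exp (n / 2))⁻¹ := by
    rw [show 2 / ((n : ℝ) * Real.exp 1) = (hh n ^ 2 * Real.exp 1)⁻¹ by rw [hh_sq]; field_simp,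
      Real.inv_rpow (by positivity), Real.mul_rpow (by positivity) (by positivity),
      Real.exp_one_rpow, ← Real.rpow_natCast (hh n) 2, ← Real.rpow_mul hh0.le,
      ← Real.rpow_natCast (hh n) n]
    congr 3; push_cast; ring
  have e2 : (n : ℝ) ^ ((1 : ℝ) / 3) = n * del n ^ 2 := by
    have : (n : ℝ) ^ ((1 : ℝ) / 3) * del n = 1 := by
      rw [del, ← Real.rpow_add hn']; norm_num
    have h4 : (n * del n ^ 2) * del n = 1 := by rw [← h3]; ring
    exact mul_right_cancel₀ hd.ne' (this.trans h4.symm)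
  have e3 : (n : ℝ) ^ (-(1 : ℝ) / 6) * (Real.sqrt n * del n) = 1 := by
    rw [del, Real.sqrt_eq_rpow, ← Real.rpow_add hn', ← Real.rpow_add hn']; norm_num
  have e4 : hh n * Real.sqrt 2 = Real.sqrt n := by
    rw [hh, ← Real.sqrt_mul (by positivity)]; congr 1; ring
  have e5 : xs n t ^ 2 / 2 = n + t * (n * del n ^ 2) + t ^ 2 / 4 * del n := by
    rw [xs_eq, mul_pow, mul_pow, hh_sq]
    linear_combination t ^ 2 / 4 * del n * h3
  have e6 : Real.exp (n / 2) * Real.exp (-xs n t ^ 2 / 2) * Real.exp (t ^ 2 / 4 * del n) =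
      (Real.exp (n / 2))⁻¹ * Real.exp (-(t * (n * del n ^ 2))) := by
    rw [← Real.exp_neg, ← Real.exp_add, ← Real.exp_add, ← Real.exp_add, neg_div, e5]
    congr 1; ring
  have e7 : (n : ℝ) ^ (-(1 : ℝ) / 6) / Real.sqrt (2 * Real.pi) =
      1 / (2 * Real.sqrt Real.pi * hh n * del n) := by
    rw [Real.sqrt_mul (by norm_num), div_eq_div_iff (by positivity) (by positivity)]
    have h22 : Real.sqrt 2 * Real.sqrt 2 = 2 := Real.mul_self_sqrt (by norm_num)
    rw [← e4] at e3
    linear_combination (-Real.sqrt Real.pi * hh n * del n * (n : ℝ) ^ (-(1 : ℝ) / 6)) * h22 +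
      Real.sqrt 2 * Real.sqrt Real.pi * e3
  rw [e1, e2]
  calc _ = (hh n ^ n)⁻¹ * ((Real.exp (n / 2))⁻¹ * Real.exp (-(t * (n * del n ^ 2)))) *
        ((n : ℝ) ^ (-(1 : ℝ) / 6) / Real.sqrt (2 * Real.pi)) := by rw [mul_inv]; ring
    _ = _ := by
      rw [← e6, e7, cn]
      field_simp
      ring

end

end PR

/-- Plancherel–Rotach type asymptotics at the critical point:
`p_n(λ0) = (√(2π)/κ)·(ne/2)^{n/2}·n^{1/6}·e^{t·n^{1/3}}·(u(t) + o(1))`. -/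
theorem plancherel_rotach_asymptotics
    (β κ : ℂ) (hβ : |β.re| < 1 / 2) (hβ0 : β ≠ 0) (hκ0 : κ ≠ 0)
    (hκ : κ ^ 2 = 1 - Complex.exp (-(2 * Real.pi * Complex.I * β)))
    (t : ℝ) (A A' : ℝ → ℝ) (hA : IsAiry A A') :
    ∃ (u : ℝ → ℂ) (N : ℕ) (p : ℕ → Polynomial ℂ), IsAblowitzSegur A κ u ∧
      (∀ n : ℕ, N ≤ n → H n (lam0 t n) β ≠ 0 ∧ MonicOrthPoly n (lam0 t n) β (p n)) ∧
      Tendsto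
        (fun n : ℕ =>
          κ * (p n).eval ((lam0 t n : ℝ) : ℂ) *
            (((2 / ((n : ℝ) * Real.exp 1)) ^ ((n : ℝ) / 2) : ℝ) : ℂ) *
            (((n : ℝ) ^ (-(1 : ℝ) / 6) : ℝ) : ℂ) *
            (Real.exp (-(t * (n : ℝ) ^ ((1 : ℝ) / 3))) : ℂ) /
            (Real.sqrt (2 * Real.pi) : ℂ))
        atTop (nhds (u t)) := by
  have hγ := PR.adm_one_sub_exp hβ
  choose a a' a'' h using PR.exists_orthogonal hγ
  obtain ⟨q, v, hq, hqv, hv, hqA⟩ := PR.exists_painleve_limit hA hγ h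
  have hu : ∀ s, HasDerivAt (fun s => κ * q s) (κ * v s) s := fun s => (hqv s).const_mul κ
  have hu' : deriv (fun s => κ * q s) = fun s => κ * v s := funext fun s => (hu s).deriv
  have hu2 := fun s => (hv s).const_mul κ
  refine ⟨fun s => κ * q s, 0, fun n => PR.orthPoly n (a n) (lam0 t n),
    ⟨fun s => (hu s).differentiableAt, ?_, fun s => ?_, ?_⟩,
    fun n _ => ⟨PR.H_ne_zero hβ n _, PR.monicOrthPoly_orthPoly (h n) _⟩, ?_⟩
  · rw [hu']
    exact fun s => (hu2 s).differentiableAt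
  · rw [hu', (hu2 s).deriv, ← hκ]
    ring
  · have := hqA.const_mul κ
    rw [mul_one] at this
    exact this.congr fun s => by ring
  · have h1 : Tendsto (fun n => ((Real.exp (t ^ 2 / 4 * PR.del n) : ℝ) : ℂ)) atTop
        (nhds ((Real.exp (t ^ 2 / 4 * 0) : ℝ) : ℂ)) :=
      (Complex.continuous_ofReal.tendsto _).comp
        ((Real.continuous_exp.tendsto _).comp (PR.tendsto_del.const_mul _))
    have h2 := ((hq t).mul h1).const_mul κ
    rw [mul_zero, Real.exp_zero, Complex.ofReal_one, mul_one] at h2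
    refine h2.congr' ?_
    filter_upwards [eventually_gt_atTop 0] with n hn
    have h3 := congrArg (fun x : ℝ => (x : ℂ)) (PR.normalization_eq hn t)
    rw [Complex.ofReal_div, Complex.ofReal_mul, Complex.ofReal_mul, Complex.ofReal_mul,
      Complex.ofReal_mul] at h3
    rw [PR.lam0_eq, ← PR.Ff_orthPoly, PR.Ff]
    linear_combination -κ * (PR.orthPoly n (a n) (PR.xs n t)).eval (PR.xs n t : ℂ) * h3
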